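/- Two-layer random network setup: fix an integer c ≥ 2. For positive integers d and n with n ≥ c, let W¹ be an n×d random matrix with i.i.d. N(0,1/d) entries and W² a c×n random matrix with i.i.d. N(0,1/n) entries, independent of each other. Given (W¹,W²), for an input x ~ N(0, I_d) on ℝ^d define the n×n diagonal matrix D = D(x) with D_ii = 1 if (W¹x)_i ≥ 0 and D_ii = 0 otherwise; y = σ(W¹x) with σ the entrywise ReLU; z = W²y ∈ ℝ^c; p = softmax(z); A = A(x) = diag(p) − p pᵀ; and the output Hessian M = M(W¹,W²) = E_x[ D (W²)ᵀ A W² D ], an n×n symmetric positive semidefinite matrix. Let S₁ ⊆ ℝ^n be a top-(c−1) eigenspace of M (a (c−1)-dimensional subspace spanned by eigenvectors of the c−1 largest eigenvalues of M), and let S₂ = { (W²)ᵀ u : u ∈ ℝ^c, ⟨u, 1_c⟩ = 0 }, the image under (W²)ᵀ of the orthogonal complement of the all-ones vector (a (c−1)-dimensional subspace almost surely). Then for every ε > 0, lim_{n→∞} lim_{d→∞} P_{(W¹,W²)}[ Overlap(S₁, S₂) > 1 − ε ] = 1. -/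

import Mathlib

open MeasureTheory ProbabilityTheory Filter Matrix
open scoped NNReal ENNReal

/-- The standard Gaussian input distribution `N(0, I_d)` on `ℝ^d`. -/
noncomputable def inputMeasure (d : ℕ) : Measure (Fin d → ℝ) :=
  Measure.pi fun _ => gaussianReal 0 1

/-- The joint law of the two weight matrices: `W¹` is `n × d` with i.i.d. `N(0, 1/d)`
entries and, independently, `W²` is `c × n` with i.i.d. `N(0, 1/n)` entries. -/
noncomputable def weightMeasure (c d n : ℕ) :
    Measure (((Fin n × Fin d) → ℝ) × ((Fin c × Fin n) → ℝ)) :=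
  (Measure.pi fun _ : Fin n × Fin d => gaussianReal 0 (d : ℝ≥0)⁻¹).prod
    (Measure.pi fun _ : Fin c × Fin n => gaussianReal 0 (n : ℝ≥0)⁻¹)

/-- First-layer weights as an `n × d` matrix. -/
def W1of {n d : ℕ} (w : (Fin n × Fin d) → ℝ) : Matrix (Fin n) (Fin d) ℝ :=
  Matrix.of fun i j => w (i, j)

/-- Second-layer weights as a `c × n` matrix. -/
def W2of {c n : ℕ} (w : (Fin c × Fin n) → ℝ) : Matrix (Fin c) (Fin n) ℝ :=
  Matrix.of fun i j => w (i, j)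

/-- The softmax function on `ℝ^c`. -/
noncomputable def softmaxFn {c : ℕ} (z : Fin c → ℝ) : Fin c → ℝ :=
  fun i => Real.exp (z i) / ∑ k, Real.exp (z k)

/-- `A(z) = diag(softmax z) - softmax z (softmax z)ᵀ`. -/
noncomputable def Amat {c : ℕ} (z : Fin c → ℝ) : Matrix (Fin c) (Fin c) ℝ :=
  Matrix.diagonal (softmaxFn z) - Matrix.vecMulVec (softmaxFn z) (softmaxFn z)

/-- The diagonal ReLU-activation pattern matrix `D` of a pre-activation vector. -/
noncomputable def Dmat {n : ℕ} (u : Fin n → ℝ) : Matrix (Fin n) (Fin n) ℝ :=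
  Matrix.diagonal fun i => if 0 ≤ u i then (1 : ℝ) else 0

/-- The logits `z = W² σ(W¹ x)` of the two-layer ReLU network. -/
noncomputable def logits {c d n : ℕ}
    (w : ((Fin n × Fin d) → ℝ) × ((Fin c × Fin n) → ℝ)) (x : Fin d → ℝ) :
    Fin c → ℝ :=
  (W2of w.2).mulVec fun i => max ((W1of w.1).mulVec x i) 0

/-- The single-input output Hessian `D (W²)ᵀ A W² D` of the first layer. -/
noncomputable def hessOne {c d n : ℕ}
    (w : ((Fin n × Fin d) → ℝ) × ((Fin c × Fin n) → ℝ)) (x : Fin d → ℝ) :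
    Matrix (Fin n) (Fin n) ℝ :=
  Dmat ((W1of w.1).mulVec x) * (W2of w.2)ᵀ * Amat (logits w x) * W2of w.2 *
    Dmat ((W1of w.1).mulVec x)

/-- The output Hessian `M = E_x[D (W²)ᵀ A W² D]` (entrywise expectation over the
Gaussian input `x ~ N(0, I_d)`). -/
noncomputable def outputHessian (c d n : ℕ)
    (w : ((Fin n × Fin d) → ℝ) × ((Fin c × Fin n) → ℝ)) :
    Matrix (Fin n) (Fin n) ℝ :=
  Matrix.of fun i j => ∫ x, hessOne w x i j ∂(inputMeasure d)

/-- Squared Frobenius norm. -/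
noncomputable def frob2 {n m : ℕ} (A : Matrix (Fin n) (Fin m) ℝ) : ℝ :=
  ∑ i, ∑ j, (A i j) ^ 2

/-- The coordinate-sum linear functional `u ↦ ∑ i, u i` on `ℝ^c`. -/
noncomputable def sumLin (c : ℕ) : (Fin c → ℝ) →ₗ[ℝ] ℝ where
  toFun u := ∑ i, u i
  map_add' a b := by simp [Finset.sum_add_distrib]
  map_smul' r a := by simp [Finset.mul_sum]

/-- Orthonormality of a finite family of vectors with respect to the dot product. -/
def DotOrthonormal {k n : ℕ} (v : Fin k → Fin n → ℝ) : Prop :=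
  ∀ a b, v a ⬝ᵥ v b = if a = b then 1 else 0

/-- An orthonormal basis of eigenvectors `b` of `M` with eigenvalues `lam`. -/
def IsEigenbasis {n : ℕ} (M : Matrix (Fin n) (Fin n) ℝ) (b : Fin n → Fin n → ℝ)
    (lam : Fin n → ℝ) : Prop :=
  DotOrthonormal b ∧ ∀ i, M *ᵥ b i = lam i • b i

/-- An orthonormal family of eigenvectors, with eigenvalues expressed as Rayleigh quotients. -/
def IsEigenfamily {k n : ℕ} (M : Matrix (Fin n) (Fin n) ℝ) (v : Fin k → Fin n → ℝ) : Prop :=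
  DotOrthonormal v ∧ ∀ a, M *ᵥ v a = (v a ⬝ᵥ M *ᵥ v a) • v a

/-- The part of `y` orthogonal to an orthonormal family `v`. -/
def orthResidual {k n : ℕ} (v : Fin k → Fin n → ℝ) (y : Fin n → ℝ) : Fin n → ℝ :=
  y - ∑ a, (v a ⬝ᵥ y) • v a

/-- An orthonormal family of eigenvectors belonging to the largest eigenvalues. -/
def IsTopFamily {k n : ℕ} (M : Matrix (Fin n) (Fin n) ℝ) (v : Fin k → Fin n → ℝ) : Prop :=
  IsEigenfamily M v ∧ ∀ y a, orthResidual v y ⬝ᵥ M *ᵥ orthResidual v y ≤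
    (v a ⬝ᵥ M *ᵥ v a) * (orthResidual v y ⬝ᵥ orthResidual v y)

theorem DotOrthonormal.comp {k l n : ℕ} {v : Fin k → Fin n → ℝ} (hv : DotOrthonormal v)
    {f : Fin l → Fin k} (hf : Function.Injective f) : DotOrthonormal fun a => v (f a) := by
  intro a b
  rw [hv]
  simp [hf.eq_iff]

theorem DotOrthonormal.dot_sum {k n : ℕ} {v : Fin k → Fin n → ℝ} (hv : DotOrthonormal v)
    (α : Fin k → ℝ) (b : Fin k) : v b ⬝ᵥ ∑ a, α a • v a = α b := by
  rw [dotProduct_sum]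
  simp [dotProduct_smul, hv b]

theorem dot_orthResidual {k n : ℕ} {v : Fin k → Fin n → ℝ} (hv : DotOrthonormal v)
    (y : Fin n → ℝ) (b : Fin k) : v b ⬝ᵥ orthResidual v y = 0 := by
  rw [orthResidual, dotProduct_sub, hv.dot_sum, sub_self]

theorem orthResidual_of_dot_eq_zero {k n : ℕ} {v : Fin k → Fin n → ℝ} {y : Fin n → ℝ}
    (h : ∀ b, v b ⬝ᵥ y = 0) : orthResidual v y = y := by
  simp [orthResidual, h]

theorem DotOrthonormal.transpose_mul_self {n : ℕ} {b : Fin n → Fin n → ℝ}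
    (hb : DotOrthonormal b) : (Matrix.of b)ᵀ * Matrix.of b = 1 := by
  apply mul_eq_one_comm.mp
  ext i j
  rw [Matrix.one_apply, ← hb i j]
  rfl

theorem DotOrthonormal.expand {n : ℕ} {b : Fin n → Fin n → ℝ} (hb : DotOrthonormal b)
    (y : Fin n → ℝ) : ∑ i, (b i ⬝ᵥ y) • b i = y := by
  have h := congrArg (fun A => A *ᵥ y) hb.transpose_mul_self
  simp only [one_mulVec, ← mulVec_mulVec] at h
  conv_rhs => rw [← h]
  ext j
  simp [mulVec, dotProduct, mul_comm]

theorem DotOrthonormal.parseval {n : ℕ} {b : Fin n → Fin n → ℝ} (hb : DotOrthonormal b)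
    (y z : Fin n → ℝ) : y ⬝ᵥ z = ∑ i, (b i ⬝ᵥ y) * (b i ⬝ᵥ z) := by
  conv_lhs => rw [← hb.expand y]
  rw [sum_dotProduct]
  simp

theorem dotProduct_mulVec_symm {n : ℕ} {M : Matrix (Fin n) (Fin n) ℝ} (hM : Mᵀ = M)
    (y z : Fin n → ℝ) : y ⬝ᵥ M *ᵥ z = z ⬝ᵥ M *ᵥ y := by
  rw [dotProduct_mulVec, ← mulVec_transpose, hM, dotProduct_comm]

theorem IsEigenbasis.transpose_eq {n : ℕ} {M : Matrix (Fin n) (Fin n) ℝ}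
    {b : Fin n → Fin n → ℝ} {lam : Fin n → ℝ} (h : IsEigenbasis M b lam) :
    M = (Matrix.of b)ᵀ * diagonal lam * Matrix.of b := by
  have h1 : M * (Matrix.of b)ᵀ = (Matrix.of b)ᵀ * diagonal lam := by
    ext i j
    have := congrFun (h.2 j) i
    rw [Matrix.mul_diagonal]
    simpa [mulVec, Matrix.mul_apply, dotProduct, mul_comm] using this
  rw [← h1, Matrix.mul_assoc, h.1.transpose_mul_self, Matrix.mul_one]

theorem IsEigenbasis.charpoly {n : ℕ} {M : Matrix (Fin n) (Fin n) ℝ}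
    {b : Fin n → Fin n → ℝ} {lam : Fin n → ℝ} (h : IsEigenbasis M b lam) :
    M.charpoly = ∏ i, (Polynomial.X - Polynomial.C (lam i)) := by
  rw [h.transpose_eq, Matrix.mul_assoc, Matrix.charpoly_mul_comm, Matrix.mul_assoc,
    mul_eq_one_comm.mp h.1.transpose_mul_self, Matrix.mul_one, Matrix.charpoly_diagonal]

theorem IsEigenbasis.quadratic {n : ℕ} {M : Matrix (Fin n) (Fin n) ℝ}
    {b : Fin n → Fin n → ℝ} {lam : Fin n → ℝ} (h : IsEigenbasis M b lam) (hM : Mᵀ = M)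
    (y : Fin n → ℝ) : y ⬝ᵥ M *ᵥ y = ∑ i, lam i * (b i ⬝ᵥ y) ^ 2 := by
  rw [h.1.parseval y]
  refine Finset.sum_congr rfl fun i _ => ?_
  rw [dotProduct_mulVec_symm hM, h.2, dotProduct_smul, dotProduct_comm y, smul_eq_mul]
  ring

theorem exists_isEigenbasis {n : ℕ} {M : Matrix (Fin n) (Fin n) ℝ} (hM : Mᵀ = M) :
    ∃ b lam, IsEigenbasis M b lam := by
  have hH : M.IsHermitian := by
    rw [Matrix.IsHermitian, conjTranspose_eq_transpose_of_trivial, hM]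
  refine ⟨fun i => ⇑(hH.eigenvectorBasis i), hH.eigenvalues, fun a b => ?_, fun i => ?_⟩
  · have := orthonormal_iff_ite.mp hH.eigenvectorBasis.orthonormal b a
    rw [EuclideanSpace.inner_eq_star_dotProduct] at this
    simpa [eq_comm] using this
  · exact hH.mulVec_eigenvectorBasis i

theorem exists_perm_comp_eq {n : ℕ} {f g : Fin n → ℝ}
    (h : ∏ i, (Polynomial.X - Polynomial.C (f i)) = ∏ i, (Polynomial.X - Polynomial.C (g i))) :
    ∃ σ : Equiv.Perm (Fin n), ∀ i, f (σ i) = g i := by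
  have h2 := congrArg Polynomial.roots h
  have key : ∀ f : Fin n → ℝ, (∏ i, (Polynomial.X - Polynomial.C (f i))).roots =
      Multiset.map f Finset.univ.val := by
    intro f
    have := Polynomial.roots_multiset_prod_X_sub_C (Multiset.map f Finset.univ.val)
    rwa [Multiset.map_map] at this
  rw [key, key] at h2
  have hcard : ∀ r : ℝ, Nonempty ({i // g i = r} ≃ {i // f i = r}) := by
    intro r
    have := congrArg (Multiset.count r) h2
    rw [Multiset.count_map, Multiset.count_map] at this
    refine ⟨Fintype.equivOfCardEq ?_⟩
    rw [Fintype.card_subtype, Fintype.card_subtype]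
    simp only [Finset.card, Finset.filter_val, eq_comm] at this ⊢
    exact this
  refine ⟨Equiv.ofFiberEquiv fun r => (hcard r).some, fun i => ?_⟩
  exact Equiv.ofFiberEquiv_map _ i

theorem exists_isEigenbasis_of_charpoly {n : ℕ} {M : Matrix (Fin n) (Fin n) ℝ} (hM : Mᵀ = M)
    {lam : Fin n → ℝ} (h : M.charpoly = ∏ i, (Polynomial.X - Polynomial.C (lam i))) :
    ∃ b, IsEigenbasis M b lam := by
  obtain ⟨b, l, hb⟩ := exists_isEigenbasis hM
  obtain ⟨σ, hσ⟩ := exists_perm_comp_eq (hb.charpoly.symm.trans h)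
  exact ⟨fun i => b (σ i), hb.1.comp σ.injective, fun i => by rw [hb.2, hσ]⟩

theorem exists_antitone_isEigenbasis {n : ℕ} {M : Matrix (Fin n) (Fin n) ℝ} (hM : Mᵀ = M) :
    ∃ b lam, IsEigenbasis M b lam ∧ Antitone lam := by
  obtain ⟨b, l, hb⟩ := exists_isEigenbasis hM
  let σ := Tuple.sort fun i => - l i
  have hs : Monotone ((fun i => - l i) ∘ σ) := Tuple.monotone_sort fun i => - l i
  refine ⟨fun i => b (σ i), fun i => l (σ i), ⟨hb.1.comp σ.injective, fun i => hb.2 _⟩, ?_⟩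
  intro i j hij
  have := hs hij
  simp only [Function.comp] at this
  linarith

theorem sum_smul_dotProduct_mulVec {ι : Type*} [Fintype ι] [DecidableEq ι] {n : ℕ}
    (M : Matrix (Fin n) (Fin n) ℝ) (w : ι → Fin n → ℝ) (α : ι → ℝ)
    (h : ∀ i j, i ≠ j → w i ⬝ᵥ M *ᵥ w j = 0) :
    (∑ i, α i • w i) ⬝ᵥ M *ᵥ (∑ i, α i • w i) = ∑ i, α i ^ 2 * (w i ⬝ᵥ M *ᵥ w i) := by
  rw [mulVec_sum, sum_dotProduct]
  refine Finset.sum_congr rfl fun i _ => ?_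
  rw [dotProduct_sum, Finset.sum_eq_single i]
  · simp [mulVec_smul]; ring
  · intro j _ hj
    simp [mulVec_smul, h i j hj.symm]
  · simp

theorem isTopFamily_of_charpoly {k n : ℕ} (hkn : k ≤ n) {M : Matrix (Fin n) (Fin n) ℝ}
    (hM : Mᵀ = M) {lam : Fin n → ℝ} (hlam : Antitone lam)
    (hchar : M.charpoly = ∏ i, (Polynomial.X - Polynomial.C (lam i)))
    {v : Fin k → Fin n → ℝ} (hv : DotOrthonormal v)
    (hMv : ∀ (a : Fin k) (h : (a : ℕ) < n), M *ᵥ v a = lam ⟨a, h⟩ • v a) :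
    IsTopFamily M v := by
  have hMv' : ∀ a : Fin k, M *ᵥ v a = lam (Fin.castLE hkn a) • v a := fun a => hMv a _
  have hray : ∀ a, v a ⬝ᵥ M *ᵥ v a = lam (Fin.castLE hkn a) := by
    intro a
    rw [hMv', dotProduct_smul, hv]
    simp
  refine ⟨⟨hv, fun a => by rw [hray, hMv']⟩, fun y₀ a₀ => ?_⟩
  obtain ⟨b, hb⟩ := exists_isEigenbasis_of_charpoly hM hchar
  have hy : ∀ a, v a ⬝ᵥ orthResidual v y₀ = 0 := dot_orthResidual hv y₀
  generalize orthResidual v y₀ = y at hy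
  rw [hray]
  by_contra! hlt
  set r := lam (Fin.castLE hkn a₀) with hr
  let J := {a : Fin k // r < lam (Fin.castLE hkn a)}
  let w : Option J → Fin n → ℝ := fun o => o.elim y fun a => v a
  have hort : ∀ i j, i ≠ j → w i ⬝ᵥ w j = 0 := by
    rintro (_ | i) (_ | j) hij
    · exact absurd rfl hij
    · exact (dotProduct_comm _ _).trans (hy _)
    · exact hy _
    · refine (hv _ _).trans (if_neg fun h => hij ?_)
      rw [Subtype.ext h]
  have hortM : ∀ i j, i ≠ j → w i ⬝ᵥ M *ᵥ w j = 0 := by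
    rintro i (_ | j) hij
    · rw [dotProduct_mulVec_symm hM]
      rcases i with (_ | i)
      · exact absurd rfl hij
      · have : w (some i) = v i := rfl
        rw [this, hMv', dotProduct_smul, dotProduct_comm]
        exact smul_eq_zero_of_right _ (hy _)
    · have : w (some j) = v j := rfl
      rw [this, hMv', dotProduct_smul, ← this, hort _ _ hij, smul_zero]
  have hpos : ∀ o, r * (w o ⬝ᵥ w o) < w o ⬝ᵥ M *ᵥ w o := by
    rintro (_ | a)
    · exact hlt
    · have : w (some a) = v a := rfl
      rw [this, hray, hv]
      simpa using a.2
  let K := {i : Fin n // r < lam i}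
  let T : (Option J → ℝ) →ₗ[ℝ] (K → ℝ) :=
    (Matrix.of fun (i : K) (o : Option J) => b i ⬝ᵥ w o).mulVecLin
  have hcard : Fintype.card K ≤ Fintype.card J := by
    have hlt : ∀ i : K, (i : Fin n) < Fin.castLE hkn a₀ := fun i => by
      by_contra! hle
      exact absurd (hlam hle) (not_le.mpr i.2)
    refine Fintype.card_le_of_injective
      (fun i => ⟨⟨i.1, lt_trans (hlt i) a₀.2⟩, i.2⟩) fun i j hij => ?_
    exact Subtype.ext (Fin.ext (congrArg (fun x : J => (x.1 : ℕ)) hij))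
  have hker : LinearMap.ker T ≠ ⊥ := by
    apply LinearMap.ker_ne_bot_of_finrank_lt
    simp only [Module.finrank_fintype_fun_eq_card, Fintype.card_option]
    omega
  obtain ⟨α, hα, hα0⟩ := (Submodule.ne_bot_iff _).mp hker
  set u := ∑ o, α o • w o with hu
  have hbu : ∀ i : Fin n, r < lam i → b i ⬝ᵥ u = 0 := by
    intro i hi
    have := congrFun (LinearMap.mem_ker.mp hα) ⟨i, hi⟩
    simp only [T, mulVecLin_apply, mulVec, dotProduct, Matrix.of_apply, Pi.zero_apply] at this
    rw [hu, dotProduct_sum, ← this]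
    refine Finset.sum_congr rfl fun o _ => ?_
    rw [dotProduct_smul, smul_eq_mul, mul_comm]
    rfl
  have hle : u ⬝ᵥ M *ᵥ u ≤ r * (u ⬝ᵥ u) := by
    rw [hb.quadratic hM, hb.1.parseval u u, Finset.mul_sum]
    refine Finset.sum_le_sum fun i _ => ?_
    by_cases hi : r < lam i
    · simp [hbu i hi]
    · rw [← sq]
      exact mul_le_mul_of_nonneg_right (not_lt.mp hi) (sq_nonneg _)
  have hgt : r * (u ⬝ᵥ u) < u ⬝ᵥ M *ᵥ u := by
    have h1 : u ⬝ᵥ u = ∑ o, α o ^ 2 * (w o ⬝ᵥ w o) := by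
      have := sum_smul_dotProduct_mulVec 1 w α (by simpa only [one_mulVec] using hort)
      simpa only [one_mulVec] using this
    rw [sum_smul_dotProduct_mulVec M w α hortM, h1, Finset.mul_sum]
    obtain ⟨o, ho⟩ := Function.ne_iff.mp hα0
    refine Finset.sum_lt_sum (fun o _ => ?_) ⟨o, Finset.mem_univ _, ?_⟩
    · have := mul_le_mul_of_nonneg_left (hpos o).le (sq_nonneg (α o))
      linarith
    · have := mul_lt_mul_of_pos_left (hpos o) (sq_pos_of_ne_zero ho)
      linarith
  exact absurd hle (not_le.mpr hgt)

/-- The sum of the values of the quadratic form `N` on the family `v`. -/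
def quadSum {k n : ℕ} (N : Matrix (Fin n) (Fin n) ℝ) (v : Fin k → Fin n → ℝ) : ℝ :=
  ∑ a, v a ⬝ᵥ N *ᵥ v a

theorem IsEigenfamily.exists_embedding {k n : ℕ} {M : Matrix (Fin n) (Fin n) ℝ} (hM : Mᵀ = M)
    {b : Fin n → Fin n → ℝ} {lam : Fin n → ℝ} (hb : IsEigenbasis M b lam)
    (hlam : Function.Injective lam) {v : Fin k → Fin n → ℝ} (hv : IsEigenfamily M v) :
    ∃ f : Fin k ↪ Fin n, ∀ a, (v a = b (f a) ∨ v a = -b (f a)) ∧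
      v a ⬝ᵥ M *ᵥ v a = lam (f a) := by
  have key : ∀ a, ∃ i, v a = b i ∨ v a = - b i := by
    intro a
    set μ := v a ⬝ᵥ M *ᵥ v a
    have h1 : ∀ i, lam i * (b i ⬝ᵥ v a) = μ * (b i ⬝ᵥ v a) := by
      intro i
      have h := dotProduct_mulVec_symm hM (b i) (v a)
      rw [hb.2, hv.2 a, dotProduct_smul, dotProduct_smul, dotProduct_comm (v a) (b i)] at h
      exact h.symm
    have hne : ∃ i, b i ⬝ᵥ v a ≠ 0 := by
      by_contra! h
      have := hb.1.parseval (v a) (v a)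
      rw [hv.1] at this
      simp [h] at this
    obtain ⟨i, hi⟩ := hne
    have hli : lam i = μ := mul_right_cancel₀ hi (h1 i)
    have hz : ∀ j, j ≠ i → b j ⬝ᵥ v a = 0 := by
      intro j hj
      by_contra h
      exact hj (hlam ((mul_right_cancel₀ h (h1 j)).trans hli.symm))
    have hva : v a = (b i ⬝ᵥ v a) • b i := by
      conv_lhs => rw [← hb.1.expand (v a)]
      rw [Finset.sum_eq_single i]
      · intro j _ hj
        simp [hz j hj]
      · simp
    have hsq : (b i ⬝ᵥ v a) ^ 2 = 1 := by
      have := hb.1.parseval (v a) (v a)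
      rw [hv.1, if_pos rfl, Finset.sum_eq_single i] at this
      · rw [sq, ← this]
      · intro j _ hj
        simp [hz j hj]
      · simp
    refine ⟨i, ?_⟩
    rcases mul_self_eq_one_iff.mp ((sq _).symm.trans hsq) with h | h
    · left; rw [hva, h, one_smul]
    · right; rw [hva, h]; simp
  choose f hf using key
  have hinj : Function.Injective f := by
    intro a a' haa
    by_contra hne
    have h0 : v a ⬝ᵥ v a' = 0 := by rw [hv.1, if_neg hne]
    have h1 := hb.1 (f a) (f a)
    rw [if_pos rfl] at h1
    rcases hf a with h | h <;> rcases hf a' with h' | h' <;>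
      · rw [h, h', haa] at h0
        rw [haa] at h1
        simp [h1] at h0
  refine ⟨⟨f, hinj⟩, fun a => ⟨hf a, ?_⟩⟩
  have h1 := hb.1 (f a) (f a)
  rw [if_pos rfl] at h1
  rcases hf a with h | h <;> simp [h, hb.2, h1, mulVec_neg]

theorem quadSum_eq_of_embedding {k n : ℕ} (N : Matrix (Fin n) (Fin n) ℝ)
    {b : Fin n → Fin n → ℝ} {v : Fin k → Fin n → ℝ} {f : Fin k → Fin n}
    (h : ∀ a, v a = b (f a) ∨ v a = -b (f a)) : quadSum N v = quadSum N fun a => b (f a) := by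
  refine Finset.sum_congr rfl fun a _ => ?_
  rcases h a with h | h <;> simp [h, mulVec_neg]

theorem IsTopFamily.quadSum_eq {k n : ℕ} {M : Matrix (Fin n) (Fin n) ℝ} (hM : Mᵀ = M)
    {b : Fin n → Fin n → ℝ} {lam : Fin n → ℝ} (hb : IsEigenbasis M b lam)
    (hlam : Function.Injective lam) (N : Matrix (Fin n) (Fin n) ℝ)
    {v v' : Fin k → Fin n → ℝ} (hv : IsTopFamily M v) (hv' : IsTopFamily M v') :
    quadSum N v = quadSum N v' := by
  obtain ⟨f, hf⟩ := hv.1.exists_embedding hM hb hlam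
  obtain ⟨f', hf'⟩ := hv'.1.exists_embedding hM hb hlam
  rw [quadSum_eq_of_embedding N fun a => (hf a).1, quadSum_eq_of_embedding N fun a => (hf' a).1]
  have main : ∀ {v : Fin k → Fin n → ℝ} {f : Fin k ↪ Fin n}, IsTopFamily M v →
      (∀ a, (v a = b (f a) ∨ v a = -b (f a)) ∧ v a ⬝ᵥ M *ᵥ v a = lam (f a)) →
      ∀ i, i ∉ Set.range f → ∀ a, lam i < lam (f a) := by
    intro v f hv hf i hi a
    have h0 : ∀ a, v a ⬝ᵥ b i = 0 := by
      intro a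
      have : f a ≠ i := fun h => hi ⟨a, h⟩
      rcases (hf a).1 with h | h <;> simp [h, hb.1 _ _, this]
    have h1 := hv.2 (b i) a
    rw [orthResidual_of_dot_eq_zero h0, (hf a).2, hb.2, dotProduct_smul, hb.1] at h1
    refine lt_of_le_of_ne (by simpa using h1) fun h => hi ⟨a, (hlam h).symm⟩
  have hset : Finset.univ.map f = Finset.univ.map f' := by
    have hc : (Finset.univ.map f).card = (Finset.univ.map f').card := by simp
    refine Finset.eq_of_subset_of_card_le (fun i hi => ?_) hc.ge
    by_contra hi'
    have hnot : ¬ Finset.univ.map f' ⊆ Finset.univ.map f := by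
      intro hsub
      exact hi' ((Finset.eq_of_subset_of_card_le hsub hc.le).symm ▸ hi)
    obtain ⟨j, hj, hj'⟩ := Finset.not_subset.mp hnot
    simp only [Finset.mem_map, Finset.mem_univ, true_and, not_exists] at hi hi' hj hj'
    obtain ⟨a, rfl⟩ := hi
    obtain ⟨a', rfl⟩ := hj
    have h1 := main hv hf (f' a') (by rintro ⟨x, hx⟩; exact hj' x hx) a
    have h2 := main hv' hf' (f a) (by rintro ⟨x, hx⟩; exact hi' x hx) a'
    exact lt_asymm h1 h2
  have := congrArg (fun s => ∑ i ∈ s, b i ⬝ᵥ N *ᵥ b i) hset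
  simpa [quadSum] using this

section SpectralPolynomial

variable {S S' : Type*} [CommRing S] [CommRing S'] {m n : ℕ}

/-- The product of the differences between `l i` and the other entries of `l`. -/
def gapProd (l : Fin n → S) (i : Fin n) : S :=
  ∏ j ∈ Finset.univ.erase i, (l i - l j)

/-- The trace of `N` against the unnormalized Lagrange projection of `M` at `l i`. -/
noncomputable def lagrangeTrace (M N : Matrix (Fin n) (Fin n) S) (l : Fin n → S)
    (i : Fin n) : S :=
  (N * Polynomial.eval₂ (algebraMap S (Matrix (Fin n) (Fin n) S)) M
    (∏ j ∈ Finset.univ.erase i, (Polynomial.X - Polynomial.C (l j)))).trace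

/-- A product that vanishes iff two entries of `l` agree or some `m` spectral projections of `M`
pair with `N` to the value `D`. -/
noncomputable def spectralProd (m : ℕ) (M N : Matrix (Fin n) (Fin n) S) (D : S)
    (l : Fin n → S) : S :=
  (∏ i, gapProd l i) * ∏ f : Fin m ↪ Fin n, (D * ∏ i, gapProd l i -
    ∑ a, (∏ k ∈ Finset.univ.erase (f a), gapProd l k) * lagrangeTrace M N l (f a))

theorem map_gapProd (φ : S →+* S') (l : Fin n → S) (i : Fin n) :
    φ (gapProd l i) = gapProd (fun j => φ (l j)) i := by
  simp [gapProd]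

theorem map_lagrangeTrace (φ : S →+* S') (M N : Matrix (Fin n) (Fin n) S) (l : Fin n → S)
    (i : Fin n) : φ (lagrangeTrace M N l i) =
      lagrangeTrace (φ.mapMatrix M) (φ.mapMatrix N) (fun j => φ (l j)) i := by
  have h : ∏ j ∈ Finset.univ.erase i, (Polynomial.X - Polynomial.C (φ (l j))) =
      (∏ j ∈ Finset.univ.erase i, (Polynomial.X - Polynomial.C (l j))).map φ := by
    simp [Polynomial.map_prod]
  have h2 : (algebraMap S' (Matrix (Fin n) (Fin n) S')).comp φ =
      (φ.mapMatrix).comp (algebraMap S (Matrix (Fin n) (Fin n) S)) := by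
    ext r i j
    simp [Matrix.algebraMap_matrix_apply, apply_ite φ]
  rw [lagrangeTrace, lagrangeTrace, h, Polynomial.eval₂_map, h2, ← Polynomial.hom_eval₂,
    ← map_mul]
  exact AddMonoidHom.map_trace φ _

theorem map_spectralProd (φ : S →+* S') (M N : Matrix (Fin n) (Fin n) S) (D : S)
    (l : Fin n → S) : φ (spectralProd m M N D l) =
      spectralProd m (φ.mapMatrix M) (φ.mapMatrix N) (φ D) (fun j => φ (l j)) := by
  simp only [spectralProd, map_mul, map_prod, map_sub, map_sum, map_gapProd, map_lagrangeTrace]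

theorem prod_erase_perm {T : Type*} [CommMonoid T] (σ : Equiv.Perm (Fin n)) (g : Fin n → T)
    (i : Fin n) : ∏ j ∈ Finset.univ.erase i, g (σ j) = ∏ j ∈ Finset.univ.erase (σ i), g j :=
  Finset.prod_equiv σ (by simp) (by simp)

theorem spectralProd_perm (M N : Matrix (Fin n) (Fin n) S) (D : S) (l : Fin n → S)
    (σ : Equiv.Perm (Fin n)) :
    spectralProd m M N D (fun i => l (σ i)) = spectralProd m M N D l := by
  have h1 : ∀ i, gapProd (fun i => l (σ i)) i = gapProd l (σ i) := fun i =>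
    prod_erase_perm σ (fun j => l (σ i) - l j) i
  have h2 : ∀ i, lagrangeTrace M N (fun i => l (σ i)) i = lagrangeTrace M N l (σ i) := fun i => by
    rw [lagrangeTrace, lagrangeTrace,
      prod_erase_perm σ (fun j => (Polynomial.X - Polynomial.C (l j))) i]
  have h3 : ∀ i, ∏ j ∈ Finset.univ.erase i, gapProd l (σ j) =
      ∏ j ∈ Finset.univ.erase (σ i), gapProd l j := fun i =>
    prod_erase_perm σ (fun j => gapProd l j) i
  simp only [spectralProd, h1, h2, h3, Equiv.prod_comp σ (gapProd l)]
  congr 1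
  exact Fintype.prod_equiv ((Equiv.refl _).embeddingCongr σ) _ _ fun f => rfl

end SpectralPolynomial

theorem IsEigenbasis.eval₂ {n : ℕ} {M : Matrix (Fin n) (Fin n) ℝ}
    {b : Fin n → Fin n → ℝ} {lam : Fin n → ℝ} (h : IsEigenbasis M b lam) (p : Polynomial ℝ) :
    IsEigenbasis (Polynomial.eval₂ (algebraMap ℝ (Matrix (Fin n) (Fin n) ℝ)) M p) b
      (fun i => p.eval (lam i)) := by
  refine ⟨h.1, fun i => ?_⟩
  change (Polynomial.aeval M p) *ᵥ b i = _
  induction p using Polynomial.induction_on with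
  | C a => simp [Algebra.algebraMap_eq_smul_one, smul_mulVec]
  | add p q hp hq => simp [add_mulVec, hp, hq, add_smul]
  | monomial k a hk =>
    rw [pow_succ, ← mul_assoc, map_mul, Polynomial.aeval_X, ← mulVec_mulVec, h.2, mulVec_smul, hk,
      smul_smul]
    congr 1
    simp
    ring

theorem IsEigenbasis.trace_mul {n : ℕ} {M : Matrix (Fin n) (Fin n) ℝ}
    {b : Fin n → Fin n → ℝ} {lam : Fin n → ℝ} (h : IsEigenbasis M b lam)
    (N : Matrix (Fin n) (Fin n) ℝ) :
    (N * M).trace = ∑ i, lam i * (b i ⬝ᵥ N *ᵥ b i) := by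
  rw [h.transpose_eq, ← Matrix.mul_assoc, Matrix.trace_mul_comm, ← Matrix.mul_assoc,
    ← Matrix.mul_assoc, Matrix.trace]
  refine Finset.sum_congr rfl fun i _ => ?_
  rw [Matrix.diag_apply, Matrix.mul_diagonal, mul_comm, Matrix.mul_assoc]
  rfl

theorem IsEigenbasis.lagrangeTrace_eq {n : ℕ} {M : Matrix (Fin n) (Fin n) ℝ}
    {b : Fin n → Fin n → ℝ} {lam : Fin n → ℝ} (h : IsEigenbasis M b lam)
    (N : Matrix (Fin n) (Fin n) ℝ) (i : Fin n) :
    lagrangeTrace M N lam i = gapProd lam i * (b i ⬝ᵥ N *ᵥ b i) := by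
  rw [lagrangeTrace, (h.eval₂ _).trace_mul, Finset.sum_eq_single i]
  · simp [Polynomial.eval_prod, gapProd]
  · intro j _ hj
    rw [Polynomial.eval_prod, Finset.prod_eq_zero (Finset.mem_erase.mpr ⟨hj, Finset.mem_univ _⟩)]
    · simp
    · simp
  · simp

/-- `M` has simple spectrum and no `m` of its eigenvectors have `N`-values summing to `D`. -/
def SpectrallyGeneric {n : ℕ} (m : ℕ) (M N : Matrix (Fin n) (Fin n) ℝ) (D : ℝ) : Prop :=
  ∀ b lam, IsEigenbasis M b lam → Function.Injective lam ∧
    ∀ f : Fin m ↪ Fin n, quadSum N (fun a => b (f a)) ≠ D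

theorem gapProd_ne_zero_iff {n : ℕ} (lam : Fin n → ℝ) :
    (∀ i, gapProd lam i ≠ 0) ↔ Function.Injective lam := by
  simp only [gapProd, Finset.prod_ne_zero_iff, Finset.mem_erase, Finset.mem_univ, and_true,
    sub_ne_zero]
  constructor
  · intro h i j hij
    by_contra hne
    exact h i j (Ne.symm hne) hij
  · intro h i j hij hl
    exact hij (h hl).symm

theorem IsEigenbasis.spectralProd_ne_zero_iff {m n : ℕ} {M : Matrix (Fin n) (Fin n) ℝ}
    {b : Fin n → Fin n → ℝ} {lam : Fin n → ℝ} (h : IsEigenbasis M b lam)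
    (N : Matrix (Fin n) (Fin n) ℝ) (D : ℝ) :
    spectralProd m M N D lam ≠ 0 ↔ Function.Injective lam ∧
      ∀ f : Fin m ↪ Fin n, quadSum N (fun a => b (f a)) ≠ D := by
  have key : ∀ f : Fin m ↪ Fin n, D * ∏ i, gapProd lam i -
      ∑ a, (∏ k ∈ Finset.univ.erase (f a), gapProd lam k) * lagrangeTrace M N lam (f a) =
      (D - quadSum N (fun a => b (f a))) * ∏ i, gapProd lam i := by
    intro f
    rw [sub_mul, quadSum, Finset.sum_mul]
    congr 1
    refine Finset.sum_congr rfl fun a _ => ?_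
    rw [h.lagrangeTrace_eq, ← mul_assoc, Finset.prod_erase_mul _ _ (Finset.mem_univ _), mul_comm]
  rw [spectralProd, mul_ne_zero_iff, Finset.prod_ne_zero_iff, Finset.prod_ne_zero_iff]
  simp only [key, mul_ne_zero_iff, Finset.prod_ne_zero_iff, Finset.mem_univ, true_implies,
    gapProd_ne_zero_iff]
  constructor
  · rintro ⟨h1, h2⟩
    exact ⟨h1, fun f => (sub_ne_zero.mp (h2 f).1).symm⟩
  · rintro ⟨h1, h2⟩
    exact ⟨h1, fun f => ⟨sub_ne_zero.mpr (h2 f).symm, h1⟩⟩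

/-- Coordinates of a pair of `n × n` matrices and a scalar. -/
abbrev PairIndex (n : ℕ) := (Fin n × Fin n) ⊕ (Fin n × Fin n) ⊕ Unit

/-- The coordinate vector of `(M, N, D)`. -/
def pairPoint {n : ℕ} (M N : Matrix (Fin n) (Fin n) ℝ) (D : ℝ) : PairIndex n → ℝ :=
  Sum.elim (fun p => M p.1 p.2) (Sum.elim (fun p => N p.1 p.2) fun _ => D)

/-- Real polynomials in the coordinates of a pair of `n × n` matrices and a scalar. -/
abbrev PairPoly (n : ℕ) := MvPolynomial (PairIndex n) ℝ

theorem exists_spectral_polynomial (m n : ℕ) :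
    ∃ Q : MvPolynomial (PairIndex n) ℝ, ∀ M N : Matrix (Fin n) (Fin n) ℝ, ∀ D : ℝ, Mᵀ = M →
      (MvPolynomial.eval (pairPoint M N D) Q ≠ 0 ↔ SpectrallyGeneric m M N D) := by
  let GM : Matrix (Fin n) (Fin n) (PairPoly n) :=
    Matrix.of fun i j => MvPolynomial.X (Sum.inl (i, j))
  let GN : Matrix (Fin n) (Fin n) (PairPoly n) :=
    Matrix.of fun i j => MvPolynomial.X (Sum.inr (Sum.inl (i, j)))
  let GD : PairPoly n := MvPolynomial.X (Sum.inr (Sum.inr ()))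
  let P : MvPolynomial (Fin n) (PairPoly n) := spectralProd m
    ((MvPolynomial.C : PairPoly n →+* MvPolynomial (Fin n) (PairPoly n)).mapMatrix GM)
    ((MvPolynomial.C : PairPoly n →+* MvPolynomial (Fin n) (PairPoly n)).mapMatrix GN)
    (MvPolynomial.C GD)
    MvPolynomial.X
  have hP : P.IsSymmetric := by
    intro σ
    have h := map_spectralProd (m := m) (MvPolynomial.rename (R := PairPoly n) σ).toRingHom
      ((MvPolynomial.C : PairPoly n →+* MvPolynomial (Fin n) (PairPoly n)).mapMatrix GM)
      ((MvPolynomial.C : PairPoly n →+* MvPolynomial (Fin n) (PairPoly n)).mapMatrix GN)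
      (MvPolynomial.C GD)
      MvPolynomial.X
    refine Eq.trans h ?_
    change _ = spectralProd m _ _ _ _
    rw [← spectralProd_perm _ _ _ MvPolynomial.X σ]
    have hC : ∀ A : Matrix (Fin n) (Fin n) (PairPoly n),
        (MvPolynomial.rename (R := PairPoly n) σ).toRingHom.mapMatrix
        ((MvPolynomial.C : PairPoly n →+* MvPolynomial (Fin n) (PairPoly n)).mapMatrix A) =
        (MvPolynomial.C : PairPoly n →+* MvPolynomial (Fin n) (PairPoly n)).mapMatrix A := by
      intro A
      ext1 i j
      simp
    rw [hC, hC]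
    simp
  obtain ⟨p, hp⟩ := MvPolynomial.esymmAlgHom_surjective (σ := Fin n) (R := PairPoly n) (n := n)
    (by simp) ⟨P, hP⟩
  have hp' : MvPolynomial.aeval (fun i : Fin n => MvPolynomial.esymm (Fin n) (PairPoly n) (i + 1))
      p = P := by
    rw [← MvPolynomial.esymmAlgHom_apply, hp]
  refine ⟨MvPolynomial.aeval (fun i : Fin n =>
    (-1) ^ ((i : ℕ) + 1) * GM.charpoly.coeff (n - (i + 1))) p, fun M N D hM => ?_⟩
  have main : ∀ b lam, IsEigenbasis M b lam → MvPolynomial.eval (pairPoint M N D)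
      (MvPolynomial.aeval (fun i : Fin n =>
        (-1) ^ ((i : ℕ) + 1) * GM.charpoly.coeff (n - (i + 1))) p) =
      spectralProd m M N D lam := by
    intro b lam hb
    let ev : PairPoly n →+* ℝ := MvPolynomial.eval (pairPoint M N D)
    have hGM : ev.mapMatrix GM = M := by
      ext i j
      exact MvPolynomial.eval_X _
    have hGN : ev.mapMatrix GN = N := by
      ext i j
      exact MvPolynomial.eval_X _
    have hGD : ev GD = D := MvPolynomial.eval_X _
    have h1 := congrArg (MvPolynomial.eval₂Hom ev lam) hp'
    have h2 : MvPolynomial.eval₂Hom ev lam P = spectralProd m M N D lam := by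
      rw [map_spectralProd]
      have hC : ∀ A : Matrix (Fin n) (Fin n) (PairPoly n), (MvPolynomial.eval₂Hom ev lam).mapMatrix
          ((MvPolynomial.C : PairPoly n →+* MvPolynomial (Fin n) (PairPoly n)).mapMatrix A) =
          ev.mapMatrix A := by
        intro A
        ext1 i j
        simp
      rw [hC, hC, hGM, hGN]
      simp [hGD]
    rw [← h2, ← h1, MvPolynomial.aeval_def, MvPolynomial.aeval_def, MvPolynomial.hom_eval₂,
      MvPolynomial.hom_eval₂]
    have hcoef : ∀ i : Fin n, ev ((-1) ^ ((i : ℕ) + 1) * GM.charpoly.coeff (n - (i + 1))) =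
        MvPolynomial.eval₂Hom ev lam (MvPolynomial.esymm (Fin n) (PairPoly n) (i + 1)) := by
      intro i
      have hch : GM.charpoly.map ev = M.charpoly := by
        rw [← hGM]
        exact (Matrix.charpoly_map GM ev).symm
      have hco : ev (GM.charpoly.coeff (n - (i + 1))) = M.charpoly.coeff (n - (i + 1)) := by
        rw [← hch, Polynomial.coeff_map]
      have hprod : (∏ i, (Polynomial.X - Polynomial.C (lam i))) =
          ((Finset.univ.val.map lam).map fun r => Polynomial.X - Polynomial.C r).prod := by
        rw [Multiset.map_map]
        rfl
      have hes : MvPolynomial.eval₂Hom ev lam (MvPolynomial.esymm (Fin n) (PairPoly n) (i + 1)) =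
          (Finset.univ.val.map lam).esymm (i + 1) := by
        rw [← MvPolynomial.aeval_esymm_eq_multiset_esymm (Fin n) ℝ]
        simp [MvPolynomial.esymm]
      have hi := i.2
      rw [map_mul, hco, hb.charpoly, hprod, Multiset.prod_X_sub_C_coeff _ (by simp), hes]
      have : (Finset.univ.val.map lam).card - (n - ((i : ℕ) + 1)) = i + 1 := by
        simp; omega
      rw [this, ← mul_assoc]
      simp [← mul_pow]
    have hring : (MvPolynomial.eval (pairPoint M N D)).comp
        (algebraMap (PairPoly n) (PairPoly n)) = (MvPolynomial.eval₂Hom ev lam).comp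
        (algebraMap (PairPoly n) (MvPolynomial (Fin n) (PairPoly n))) := by
      refine RingHom.ext fun q => ?_
      exact (MvPolynomial.eval₂Hom_C ev lam q).symm
    rw [hring]
    congr 1
    exact funext hcoef
  constructor
  · intro h b lam hb
    rw [main b lam hb] at h
    exact (hb.spectralProd_ne_zero_iff N D).mp h
  · intro h
    obtain ⟨b, lam, hb⟩ := exists_isEigenbasis hM
    rw [main b lam hb]
    exact (hb.spectralProd_ne_zero_iff N D).mpr (h b lam hb)

theorem isCompact_dotOrthonormal (k n : ℕ) :
    IsCompact {v : Fin k → Fin n → ℝ | DotOrthonormal v} := by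
  refine IsCompact.of_isClosed_subset (isCompact_Icc (a := fun _ _ => -1) (b := fun _ _ => 1))
    ?_ fun v hv => ?_
  · simp only [DotOrthonormal, Set.ofPred_forall]
    refine isClosed_iInter fun a => isClosed_iInter fun b => isClosed_eq ?_ continuous_const
    exact Continuous.dotProduct (by fun_prop) (by fun_prop)
  · have h : ∀ a i, v a i ^ 2 ≤ 1 := by
      intro a i
      have h1 : v a ⬝ᵥ v a = 1 := (hv a a).trans (if_pos rfl)
      rw [← h1, dotProduct, sq]
      exact Finset.single_le_sum (f := fun i => v a i * v a i)
        (fun _ _ => mul_self_nonneg _) (Finset.mem_univ i)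
    exact ⟨fun a i => (abs_le.mp (abs_le_one_iff_mul_self_le_one.mpr
      (by simpa [sq] using h a i))).1,
      fun a i => (abs_le.mp (abs_le_one_iff_mul_self_le_one.mpr (by simpa [sq] using h a i))).2⟩

/-- Triples consisting of two `n × n` matrices and a scalar. -/
abbrev SpecData (n : ℕ) := Matrix (Fin n) (Fin n) ℝ × Matrix (Fin n) (Fin n) ℝ × ℝ

theorem isClosed_exists_dotOrthonormal {k n : ℕ} {Y : Type*} [TopologicalSpace Y]
    (s : Set ((Fin k → Fin n → ℝ) × Y)) (hs : IsClosed s) :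
    IsClosed {p : Y | ∃ v, DotOrthonormal v ∧ (v, p) ∈ s} := by
  have : CompactSpace {v : Fin k → Fin n → ℝ | DotOrthonormal v} :=
    isCompact_iff_compactSpace.mp (isCompact_dotOrthonormal k n)
  have h := isClosedMap_snd_of_compactSpace (X := {v : Fin k → Fin n → ℝ | DotOrthonormal v})
    (Y := Y) _ (hs.preimage (f := fun q : {v : Fin k → Fin n → ℝ | DotOrthonormal v} × Y =>
      ((q.1 : Fin k → Fin n → ℝ), q.2)) (by fun_prop))
  convert h using 1
  ext p
  simp

theorem continuous_rayleigh (k n : ℕ) (a : Fin k) :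
    Continuous fun q : (Fin k → Fin n → ℝ) × SpecData n => q.1 a ⬝ᵥ q.2.1 *ᵥ q.1 a :=
  Continuous.dotProduct (by fun_prop) (Continuous.matrix_mulVec (by fun_prop) (by fun_prop))

theorem isClosed_eigen (k n : ℕ) : IsClosed {q : (Fin k → Fin n → ℝ) × SpecData n |
    ∀ a, q.2.1 *ᵥ q.1 a = (q.1 a ⬝ᵥ q.2.1 *ᵥ q.1 a) • q.1 a} := by
  simp only [Set.ofPred_forall]
  refine isClosed_iInter fun a => isClosed_eq ?_ ?_
  · exact Continuous.matrix_mulVec (by fun_prop) (by fun_prop)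
  · exact (continuous_rayleigh k n a).smul
      (by fun_prop : Continuous fun q : (Fin k → Fin n → ℝ) × SpecData n => q.1 a)

theorem continuous_quadSum (k n : ℕ) :
    Continuous fun q : (Fin k → Fin n → ℝ) × SpecData n => quadSum q.2.2.1 q.1 := by
  refine continuous_finsetSum _ fun a _ => Continuous.dotProduct (by fun_prop) ?_
  exact Continuous.matrix_mulVec (by fun_prop) (by fun_prop)

theorem continuous_orthResidual (k n : ℕ) (y : Fin n → ℝ) :
    Continuous fun q : (Fin k → Fin n → ℝ) × SpecData n => orthResidual q.1 y := by
  refine continuous_const.sub (continuous_finsetSum _ fun a _ => ?_)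
  have h : Continuous fun q : (Fin k → Fin n → ℝ) × SpecData n => q.1 a := by fun_prop
  exact (h.dotProduct continuous_const).smul h

theorem isClosed_top (k n : ℕ) : IsClosed {q : (Fin k → Fin n → ℝ) × SpecData n |
    (∀ a, q.2.1 *ᵥ q.1 a = (q.1 a ⬝ᵥ q.2.1 *ᵥ q.1 a) • q.1 a) ∧
    ∀ y a, orthResidual q.1 y ⬝ᵥ q.2.1 *ᵥ orthResidual q.1 y ≤
      (q.1 a ⬝ᵥ q.2.1 *ᵥ q.1 a) * (orthResidual q.1 y ⬝ᵥ orthResidual q.1 y)} := by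
  refine (isClosed_eigen k n).and ?_
  simp only [Set.ofPred_forall]
  refine isClosed_iInter fun y => isClosed_iInter fun a => isClosed_le ?_ ?_
  · refine (continuous_orthResidual k n y).dotProduct ?_
    exact Continuous.matrix_mulVec (by fun_prop) (continuous_orthResidual k n y)
  · exact (continuous_rayleigh k n a).mul
      ((continuous_orthResidual k n y).dotProduct (continuous_orthResidual k n y))

/-- Data for which some top family has quadratic sum at most the given scalar. -/
def topLE (k n : ℕ) : Set (SpecData n) :=
  {p | ∃ v : Fin k → Fin n → ℝ, IsTopFamily p.1 v ∧ quadSum p.2.1 v ≤ p.2.2}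

/-- Data for which some top family has quadratic sum at least the given scalar. -/
def topGE (k n : ℕ) : Set (SpecData n) :=
  {p | ∃ v : Fin k → Fin n → ℝ, IsTopFamily p.1 v ∧ p.2.2 ≤ quadSum p.2.1 v}

/-- Data for which some orthonormal eigenbasis contains `k` vectors whose quadratic sum equals
the given scalar. -/
def eigenEq (k n : ℕ) : Set (SpecData n) :=
  ⋃ f : Fin k ↪ Fin n, {p | ∃ b : Fin n → Fin n → ℝ, IsEigenfamily p.1 b ∧
    quadSum p.2.1 (fun a => b (f a)) = p.2.2}

theorem isClosed_topLE (k n : ℕ) : IsClosed (topLE k n) := by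
  convert isClosed_exists_dotOrthonormal _ ((isClosed_top k n).inter
    (isClosed_le (continuous_quadSum k n) (by fun_prop : Continuous fun q => q.2.2.2))) using 1
  ext p
  simp [topLE, IsTopFamily, IsEigenfamily, and_assoc]

theorem isClosed_topGE (k n : ℕ) : IsClosed (topGE k n) := by
  convert isClosed_exists_dotOrthonormal _ ((isClosed_top k n).inter
    (isClosed_le (by fun_prop : Continuous fun q => q.2.2.2) (continuous_quadSum k n))) using 1
  ext p
  simp [topGE, IsTopFamily, IsEigenfamily, and_assoc]

theorem isClosed_eigenEq (k n : ℕ) : IsClosed (eigenEq k n) := by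
  refine isClosed_iUnion_of_finite fun f => ?_
  have hq : Continuous fun q : (Fin n → Fin n → ℝ) × SpecData n =>
      quadSum q.2.2.1 (fun a => q.1 (f a)) :=
    (continuous_quadSum k n).comp (g := fun q : (Fin k → Fin n → ℝ) × SpecData n =>
      quadSum q.2.2.1 q.1) (f := fun q : (Fin n → Fin n → ℝ) × SpecData n =>
      ((fun a => q.1 (f a)), q.2)) (by fun_prop)
  convert isClosed_exists_dotOrthonormal _ ((isClosed_eigen n n).inter
    (isClosed_eq hq (by fun_prop : Continuous fun q => q.2.2.2))) using 1
  ext p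
  simp [IsEigenfamily, and_assoc]

/-- For spectrally generic data the two closed conditions exclude each other. -/
theorem SpectrallyGeneric.notMem_inter {k n : ℕ} {p : SpecData n} (hM : p.1ᵀ = p.1)
    (h : SpectrallyGeneric k p.1 p.2.1 p.2.2) (h1 : p ∈ topLE k n) : p ∉ topGE k n := by
  rintro ⟨v', hv', hge⟩
  obtain ⟨v, hv, hle⟩ := h1
  obtain ⟨b, lam, hb⟩ := exists_isEigenbasis hM
  obtain ⟨hinj, hf⟩ := h b lam hb
  have heq := hv.quadSum_eq hM hb hinj p.2.1 hv'
  obtain ⟨f, hfv⟩ := hv.1.exists_embedding hM hb hinj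
  refine hf f ?_
  rw [← quadSum_eq_of_embedding p.2.1 fun a => (hfv a).1]
  linarith

theorem spectrallyGeneric_of_notMem_eigenEq {k n : ℕ} {p : SpecData n}
    (h : p ∉ eigenEq k n)
    (hinj : ∀ b lam, IsEigenbasis p.1 b lam → Function.Injective lam) :
    SpectrallyGeneric k p.1 p.2.1 p.2.2 := by
  refine fun b lam hb => ⟨hinj b lam hb, fun f hf => h ?_⟩
  refine Set.mem_iUnion.mpr ⟨f, b, ⟨hb.1, fun a => ?_⟩, hf⟩
  simp [hb.2, hb.1 _ _]

theorem exists_isTopFamily {k n : ℕ} (hkn : k ≤ n) {M : Matrix (Fin n) (Fin n) ℝ}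
    (hM : Mᵀ = M) : ∃ lam : Fin n → ℝ, ∃ v : Fin k → Fin n → ℝ, Antitone lam ∧
      M.charpoly = ∏ i, (Polynomial.X - Polynomial.C (lam i)) ∧ DotOrthonormal v ∧
      (∀ (a : Fin k) (h : (a : ℕ) < n), M *ᵥ v a = lam ⟨a, h⟩ • v a) ∧ IsTopFamily M v := by
  obtain ⟨b, lam, hb, hlam⟩ := exists_antitone_isEigenbasis hM
  have hv : DotOrthonormal fun a => b (Fin.castLE hkn a) := hb.1.comp (Fin.castLE_injective hkn)
  have hMv : ∀ (a : Fin k) (h : (a : ℕ) < n),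
      M *ᵥ b (Fin.castLE hkn a) = lam ⟨a, h⟩ • b (Fin.castLE hkn a) := fun a h => hb.2 _
  exact ⟨lam, fun a => b (Fin.castLE hkn a), hlam, hb.charpoly, hv, hMv,
    isTopFamily_of_charpoly hkn hM hlam hb.charpoly hv hMv⟩

/-- The rows of `W` relative to its last row. -/
def rowDiff {m n : ℕ} (W : Matrix (Fin (m + 1)) (Fin n) ℝ) : Matrix (Fin m) (Fin n) ℝ :=
  Matrix.of fun a j => W a.castSucc j - W (Fin.last m) j

/-- The Gram determinant of the rows of `V`. -/
noncomputable def gramDet {m n : ℕ} (V : Matrix (Fin m) (Fin n) ℝ) : ℝ := (V * Vᵀ).det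

/-- The projection onto the row space of `V`, multiplied by the Gram determinant. -/
noncomputable def gramProj {m n : ℕ} (V : Matrix (Fin m) (Fin n) ℝ) :
    Matrix (Fin n) (Fin n) ℝ :=
  Vᵀ * (V * Vᵀ).adjugate * V

theorem transpose_mulVec_eq_rowDiff {m n : ℕ} (W : Matrix (Fin (m + 1)) (Fin n) ℝ)
    {y : Fin (m + 1) → ℝ} (hy : ∑ i, y i = 0) :
    Wᵀ *ᵥ y = (rowDiff W)ᵀ *ᵥ fun a => y a.castSucc := by
  ext j
  rw [Fin.sum_univ_castSucc] at hy
  simp only [mulVec, dotProduct, transpose_apply, rowDiff, Matrix.of_apply,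
    Fin.sum_univ_castSucc, sub_mul, Finset.sum_sub_distrib, ← Finset.mul_sum]
  rw [eq_neg_of_add_eq_zero_right hy]
  ring

theorem map_ker_sumLin {m n : ℕ} (W : Matrix (Fin (m + 1)) (Fin n) ℝ) :
    Submodule.map (Matrix.mulVecLin Wᵀ) (LinearMap.ker (sumLin (m + 1))) =
      LinearMap.range (Matrix.mulVecLin (rowDiff W)ᵀ) := by
  ext z
  simp only [Submodule.mem_map, LinearMap.mem_ker, LinearMap.mem_range, mulVecLin_apply]
  constructor
  · rintro ⟨y, hy, rfl⟩
    exact ⟨_, (transpose_mulVec_eq_rowDiff W hy).symm⟩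
  · rintro ⟨t, rfl⟩
    have hs : ∑ i, (Fin.snoc t (-∑ a, t a) : Fin (m + 1) → ℝ) i = 0 := by
      simp [Fin.sum_univ_castSucc]
    refine ⟨Fin.snoc t (-∑ a, t a), hs, ?_⟩
    rw [transpose_mulVec_eq_rowDiff W hs]
    simp

theorem gramDet_nonneg {m n : ℕ} (V : Matrix (Fin m) (Fin n) ℝ) : 0 ≤ gramDet V := by
  have := Matrix.posSemidef_self_mul_conjTranspose V
  rw [conjTranspose_eq_transpose_of_trivial] at this
  exact this.det_nonneg

theorem gramProj_mulVec {m n k : ℕ} (V : Matrix (Fin m) (Fin n) ℝ) {u : Fin k → Fin n → ℝ}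
    (hu : DotOrthonormal u)
    (hspan : Submodule.span ℝ (Set.range u) = LinearMap.range (Matrix.mulVecLin Vᵀ))
    (v : Fin n → ℝ) : gramProj V *ᵥ v = gramDet V • ∑ b, (u b ⬝ᵥ v) • u b := by
  have hmem : ∑ b, (u b ⬝ᵥ v) • u b ∈ LinearMap.range (Matrix.mulVecLin Vᵀ) := by
    rw [← hspan]
    exact Submodule.sum_mem _ fun b _ =>
      Submodule.smul_mem _ _ (Submodule.subset_span (Set.mem_range_self b))
  obtain ⟨t, ht⟩ := hmem
  rw [mulVecLin_apply] at ht
  have hperp : V *ᵥ orthResidual u v = 0 := by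
    have h : ∀ z ∈ Submodule.span ℝ (Set.range u), z ⬝ᵥ orthResidual u v = 0 := by
      intro z hz
      induction hz using Submodule.span_induction with
      | mem z hz => obtain ⟨b, rfl⟩ := hz; exact dot_orthResidual hu v b
      | zero => simp
      | add z z' _ _ h h' => rw [add_dotProduct, h, h', add_zero]
      | smul r z _ h => rw [smul_dotProduct, h, smul_zero]
    ext a
    have := h (Vᵀ *ᵥ Pi.single a 1) (by rw [hspan]; exact ⟨_, rfl⟩)
    rw [mulVec_single_one] at this
    exact this
  have hv : v = Vᵀ *ᵥ t + orthResidual u v := by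
    rw [ht, orthResidual]
    abel
  rw [← ht]
  conv_lhs => rw [hv]
  rw [gramProj, mulVec_add, ← mulVec_mulVec (orthResidual u v) _ V, hperp, mulVec_zero, add_zero,
    mulVec_mulVec, Matrix.mul_assoc, Matrix.mul_assoc, adjugate_mul,
    Matrix.mul_smul, Matrix.mul_one, smul_mulVec]
  rfl

theorem quadSum_gramProj {m n k l : ℕ} (V : Matrix (Fin m) (Fin n) ℝ) {u : Fin k → Fin n → ℝ}
    (hu : DotOrthonormal u)
    (hspan : Submodule.span ℝ (Set.range u) = LinearMap.range (Matrix.mulVecLin Vᵀ))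
    (v : Fin l → Fin n → ℝ) :
    quadSum (gramProj V) v = gramDet V * ∑ a, ∑ b, (v a ⬝ᵥ u b) ^ 2 := by
  rw [quadSum, Finset.mul_sum]
  refine Finset.sum_congr rfl fun a _ => ?_
  rw [gramProj_mulVec V hu hspan, dotProduct_smul, dotProduct_sum, smul_eq_mul]
  congr 1
  refine Finset.sum_congr rfl fun b _ => ?_
  rw [dotProduct_smul, dotProduct_comm (u b), smul_eq_mul, sq]

theorem exists_orthonormal_span {m n : ℕ} (V : Matrix (Fin m) (Fin n) ℝ) (hV : gramDet V ≠ 0) :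
    ∃ u : Fin m → Fin n → ℝ, DotOrthonormal u ∧
      Submodule.span ℝ (Set.range u) = LinearMap.range (Matrix.mulVecLin Vᵀ) := by
  have hG : (V * Vᵀ)ᵀ = V * Vᵀ := by rw [transpose_mul, transpose_transpose]
  obtain ⟨b, lam, hb⟩ := exists_isEigenbasis hG
  have hdot : ∀ i j, (Vᵀ *ᵥ b i) ⬝ᵥ (Vᵀ *ᵥ b j) = lam j * (b i ⬝ᵥ b j) := by
    intro i j
    rw [mulVec_transpose, ← dotProduct_mulVec, mulVec_mulVec, hb.2,
      dotProduct_smul, smul_eq_mul]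
  have hpos : ∀ i, 0 < lam i := by
    intro i
    have h1 : 0 ≤ lam i := by
      have := hdot i i
      rw [hb.1, if_pos rfl, mul_one] at this
      rw [← this]
      exact Finset.sum_nonneg fun _ _ => mul_self_nonneg _
    refine lt_of_le_of_ne h1 fun h0 => ?_
    have h2 : (V * Vᵀ) *ᵥ b i = 0 := by rw [hb.2, ← h0, zero_smul]
    have h3 := eq_zero_of_mulVec_eq_zero hV h2
    have := hb.1 i i
    simp [h3] at this
  have hsq : ∀ i, (√(lam i))⁻¹ ≠ 0 := fun i => inv_ne_zero (Real.sqrt_pos.mpr (hpos i)).ne'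
  refine ⟨fun i => (√(lam i))⁻¹ • Vᵀ *ᵥ b i, fun i j => ?_, le_antisymm ?_ ?_⟩
  · rw [smul_dotProduct, dotProduct_smul, hdot, hb.1]
    by_cases h : i = j
    · subst h
      have := Real.mul_self_sqrt (hpos i).le
      have h0 := (Real.sqrt_pos.mpr (hpos i)).ne'
      simp only [smul_eq_mul, if_true, mul_one]
      field_simp
      rw [sq, this]
    · simp [h]
  · rw [Submodule.span_le]
    rintro _ ⟨i, rfl⟩
    exact Submodule.smul_mem _ _ ⟨b i, rfl⟩
  · rintro _ ⟨y, rfl⟩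
    rw [mulVecLin_apply, ← hb.1.expand y, mulVec_sum]
    refine Submodule.sum_mem _ fun i _ => ?_
    rw [mulVec_smul]
    refine Submodule.smul_mem _ _ ?_
    have := Submodule.smul_mem (Submodule.span ℝ (Set.range fun i => (√(lam i))⁻¹ • Vᵀ *ᵥ b i))
      (√(lam i)) (Submodule.subset_span (Set.mem_range_self i))
    rwa [smul_smul, mul_inv_cancel₀ (Real.sqrt_pos.mpr (hpos i)).ne', one_smul] at this

/-- The overlap condition of the main theorem, for a matrix `M` and a subspace `S`. -/
def OverlapGood {m n : ℕ} (ε : ℝ) (M : Matrix (Fin n) (Fin n) ℝ)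
    (S : Submodule ℝ (Fin n → ℝ)) : Prop :=
  ∀ lam : Fin n → ℝ, Antitone lam →
    M.charpoly = ∏ k : Fin n, (Polynomial.X - Polynomial.C (lam k)) →
    ∀ v : Fin m → (Fin n → ℝ),
      (∀ (a : Fin m) (h : (a : ℕ) < n), M.mulVec (v a) = lam ⟨a, h⟩ • v a) →
      (∀ a b, v a ⬝ᵥ v b = if a = b then 1 else 0) →
    ∀ u : Fin m → (Fin n → ℝ), (∀ a b, u a ⬝ᵥ u b = if a = b then 1 else 0) →
      Submodule.span ℝ (Set.range u) = S →
      1 - ε < (∑ a : Fin m, ∑ b : Fin m, (v a ⬝ᵥ u b) ^ 2) / (m : ℝ)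

/-- The data `(M, N, m (1 - ε) det)` attached to a matrix and the row space of `V`. -/
noncomputable def specData {m n : ℕ} (ε : ℝ) (M : Matrix (Fin n) (Fin n) ℝ)
    (V : Matrix (Fin m) (Fin n) ℝ) : SpecData n :=
  (M, gramProj V, m * (1 - ε) * gramDet V)

theorem overlapGood_of_notMem {m n : ℕ} (hm : 0 < m) (hmn : m ≤ n) {ε : ℝ}
    {M : Matrix (Fin n) (Fin n) ℝ} (hM : Mᵀ = M) {V : Matrix (Fin m) (Fin n) ℝ}
    (h : specData ε M V ∉ topLE m n) :
    OverlapGood (m := m) ε M (LinearMap.range (Matrix.mulVecLin Vᵀ)) := by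
  intro lam hlam hchar v hMv hv u hu hspan
  have htop := isTopFamily_of_charpoly hmn hM hlam hchar hv hMv
  by_contra hle
  refine h ⟨v, htop, ?_⟩
  simp only [specData]
  rw [quadSum_gramProj V hu hspan, mul_comm]
  refine mul_le_mul_of_nonneg_right ?_ (gramDet_nonneg V)
  rw [not_lt, div_le_iff₀ (by exact_mod_cast hm)] at hle
  linarith

theorem OverlapGood.mem_topGE {m n : ℕ} (hm : 0 < m) (hmn : m ≤ n) {ε : ℝ}
    {M : Matrix (Fin n) (Fin n) ℝ} (hM : Mᵀ = M) {V : Matrix (Fin m) (Fin n) ℝ}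
    (hV : gramDet V ≠ 0)
    (h : OverlapGood (m := m) ε M (LinearMap.range (Matrix.mulVecLin Vᵀ))) :
    specData ε M V ∈ topGE m n := by
  obtain ⟨lam, v, hlam, hchar, hv, hMv, htop⟩ := exists_isTopFamily hmn hM
  obtain ⟨u, hu, hspan⟩ := exists_orthonormal_span V hV
  have := h lam hlam hchar v hMv hv u hu hspan
  refine ⟨v, htop, ?_⟩
  simp only [specData]
  rw [quadSum_gramProj V hu hspan, mul_comm]
  refine mul_le_mul_of_nonneg_left ?_ (gramDet_nonneg V)
  rw [lt_div_iff₀ (by exact_mod_cast hm)] at this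
  linarith

instance isProbabilityMeasure_inputMeasure (d : ℕ) : IsProbabilityMeasure (inputMeasure d) := by
  unfold inputMeasure
  infer_instance

theorem charFunDual_gaussianReal (L : StrongDual ℝ ℝ) :
    charFunDual (gaussianReal 0 1) L = Complex.exp (-((L 1) ^ 2 : ℝ) / 2) := by
  have h : charFunDual (gaussianReal 0 1) L = charFun (gaussianReal 0 1) (L 1) := by
    rw [charFunDual_apply, charFun_apply_real]
    refine integral_congr_ae (ae_of_all _ fun x => ?_)
    have : L x = L 1 * x := by
      have := L.map_smul x 1
      simp only [smul_eq_mul, mul_one] at this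
      rw [this, mul_comm]
    simp [this]
  rw [h, charFun_gaussianReal]
  congr 1
  push_cast
  simp [neg_div]

theorem measurable_mulVec {n d : ℕ} (W : Matrix (Fin n) (Fin d) ℝ) :
    Measurable fun x : Fin d → ℝ => W *ᵥ x :=
  (Continuous.matrix_mulVec continuous_const continuous_id).measurable

theorem charFunDual_map_mulVec {n d : ℕ} (W : Matrix (Fin n) (Fin d) ℝ)
    (L : StrongDual ℝ (Fin n → ℝ)) :
    charFunDual ((inputMeasure d).map fun x => W *ᵥ x) L =
      Complex.exp (-(((fun i => L (Pi.single i 1)) ⬝ᵥ (W * Wᵀ) *ᵥ fun i => L (Pi.single i 1) : ℝ)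
        : ℂ) / 2) := by
  have h1 : charFunDual ((inputMeasure d).map fun x => W *ᵥ x) L =
      charFunDual (inputMeasure d) (L.comp (LinearMap.toContinuousLinearMap W.mulVecLin)) := by
    rw [charFunDual_apply, charFunDual_apply, integral_map (measurable_mulVec W).aemeasurable]
    · rfl
    · exact (by fun_prop : Continuous fun v => Complex.exp (L v * Complex.I)).aestronglyMeasurable
  set c : Fin n → ℝ := fun i => L (Pi.single i 1) with hc
  have hL : ∀ y, L y = c ⬝ᵥ y := by
    intro y
    conv_lhs => rw [pi_eq_sum_univ' y]
    rw [map_sum, dotProduct]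
    refine Finset.sum_congr rfl fun i _ => ?_
    rw [map_smul, smul_eq_mul, mul_comm, hc]
  rw [h1, inputMeasure, charFunDual_pi]
  simp only [charFunDual_gaussianReal]
  rw [← Complex.exp_sum, ← Finset.sum_div, Finset.sum_neg_distrib, ← Complex.ofReal_sum]
  congr 4
  rw [← mulVec_mulVec, dotProduct_mulVec, ← mulVec_transpose, dotProduct]
  refine Finset.sum_congr rfl fun j _ => ?_
  have : (L.comp (LinearMap.toContinuousLinearMap W.mulVecLin)).comp
      (ContinuousLinearMap.single ℝ (fun _ => ℝ) j) 1 = (Wᵀ *ᵥ c) j := by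
    change L (W *ᵥ Pi.single j 1) = _
    rw [hL, mulVec_single_one, mulVec, dotProduct_comm]
    rfl
  rw [this, sq]

theorem map_mulVec_inputMeasure_eq {n d d' : ℕ} {W : Matrix (Fin n) (Fin d) ℝ}
    {W' : Matrix (Fin n) (Fin d') ℝ} (h : W * Wᵀ = W' * W'ᵀ) :
    ((inputMeasure d).map fun x => W *ᵥ x) = (inputMeasure d').map fun x => W' *ᵥ x := by
  have := Measure.isProbabilityMeasure_map (μ := inputMeasure d) (measurable_mulVec W).aemeasurable
  have := Measure.isProbabilityMeasure_map (μ := inputMeasure d')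
    (measurable_mulVec W').aemeasurable
  refine Measure.ext_of_charFunDual (funext fun L => ?_)
  rw [charFunDual_map_mulVec, charFunDual_map_mulVec, h]

theorem frob2_eq_trace {n m : ℕ} (A : Matrix (Fin n) (Fin m) ℝ) : frob2 A = (A * Aᵀ).trace := by
  simp [frob2, Matrix.trace, Matrix.mul_apply, sq]

theorem IsEigenbasis.frob2_eq {n : ℕ} {M : Matrix (Fin n) (Fin n) ℝ} (hM : Mᵀ = M)
    {b : Fin n → Fin n → ℝ} {lam : Fin n → ℝ} (h : IsEigenbasis M b lam) :
    frob2 M = ∑ i, lam i ^ 2 := by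
  rw [frob2_eq_trace, hM, h.trace_mul]
  refine Finset.sum_congr rfl fun i _ => ?_
  rw [h.2, dotProduct_smul, h.1, if_pos rfl, smul_eq_mul, mul_one, sq]

theorem IsEigenbasis.sub_one {n : ℕ} {M : Matrix (Fin n) (Fin n) ℝ}
    {b : Fin n → Fin n → ℝ} {lam : Fin n → ℝ} (h : IsEigenbasis M b lam) :
    IsEigenbasis (M - 1) b fun i => lam i - 1 :=
  ⟨h.1, fun i => by rw [sub_mulVec, h.2, one_mulVec, sub_smul, one_smul]⟩

/-- A Gram matrix has a square root which is at least as close to the identity. -/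
theorem exists_sqrt_frob2_le {n d : ℕ} (W : Matrix (Fin n) (Fin d) ℝ) :
    ∃ R : Matrix (Fin n) (Fin n) ℝ, R * Rᵀ = W * Wᵀ ∧ frob2 (R - 1) ≤ frob2 (W * Wᵀ - 1) := by
  have hK : (W * Wᵀ)ᵀ = W * Wᵀ := by rw [transpose_mul, transpose_transpose]
  obtain ⟨b, lam, hb⟩ := exists_isEigenbasis hK
  have hpos : ∀ i, 0 ≤ lam i := by
    intro i
    have h1 : b i ⬝ᵥ (W * Wᵀ) *ᵥ b i = lam i := by
      rw [hb.2, dotProduct_smul, hb.1, if_pos rfl, smul_eq_mul, mul_one]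
    rw [← h1, ← mulVec_mulVec, dotProduct_mulVec, ← mulVec_transpose]
    exact Finset.sum_nonneg fun _ _ => mul_self_nonneg _
  have hBB : Matrix.of b * (Matrix.of b)ᵀ = 1 := mul_eq_one_comm.mp hb.1.transpose_mul_self
  set R := (Matrix.of b)ᵀ * diagonal (fun i => √(lam i)) * Matrix.of b with hR
  have hRt : Rᵀ = R := by
    simp [hR, transpose_mul, Matrix.mul_assoc]
  have hRb : IsEigenbasis R b fun i => √(lam i) := by
    refine ⟨hb.1, fun i => ?_⟩
    have h1 : Matrix.of b *ᵥ b i = Pi.single i 1 := by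
      ext j
      have : (Matrix.of b *ᵥ b i) j = b j ⬝ᵥ b i := rfl
      rw [this, hb.1, Pi.single_apply]
    rw [hR, ← mulVec_mulVec, h1, ← mulVec_mulVec]
    ext j
    simp [mulVec, dotProduct, diagonal_apply, Pi.single_apply, mul_comm]
  refine ⟨R, ?_, ?_⟩
  · rw [hRt, hb.transpose_eq, hR]
    calc _ = (Matrix.of b)ᵀ * diagonal (fun i => √(lam i)) * (Matrix.of b * (Matrix.of b)ᵀ) *
          diagonal (fun i => √(lam i)) * Matrix.of b := by simp only [Matrix.mul_assoc]
      _ = _ := by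
          rw [hBB, Matrix.mul_one, Matrix.mul_assoc (Matrix.of b)ᵀ, diagonal_mul_diagonal]
          simp only [Real.mul_self_sqrt (hpos _)]
  · rw [hRb.sub_one.frob2_eq (by simp [hRt]), hb.sub_one.frob2_eq (by rw [transpose_sub, hK]; simp)]
    refine Finset.sum_le_sum fun i _ => ?_
    have h1 := Real.sq_sqrt (hpos i)
    have h2 := Real.sqrt_nonneg (lam i)
    nlinarith [mul_nonneg h2 (sq_nonneg (√(lam i) - 1)), sq_nonneg (√(lam i) - 1),
      mul_nonneg (mul_nonneg h2 h2) (sq_nonneg (√(lam i) - 1))]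

theorem softmaxFn_pos {c : ℕ} (z : Fin c → ℝ) (i : Fin c) : 0 < softmaxFn z i :=
  div_pos (Real.exp_pos _) (Finset.sum_pos (fun _ _ => Real.exp_pos _) ⟨i, Finset.mem_univ _⟩)

theorem sum_softmaxFn {c : ℕ} (hc : 0 < c) (z : Fin c → ℝ) : ∑ i, softmaxFn z i = 1 := by
  unfold softmaxFn
  rw [← Finset.sum_div, div_self]
  exact (Finset.sum_pos (fun _ _ => Real.exp_pos _) ⟨⟨0, hc⟩, Finset.mem_univ _⟩).ne'

theorem softmaxFn_le_one {c : ℕ} (z : Fin c → ℝ) (i : Fin c) : softmaxFn z i ≤ 1 := by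
  rw [← sum_softmaxFn (Fin.pos i) z]
  exact Finset.single_le_sum (fun j _ => (softmaxFn_pos z j).le) (Finset.mem_univ i)

theorem continuous_softmaxFn {c : ℕ} : Continuous (softmaxFn : (Fin c → ℝ) → Fin c → ℝ) := by
  refine continuous_pi fun i => ?_
  refine Continuous.div (by fun_prop) (by fun_prop) fun z => ?_
  exact (Finset.sum_pos (fun _ _ => Real.exp_pos _) ⟨i, Finset.mem_univ _⟩).ne'

theorem continuous_Amat {c : ℕ} : Continuous (Amat : (Fin c → ℝ) → Matrix (Fin c) (Fin c) ℝ) := by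
  unfold Amat
  exact continuous_softmaxFn.matrix_diagonal.sub
    (continuous_softmaxFn.matrix_vecMulVec continuous_softmaxFn)

theorem Amat_transpose {c : ℕ} (z : Fin c → ℝ) : (Amat z)ᵀ = Amat z := by
  ext i j
  simp only [Amat, transpose_apply, Matrix.sub_apply, vecMulVec_apply, diagonal_apply]
  by_cases h : i = j
  · rw [h]
  · rw [if_neg h, if_neg (Ne.symm h), mul_comm]

theorem abs_Amat_le {c : ℕ} (z : Fin c → ℝ) (a b : Fin c) : |Amat z a b| ≤ 1 := by
  have h1 := softmaxFn_pos z a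
  have h2 := softmaxFn_pos z b
  have h3 := softmaxFn_le_one z a
  have h4 := softmaxFn_le_one z b
  have h5 : 0 < softmaxFn z a * softmaxFn z b := mul_pos h1 h2
  have h6 : softmaxFn z a * softmaxFn z b ≤ softmaxFn z a := mul_le_of_le_one_right h1.le h4
  simp only [Amat, Matrix.sub_apply, vecMulVec_apply, diagonal_apply]
  split_ifs <;> rw [abs_le] <;> constructor <;> linarith

/-- The single-input Hessian as a function of the pre-activation vector. -/
noncomputable def reluHess {c n : ℕ} (W : Matrix (Fin c) (Fin n) ℝ) (h : Fin n → ℝ) :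
    Matrix (Fin n) (Fin n) ℝ :=
  Dmat h * Wᵀ * Amat (W *ᵥ fun i => max (h i) 0) * W * Dmat h

/-- The activation indicator. -/
noncomputable def act (t : ℝ) : ℝ := if 0 ≤ t then 1 else 0

theorem act_nonneg (t : ℝ) : 0 ≤ act t := by unfold act; split_ifs <;> norm_num

theorem act_le_one (t : ℝ) : act t ≤ 1 := by unfold act; split_ifs <;> norm_num

theorem measurable_act : Measurable act :=
  Measurable.ite measurableSet_Ici measurable_const measurable_const

theorem continuousAt_act {t : ℝ} (ht : t ≠ 0) : ContinuousAt act t := by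
  rcases lt_or_gt_of_ne ht with h | h
  · refine (continuousAt_const (y := (0 : ℝ))).congr ?_
    filter_upwards [Iio_mem_nhds h] with s hs
    rw [act, if_neg (not_le.mpr hs)]
  · refine (continuousAt_const (y := (1 : ℝ))).congr ?_
    filter_upwards [Ioi_mem_nhds h] with s hs
    rw [act, if_pos (le_of_lt hs)]

theorem reluHess_apply {c n : ℕ} (W : Matrix (Fin c) (Fin n) ℝ) (h : Fin n → ℝ) (i j : Fin n) :
    reluHess W h i j = act (h i) * act (h j) *
      (Wᵀ * Amat (W *ᵥ fun i => max (h i) 0) * W) i j := by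
  unfold reluHess Dmat
  simp only [Matrix.mul_assoc]
  rw [diagonal_mul]
  simp only [← Matrix.mul_assoc]
  rw [mul_diagonal]
  simp only [act]
  ring

/-- A uniform bound for the entries of the single-input Hessian. -/
noncomputable def hessBound {c n : ℕ} (W : Matrix (Fin c) (Fin n) ℝ) (i j : Fin n) : ℝ :=
  ∑ b, (∑ a, |W a i|) * |W b j|

theorem abs_reluHess_le {c n : ℕ} (W : Matrix (Fin c) (Fin n) ℝ) (h : Fin n → ℝ) (i j : Fin n) :
    |reluHess W h i j| ≤ hessBound W i j := by
  rw [reluHess_apply, abs_mul, abs_mul, abs_of_nonneg (act_nonneg _),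
    abs_of_nonneg (act_nonneg _)]
  have h1 : act (h i) * act (h j) ≤ 1 :=
    mul_le_one₀ (act_le_one _) (act_nonneg _) (act_le_one _)
  refine (mul_le_of_le_one_left (abs_nonneg _) h1).trans ?_
  rw [Matrix.mul_apply, hessBound]
  refine (Finset.abs_sum_le_sum_abs _ _).trans (Finset.sum_le_sum fun b _ => ?_)
  rw [abs_mul]
  refine mul_le_mul_of_nonneg_right ?_ (abs_nonneg _)
  rw [Matrix.mul_apply]
  refine (Finset.abs_sum_le_sum_abs _ _).trans (Finset.sum_le_sum fun a _ => ?_)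
  rw [abs_mul, transpose_apply]
  exact mul_le_of_le_one_right (abs_nonneg _) (abs_Amat_le _ _ _)

theorem reluHess_transpose {c n : ℕ} (W : Matrix (Fin c) (Fin n) ℝ) (h : Fin n → ℝ) :
    (reluHess W h)ᵀ = reluHess W h := by
  simp only [reluHess, transpose_mul, transpose_transpose, Amat_transpose, Dmat,
    diagonal_transpose, Matrix.mul_assoc]

theorem continuous_preHess (c n : ℕ) :
    Continuous fun p : Matrix (Fin c) (Fin n) ℝ × (Fin n → ℝ) =>
      p.1ᵀ * Amat (p.1 *ᵥ fun i => max (p.2 i) 0) * p.1 := by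
  have h1 : Continuous fun p : Matrix (Fin c) (Fin n) ℝ × (Fin n → ℝ) =>
      p.1 *ᵥ fun i => max (p.2 i) 0 :=
    Continuous.matrix_mulVec continuous_fst
      (continuous_pi fun i => ((continuous_apply i).comp continuous_snd).max continuous_const)
  exact (continuous_fst.matrix_transpose.matrix_mul (continuous_Amat.comp h1)).matrix_mul
    continuous_fst

theorem continuousAt_reluHess {c n : ℕ} (W : Matrix (Fin c) (Fin n) ℝ) {h : Fin n → ℝ}
    (hh : ∀ i, h i ≠ 0) (i j : Fin n) : ContinuousAt (fun h => reluHess W h i j) h := by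
  simp only [reluHess_apply]
  refine ContinuousAt.mul (ContinuousAt.mul ?_ ?_) ?_
  · exact (continuousAt_act (hh i)).comp (f := fun h : Fin n → ℝ => h i)
      (continuous_apply i).continuousAt
  · exact (continuousAt_act (hh j)).comp (f := fun h : Fin n → ℝ => h j)
      (continuous_apply j).continuousAt
  · exact (((continuous_preHess c n).comp (Continuous.prodMk_right W)).matrix_elem i j).continuousAt

theorem measurable_reluHess {c n : ℕ} (i j : Fin n) :
    Measurable fun p : ((Fin c × Fin n) → ℝ) × (Fin n → ℝ) => reluHess (W2of p.1) p.2 i j := by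
  simp only [reluHess_apply]
  refine Measurable.mul (Measurable.mul ?_ ?_) ?_
  · exact measurable_act.comp ((measurable_pi_apply i).comp measurable_snd)
  · exact measurable_act.comp ((measurable_pi_apply j).comp measurable_snd)
  · have h1 : Continuous fun p : ((Fin c × Fin n) → ℝ) × (Fin n → ℝ) =>
        ((W2of p.1 : Matrix (Fin c) (Fin n) ℝ), p.2) :=
      Continuous.prodMk (continuous_matrix fun a b => by
        exact (continuous_apply (a, b)).comp continuous_fst) continuous_snd
    exact (((continuous_preHess c n).comp h1).matrix_elem i j).measurable

theorem measurable_reluHess_right {c n : ℕ} (W : Matrix (Fin c) (Fin n) ℝ) (i j : Fin n) :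
    Measurable fun h => reluHess W h i j := by
  simp only [reluHess_apply]
  refine Measurable.mul (Measurable.mul ?_ ?_) ?_
  · exact measurable_act.comp (measurable_pi_apply i)
  · exact measurable_act.comp (measurable_pi_apply j)
  · exact (((continuous_preHess c n).comp (Continuous.prodMk_right W)).matrix_elem i j).measurable

theorem integrable_reluHess {c n : ℕ} (W : Matrix (Fin c) (Fin n) ℝ) (i j : Fin n)
    (μ : Measure (Fin n → ℝ)) [IsFiniteMeasure μ] :
    Integrable (fun h => reluHess W h i j) μ :=
  Integrable.of_bound (measurable_reluHess_right W i j).aestronglyMeasurable (hessBound W i j)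
    (ae_of_all _ fun h => abs_reluHess_le W h i j)

/-- The expected Hessian when the pre-activations have the law of `R g`, `g` standard Gaussian. -/
noncomputable def gaussHess {c n : ℕ} (W : Matrix (Fin c) (Fin n) ℝ)
    (R : Matrix (Fin n) (Fin n) ℝ) : Matrix (Fin n) (Fin n) ℝ :=
  Matrix.of fun i j => ∫ g, reluHess W (R *ᵥ g) i j ∂(inputMeasure n)

theorem gaussHess_transpose {c n : ℕ} (W : Matrix (Fin c) (Fin n) ℝ)
    (R : Matrix (Fin n) (Fin n) ℝ) : (gaussHess W R)ᵀ = gaussHess W R := by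
  ext i j
  simp only [transpose_apply, gaussHess, of_apply]
  congr 1
  ext g
  rw [← transpose_apply (reluHess W _), reluHess_transpose]

theorem outputHessian_eq_gaussHess {c d n : ℕ}
    (w : ((Fin n × Fin d) → ℝ) × ((Fin c × Fin n) → ℝ)) {R : Matrix (Fin n) (Fin n) ℝ}
    (hR : R * Rᵀ = W1of w.1 * (W1of w.1)ᵀ) :
    outputHessian c d n w = gaussHess (W2of w.2) R := by
  ext i j
  simp only [outputHessian, gaussHess, of_apply]
  have h1 := integral_map (μ := inputMeasure d) (measurable_mulVec (W1of w.1)).aemeasurable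
    (f := fun h => reluHess (W2of w.2) h i j)
    (measurable_reluHess_right (W2of w.2) i j).aestronglyMeasurable
  have h2 := integral_map (μ := inputMeasure n) (measurable_mulVec R).aemeasurable
    (f := fun h => reluHess (W2of w.2) h i j)
    (measurable_reluHess_right (W2of w.2) i j).aestronglyMeasurable
  rw [← h2, map_mulVec_inputMeasure_eq hR, h1]
  rfl

theorem outputHessian_transpose {c d n : ℕ}
    (w : ((Fin n × Fin d) → ℝ) × ((Fin c × Fin n) → ℝ)) :
    (outputHessian c d n w)ᵀ = outputHessian c d n w := by
  obtain ⟨R, hR, -⟩ := exists_sqrt_frob2_le (W1of w.1)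
  rw [outputHessian_eq_gaussHess w hR, gaussHess_transpose]

theorem ae_inputMeasure_ne_zero (n : ℕ) : ∀ᵐ g ∂(inputMeasure n), ∀ i, g i ≠ 0 := by
  rw [ae_all_iff]
  intro i
  have h1 : MeasurePreserving (Function.eval i) (inputMeasure n) (gaussianReal 0 1) :=
    measurePreserving_eval (fun _ : Fin n => gaussianReal 0 1) i
  have := nullSingletonClass_gaussianReal (μ := 0) (v := 1) one_ne_zero
  have h2 : ∀ᵐ t ∂(gaussianReal 0 1), t ≠ 0 := by
    rw [ae_iff]
    simp only [not_not]
    exact measure_singleton 0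
  exact h1.quasiMeasurePreserving.ae h2

theorem continuousAt_gaussHess {c n : ℕ} (W : Matrix (Fin c) (Fin n) ℝ) :
    ContinuousAt (gaussHess W) 1 := by
  refine continuousAt_pi.mpr fun i => continuousAt_pi.mpr fun j => ?_
  change ContinuousAt (fun R => ∫ g, reluHess W (R *ᵥ g) i j ∂(inputMeasure n)) 1
  have : FirstCountableTopology (Matrix (Fin n) (Fin n) ℝ) :=
    inferInstanceAs (FirstCountableTopology (Fin n → Fin n → ℝ))
  refine continuousAt_of_dominated (bound := fun _ => hessBound W i j) ?_ ?_ ?_ ?_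
  · exact Eventually.of_forall fun R =>
      ((measurable_reluHess_right W i j).comp (measurable_mulVec R)).aestronglyMeasurable
  · exact Eventually.of_forall fun R => ae_of_all _ fun g => abs_reluHess_le W _ i j
  · exact integrable_const _
  · filter_upwards [ae_inputMeasure_ne_zero n] with g hg
    refine ContinuousAt.comp (g := fun h => reluHess W h i j) (f := fun R => R *ᵥ g) ?_ ?_
    · rw [one_mulVec]
      exact continuousAt_reluHess W hg i j
    · exact (Continuous.matrix_mulVec continuous_id continuous_const).continuousAt

theorem exists_frob2_lt_mem {n : ℕ} {U : Set (Matrix (Fin n) (Fin n) ℝ)}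
    (hU : U ∈ nhds (1 : Matrix (Fin n) (Fin n) ℝ)) :
    ∃ δ > 0, ∀ R : Matrix (Fin n) (Fin n) ℝ, frob2 (R - 1) < δ → R ∈ U := by
  have h1 : Tendsto id (comap (fun R : Matrix (Fin n) (Fin n) ℝ => frob2 (R - 1)) (nhds 0))
      (nhds 1) := by
    refine tendsto_pi_nhds.mpr fun i => tendsto_pi_nhds.mpr fun j => ?_
    rw [tendsto_iff_dist_tendsto_zero]
    have h2 : Tendsto (fun R : Matrix (Fin n) (Fin n) ℝ => √(frob2 (R - 1)))
        (comap (fun R : Matrix (Fin n) (Fin n) ℝ => frob2 (R - 1)) (nhds 0)) (nhds 0) := by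
      have := (Real.continuous_sqrt.tendsto 0).comp
        (tendsto_comap (f := fun R : Matrix (Fin n) (Fin n) ℝ => frob2 (R - 1)) (x := nhds 0))
      rwa [Real.sqrt_zero] at this
    refine squeeze_zero (fun _ => dist_nonneg) (fun R => ?_) h2
    rw [Real.dist_eq]
    refine Real.abs_le_sqrt ?_
    refine le_trans ?_ (Finset.single_le_sum (f := fun i => ∑ j, (R - 1) i j ^ 2)
      (fun _ _ => Finset.sum_nonneg fun _ _ => sq_nonneg _) (Finset.mem_univ i))
    exact Finset.single_le_sum (f := fun j => (R - 1) i j ^ 2)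
      (fun _ _ => sq_nonneg _) (Finset.mem_univ j)
  have h3 := ((Metric.nhds_basis_ball (x := (0 : ℝ))).comap
    (fun R : Matrix (Fin n) (Fin n) ℝ => frob2 (R - 1))).mem_iff.mp (h1 hU)
  obtain ⟨δ, hδ, h⟩ := h3
  refine ⟨δ, hδ, fun R hR => h ?_⟩
  have h0 : 0 ≤ frob2 (R - 1) :=
    Finset.sum_nonneg fun _ _ => Finset.sum_nonneg fun _ _ => sq_nonneg _
  simpa [abs_of_nonneg h0] using hR

/-- The limit of the output Hessian as the input dimension tends to infinity. -/
noncomputable def limHess {c n : ℕ} (W : Matrix (Fin c) (Fin n) ℝ) : Matrix (Fin n) (Fin n) ℝ :=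
  gaussHess W 1

theorem outputHessian_mem_of_frob2_lt {c n : ℕ} (W : Matrix (Fin c) (Fin n) ℝ)
    {U : Set (Matrix (Fin n) (Fin n) ℝ)} (hU : U ∈ nhds (limHess W)) :
    ∃ δ > 0, ∀ (d : ℕ) (w : ((Fin n × Fin d) → ℝ) × ((Fin c × Fin n) → ℝ)), W2of w.2 = W →
      frob2 (W1of w.1 * (W1of w.1)ᵀ - 1) < δ → outputHessian c d n w ∈ U := by
  obtain ⟨δ, hδ, h⟩ := exists_frob2_lt_mem ((continuousAt_gaussHess W) hU)
  refine ⟨δ, hδ, fun d w hw hlt => ?_⟩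
  obtain ⟨R, hR, hle⟩ := exists_sqrt_frob2_le (W1of w.1)
  rw [outputHessian_eq_gaussHess w hR, hw]
  exact h R (hle.trans_lt hlt)

/-- The law of a finite family of i.i.d. centred Gaussian variables of variance `v`. -/
noncomputable abbrev gaussianPi (ι : Type*) [Fintype ι] (v : ℝ≥0) : Measure (ι → ℝ) :=
  Measure.pi fun _ => gaussianReal 0 v

/-- The fourth moment of the standard Gaussian. -/
noncomputable def fourthMoment : ℝ := ∫ t, t ^ 4 ∂(gaussianReal 0 1)

theorem integrable_pow_gaussianReal (v : ℝ≥0) (k : ℕ) :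
    Integrable (fun t : ℝ => t ^ k) (gaussianReal 0 v) := by
  have h := (memLp_id_gaussianReal (μ := 0) (v := v) (k : ℝ≥0)).integrable_norm_pow'
  refine h.mono' (by fun_prop) (ae_of_all _ fun t => ?_)
  simp

theorem integral_pow_four_gaussianReal (v : ℝ≥0) :
    ∫ t, t ^ 4 ∂(gaussianReal 0 v) = v ^ 2 * fourthMoment := by
  have h := gaussianReal_map_const_mul (μ := 0) (v := 1) (√v)
  have hv : NNReal.mk (√(v : ℝ) ^ 2) (sq_nonneg _) * 1 = v := by
    ext
    simp
  rw [mul_zero, hv] at h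
  rw [← h, integral_map (by fun_prop) (by fun_prop), fourthMoment, ← integral_const_mul]
  congr 1
  ext t
  rw [mul_pow, show √(v : ℝ) ^ 4 = (√(v : ℝ) ^ 2) ^ 2 by ring, Real.sq_sqrt v.coe_nonneg]

section GaussianPi

variable {ι : Type*} [Fintype ι] (v : ℝ≥0)

theorem measurePreserving_gaussianPi (i : ι) :
    MeasurePreserving (Function.eval i) (gaussianPi ι v) (gaussianReal 0 v) :=
  measurePreserving_eval (fun _ : ι => gaussianReal 0 v) i

theorem integrable_pow_gaussianPi (i : ι) (k : ℕ) :
    Integrable (fun w : ι → ℝ => w i ^ k) (gaussianPi ι v) :=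
  (measurePreserving_gaussianPi v i).integrable_comp_of_integrable (integrable_pow_gaussianReal v k)

theorem integral_comp_gaussianPi (i : ι) (f : ℝ → ℝ) (hf : Continuous f) :
    ∫ w, f (w i) ∂(gaussianPi ι v) = ∫ t, f t ∂(gaussianReal 0 v) := by
  rw [← (measurePreserving_gaussianPi v i).map_eq,
    integral_map (measurable_pi_apply i).aemeasurable hf.aestronglyMeasurable]

theorem iIndepFun_gaussianPi : iIndepFun (fun (i : ι) (w : ι → ℝ) => w i) (gaussianPi ι v) :=
  iIndepFun_pi (X := fun _ t => t) fun _ => aemeasurable_id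

theorem integrable_sq_mul_sq_gaussianPi (i j : ι) :
    Integrable (fun w : ι → ℝ => (w i * w j) ^ 2) (gaussianPi ι v) := by
  refine ((integrable_pow_gaussianPi v i 4).add (integrable_pow_gaussianPi v j 4)).mono'
    (by fun_prop) (ae_of_all _ fun w => ?_)
  rw [Real.norm_of_nonneg (sq_nonneg _)]
  simp only [Pi.add_apply]
  nlinarith [sq_nonneg (w i ^ 2 - w j ^ 2), sq_nonneg (w i ^ 2), sq_nonneg (w j ^ 2)]

theorem memLp_mul_gaussianPi (i j : ι) :
    MemLp (fun w : ι → ℝ => w i * w j) 2 (gaussianPi ι v) :=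
  (memLp_two_iff_integrable_sq (by fun_prop)).mpr (integrable_sq_mul_sq_gaussianPi v i j)

theorem integrable_mul_gaussianPi (i j : ι) :
    Integrable (fun w : ι → ℝ => w i * w j) (gaussianPi ι v) :=
  (memLp_mul_gaussianPi v i j).integrable (by norm_num)

theorem integral_mul_gaussianPi [DecidableEq ι] (i j : ι) :
    ∫ w, w i * w j ∂(gaussianPi ι v) = if i = j then (v : ℝ) else 0 := by
  split_ifs with h
  · subst h
    rw [integral_comp_gaussianPi v i (fun t => t * t) (by fun_prop)]
    have h1 := variance_fun_id_gaussianReal (μ := 0) (v := v)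
    rw [variance_eq_integral (by fun_prop), integral_id_gaussianReal] at h1
    rw [← h1]
    congr 1
    ext t
    ring
  · have h1 := ((iIndepFun_gaussianPi (ι := ι) v).indepFun h).integral_fun_mul_eq_mul_integral
      (measurable_pi_apply i).aestronglyMeasurable (measurable_pi_apply j).aestronglyMeasurable
    rw [h1, integral_comp_gaussianPi v i (fun t => t) (by fun_prop), integral_id_gaussianReal,
      zero_mul]

theorem variance_mul_le_gaussianPi (i j : ι) :
    variance (fun w : ι → ℝ => w i * w j) (gaussianPi ι v) ≤ v ^ 2 * fourthMoment := by
  refine (variance_le_expectation_sq (by fun_prop)).trans ?_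
  have h : ∀ i : ι, ∫ w, w i ^ 4 ∂(gaussianPi ι v) = v ^ 2 * fourthMoment := fun i => by
    rw [integral_comp_gaussianPi v i (fun t => t ^ 4) (by fun_prop), integral_pow_four_gaussianReal]
  have h1 : ∫ w, (1 / 2 * w i ^ 4 + 1 / 2 * w j ^ 4) ∂(gaussianPi ι v) =
      v ^ 2 * fourthMoment := by
    rw [integral_add ((integrable_pow_gaussianPi v i 4).const_mul _)
      ((integrable_pow_gaussianPi v j 4).const_mul _), integral_const_mul, integral_const_mul,
      h, h]
    ring
  rw [← h1]
  refine integral_mono (integrable_sq_mul_sq_gaussianPi v i j)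
    (((integrable_pow_gaussianPi v i 4).const_mul _).add
      ((integrable_pow_gaussianPi v j 4).const_mul _)) fun w => ?_
  simp only [Pi.pow_apply]
  nlinarith [sq_nonneg (w i ^ 2 - w j ^ 2)]

end GaussianPi

/-- Chebyshev bound for the entries of the Gram matrix of a Gaussian matrix. -/
theorem gaussianPi_gram_deviation {p q : ℕ} (v : ℝ≥0) (a b : Fin p) {η : ℝ} (hη : 0 < η) :
    gaussianPi (Fin p × Fin q) v
      {w | η ≤ |∑ j, w (a, j) * w (b, j) - if a = b then (q * v : ℝ) else 0|} ≤
      ENNReal.ofReal (q * v ^ 2 * fourthMoment / η ^ 2) := by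
  set X : Fin q → (Fin p × Fin q → ℝ) → ℝ := fun j w => w (a, j) * w (b, j) with hX
  have hm : ∀ j, MemLp (X j) 2 (gaussianPi (Fin p × Fin q) v) := fun j =>
    memLp_mul_gaussianPi v (a, j) (b, j)
  have hsum : (fun w => ∑ j, X j w) = ∑ j, X j := by
    ext w
    rw [Finset.sum_apply]
  have hmean : ∫ w, (∑ j, X j) w ∂(gaussianPi (Fin p × Fin q) v) =
      if a = b then (q * v : ℝ) else 0 := by
    simp only [Finset.sum_apply]
    rw [integral_finsetSum _ fun j _ => (hm j).integrable (by norm_num)]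
    simp only [hX, integral_mul_gaussianPi, Prod.mk.injEq, and_true]
    split_ifs <;> simp
  have hvar : variance (∑ j, X j) (gaussianPi (Fin p × Fin q) v) ≤ q * v ^ 2 * fourthMoment := by
    rw [IndepFun.variance_sum (fun j _ => hm j)]
    · refine (Finset.sum_le_sum fun j _ => variance_mul_le_gaussianPi v (a, j) (b, j)).trans ?_
      simp [mul_assoc]
    · intro j _ k _ hjk
      exact (iIndepFun_gaussianPi v).indepFun_mul_mul (fun i => measurable_pi_apply i)
        (a, j) (b, j) (a, k) (b, k) (by simp [hjk]) (by simp [hjk]) (by simp [hjk]) (by simp [hjk])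
  have h := meas_ge_le_variance_div_sq (memLp_finsetSum' Finset.univ fun j _ => hm j) hη
  rw [hmean] at h
  simp only [Finset.sum_apply] at h
  refine h.trans (ENNReal.ofReal_le_ofReal ?_)
  gcongr

theorem frob2_lt_of_abs_lt {p q : ℕ} {A : Matrix (Fin p) (Fin q) ℝ} {δ : ℝ} (hδ : 0 < δ)
    (h : ∀ a b, |A a b| < √(δ / (p * q + 1))) : frob2 A < δ := by
  have h1 : ∀ a b, A a b ^ 2 ≤ δ / (p * q + 1) := fun a b => by
    rw [← sq_abs]
    exact (Real.lt_sqrt (abs_nonneg _)).mp (h a b) |>.le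
  have hpos : (0 : ℝ) < p * q + 1 := by positivity
  calc frob2 A ≤ ∑ _a : Fin p, ∑ _b : Fin q, δ / (p * q + 1) :=
        Finset.sum_le_sum fun a _ => Finset.sum_le_sum fun b _ => h1 a b
    _ = p * q * (δ / (p * q + 1)) := by simp [mul_assoc]
    _ < δ := by
        rw [mul_div_assoc', div_lt_iff₀ hpos]
        nlinarith

theorem W1of_gram_apply {p q : ℕ} (w : Fin p × Fin q → ℝ) (a b : Fin p) :
    (W1of w * (W1of w)ᵀ) a b = ∑ j, w (a, j) * w (b, j) := by
  simp [Matrix.mul_apply, W1of]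

theorem tendsto_gram_deviation (p : ℕ) {η : ℝ} (hη : 0 < η) :
    Tendsto (fun q : ℕ => gaussianPi (Fin p × Fin q) (q : ℝ≥0)⁻¹
      {w | ∃ a b, η ≤ |∑ j, w (a, j) * w (b, j) - (1 : Matrix (Fin p) (Fin p) ℝ) a b|})
      atTop (nhds 0) := by
  have hlim : Tendsto (fun q : ℕ => ∑ _a : Fin p, ∑ _b : Fin p,
      ENNReal.ofReal (fourthMoment / η ^ 2 * (q : ℝ)⁻¹)) atTop (nhds 0) := by
    have h0 : Tendsto (fun q : ℕ => ENNReal.ofReal (fourthMoment / η ^ 2 * (q : ℝ)⁻¹)) atTop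
        (nhds 0) := by
      rw [← ENNReal.ofReal_zero]
      refine (ENNReal.continuous_ofReal.tendsto 0).comp ?_
      rw [← mul_zero (fourthMoment / η ^ 2)]
      exact tendsto_const_nhds.mul (tendsto_inv_atTop_zero.comp tendsto_natCast_atTop_atTop)
    rw [← (show ∑ _a : Fin p, ∑ _b : Fin p, (0 : ℝ≥0∞) = 0 by simp)]
    exact tendsto_finsetSum _ fun a _ => tendsto_finsetSum _ fun b _ => h0
  refine tendsto_of_tendsto_of_tendsto_of_le_of_le' tendsto_const_nhds hlim
    (Eventually.of_forall fun _ => zero_le) ?_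
  filter_upwards [eventually_gt_atTop 0] with q hq
  have hq' : (q : ℝ) ≠ 0 := by positivity
  have hset : {w : Fin p × Fin q → ℝ | ∃ a b,
      η ≤ |∑ j, w (a, j) * w (b, j) - (1 : Matrix (Fin p) (Fin p) ℝ) a b|} =
      ⋃ a, ⋃ b, {w | η ≤ |∑ j, w (a, j) * w (b, j) - (1 : Matrix (Fin p) (Fin p) ℝ) a b|} := by
    ext w
    simp
  rw [hset]
  refine (measure_iUnion_fintype_le _ _).trans (Finset.sum_le_sum fun a _ =>
    (measure_iUnion_fintype_le _ _).trans (Finset.sum_le_sum fun b _ => ?_))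
  have h := gaussianPi_gram_deviation (q := q) (q : ℝ≥0)⁻¹ a b hη
  have h1 : ((q : ℝ) * ((q : ℝ≥0)⁻¹ : ℝ≥0) : ℝ) = 1 := by
    push_cast
    exact mul_inv_cancel₀ hq'
  rw [h1] at h
  refine h.trans (ENNReal.ofReal_le_ofReal (le_of_eq ?_))
  push_cast
  field_simp

theorem tendsto_frob2_gram (n : ℕ) {δ : ℝ} (hδ : 0 < δ) :
    Tendsto (fun d : ℕ => gaussianPi (Fin n × Fin d) (d : ℝ≥0)⁻¹
      {w | δ ≤ frob2 (W1of w * (W1of w)ᵀ - 1)}) atTop (nhds 0) := by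
  have hη : 0 < √(δ / (n * n + 1)) := Real.sqrt_pos.mpr (by positivity)
  refine tendsto_of_tendsto_of_tendsto_of_le_of_le tendsto_const_nhds
    (tendsto_gram_deviation n hη) (fun _ => zero_le) fun d => measure_mono fun w hw => ?_
  by_contra hcon
  simp only [Set.mem_ofPred_eq, not_exists, not_le] at hcon
  refine absurd hw (not_le.mpr (frob2_lt_of_abs_lt hδ fun a b => ?_))
  rw [Matrix.sub_apply, W1of_gram_apply]
  exact hcon a b

/-- Preimages of closed sets of spectral data under entrywise measurable maps. -/
theorem measurableSet_specData_mem {Ω : Type*} [MeasurableSpace Ω] {m n : ℕ} (ε : ℝ)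
    {M : Ω → Matrix (Fin n) (Fin n) ℝ} (hM : ∀ i j, Measurable fun ω => M ω i j)
    {V : Ω → Matrix (Fin m) (Fin n) ℝ} (hV : ∀ i j, Measurable fun ω => V ω i j)
    {F : Set (SpecData n)} (hF : IsClosed F) : MeasurableSet {ω | specData ε (M ω) (V ω) ∈ F} := by
  have hM' : Measurable (fun ω i j => M ω i j) :=
    measurable_pi_lambda _ fun i => measurable_pi_lambda _ fun j => hM i j
  have hV' : Measurable (fun ω i j => V ω i j) :=
    measurable_pi_lambda _ fun i => measurable_pi_lambda _ fun j => hV i j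
  have hc : Continuous fun p : (Fin n → Fin n → ℝ) × (Fin m → Fin n → ℝ) =>
      specData ε (Matrix.of p.1) (Matrix.of p.2) := by
    have hV2 : Continuous fun p : (Fin n → Fin n → ℝ) × (Fin m → Fin n → ℝ) =>
        (Matrix.of p.2 : Matrix (Fin m) (Fin n) ℝ) := continuous_snd
    have hV1 : Continuous fun p : (Fin n → Fin n → ℝ) × (Fin m → Fin n → ℝ) =>
        (Matrix.of p.1 : Matrix (Fin n) (Fin n) ℝ) := continuous_fst
    unfold specData gramProj gramDet
    have hG := hV2.matrix_mul hV2.matrix_transpose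
    exact hV1.prodMk (((hV2.matrix_transpose.matrix_mul hG.matrix_adjugate).matrix_mul hV2).prodMk
      (continuous_const.mul hG.matrix_det))
  exact (hM'.prodMk hV') ((hF.preimage hc).measurableSet)

theorem hessOne_eq_reluHess {c d n : ℕ}
    (w : ((Fin n × Fin d) → ℝ) × ((Fin c × Fin n) → ℝ)) (x : Fin d → ℝ) :
    hessOne w x = reluHess (W2of w.2) (W1of w.1 *ᵥ x) := rfl

theorem measurable_outputHessian_apply {c d n : ℕ} (i j : Fin n) :
    Measurable fun w : ((Fin n × Fin d) → ℝ) × ((Fin c × Fin n) → ℝ) =>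
      outputHessian c d n w i j := by
  simp only [outputHessian, of_apply, hessOne_eq_reluHess]
  have h1 : Continuous fun p : (((Fin n × Fin d) → ℝ) × ((Fin c × Fin n) → ℝ)) × (Fin d → ℝ) =>
      (p.1.2, W1of p.1.1 *ᵥ p.2) := by
    refine Continuous.prodMk (by fun_prop) (Continuous.matrix_mulVec ?_ continuous_snd)
    refine continuous_matrix fun a b => ?_
    simp only [W1of, of_apply]
    fun_prop
  have h2 := (measurable_reluHess (c := c) i j).comp h1.measurable
  simp only [Function.comp_def] at h2
  exact h2.stronglyMeasurable.integral_prod_right'.measurable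

theorem measurable_limHess_apply {c n : ℕ} (i j : Fin n) :
    Measurable fun w : (Fin c × Fin n) → ℝ => limHess (W2of w) i j := by
  simp only [limHess, gaussHess, of_apply, one_mulVec]
  exact (StronglyMeasurable.integral_prod_right' (f := fun p : ((Fin c × Fin n) → ℝ) ×
    (Fin n → ℝ) => reluHess (W2of p.1) p.2 i j)
    (measurable_reluHess i j).stronglyMeasurable).measurable

theorem measurable_rowDiff_W2of {m n : ℕ} (i : Fin m) (j : Fin n) :
    Measurable fun w : (Fin (m + 1) × Fin n) → ℝ => rowDiff (W2of w) i j :=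
  (measurable_pi_apply (i.castSucc, j)).sub (measurable_pi_apply (Fin.last m, j))

/-- Spectral data of the output Hessian at finite input dimension. -/
noncomputable def outData {m n : ℕ} (ε : ℝ) (d : ℕ)
    (w : ((Fin n × Fin d) → ℝ) × ((Fin (m + 1) × Fin n) → ℝ)) : SpecData n :=
  specData ε (outputHessian (m + 1) d n w) (rowDiff (W2of w.2))

/-- Spectral data of the limiting output Hessian. -/
noncomputable def limData {m n : ℕ} (ε : ℝ) (w : (Fin (m + 1) × Fin n) → ℝ) : SpecData n :=
  specData ε (limHess (W2of w)) (rowDiff (W2of w))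

theorem measurableSet_outData_mem {m n : ℕ} (ε : ℝ) (d : ℕ) {F : Set (SpecData n)}
    (hF : IsClosed F) : MeasurableSet {w | outData (m := m) ε d w ∈ F} :=
  measurableSet_specData_mem ε (fun i j => measurable_outputHessian_apply i j)
    (fun i j => (measurable_rowDiff_W2of i j).comp measurable_snd) hF

theorem measurableSet_limData_mem {m n : ℕ} (ε : ℝ) {F : Set (SpecData n)}
    (hF : IsClosed F) : MeasurableSet {w | limData (m := m) ε w ∈ F} :=
  measurableSet_specData_mem ε (fun i j => measurable_limHess_apply i j)
    (fun i j => measurable_rowDiff_W2of i j) hF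

theorem tendsto_outData_mem {m n : ℕ} (ε : ℝ) {F : Set (SpecData n)} (hF : IsClosed F)
    (w : (Fin (m + 1) × Fin n) → ℝ) (hw : limData ε w ∉ F) :
    Tendsto (fun d : ℕ => gaussianPi (Fin n × Fin d) (d : ℝ≥0)⁻¹ {w1 | outData ε d (w1, w) ∈ F})
      atTop (nhds 0) := by
  have hU : {M | specData ε M (rowDiff (W2of w)) ∈ Fᶜ} ∈ nhds (limHess (W2of w)) := by
    refine ContinuousAt.preimage_mem_nhds ?_ (hF.isOpen_compl.mem_nhds hw)
    exact (continuous_id.prodMk continuous_const).continuousAt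
  obtain ⟨δ, hδ, h⟩ := outputHessian_mem_of_frob2_lt (W2of w) hU
  refine tendsto_of_tendsto_of_tendsto_of_le_of_le tendsto_const_nhds
    (tendsto_frob2_gram n hδ) (fun _ => zero_le) fun d => measure_mono fun w1 hw1 => ?_
  by_contra hlt
  exact h d (w1, w) rfl (not_le.mp hlt) hw1

theorem tendsto_outData_notMem {m n : ℕ} (ε : ℝ) {F : Set (SpecData n)} (hF : IsClosed F)
    (w : (Fin (m + 1) × Fin n) → ℝ) (hw : limData ε w ∉ F) :
    Tendsto (fun d : ℕ => gaussianPi (Fin n × Fin d) (d : ℝ≥0)⁻¹ {w1 | outData ε d (w1, w) ∉ F})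
      atTop (nhds 1) := by
  have h : ∀ d : ℕ, gaussianPi (Fin n × Fin d) (d : ℝ≥0)⁻¹ {w1 | outData ε d (w1, w) ∉ F} =
      1 - gaussianPi (Fin n × Fin d) (d : ℝ≥0)⁻¹ {w1 | outData ε d (w1, w) ∈ F} := by
    intro d
    rw [← prob_compl_eq_one_sub]
    · rfl
    · exact measurable_prodMk_right (measurableSet_outData_mem ε d hF)
  simp only [h]
  simpa using ENNReal.Tendsto.sub (tendsto_const_nhds (x := (1 : ℝ≥0∞)))
    (tendsto_outData_mem ε hF w hw) (Or.inl ENNReal.one_ne_top)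

theorem tendsto_prod_measure {Ω : Type*} [MeasurableSpace Ω] {X : ℕ → Type*}
    [∀ d, MeasurableSpace (X d)] (μ : ∀ d, Measure (X d)) [∀ d, IsProbabilityMeasure (μ d)]
    (ν : Measure Ω) [IsProbabilityMeasure ν] {S : ∀ d, Set (X d × Ω)}
    (hS : ∀ d, MeasurableSet (S d)) {T : Set Ω} (hT : MeasurableSet T)
    (h1 : ∀ᵐ w ∂ν, w ∈ T → Tendsto (fun d => μ d {x | (x, w) ∈ S d}) atTop (nhds 1))
    (h0 : ∀ᵐ w ∂ν, w ∉ T → Tendsto (fun d => μ d {x | (x, w) ∈ S d}) atTop (nhds 0)) :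
    Tendsto (fun d => ((μ d).prod ν) (S d)) atTop (nhds (ν T)) := by
  have h : ∀ d, ((μ d).prod ν) (S d) = ∫⁻ w, μ d {x | (x, w) ∈ S d} ∂ν := fun d =>
    Measure.prod_apply_symm (hS d)
  simp only [h]
  rw [← lintegral_indicator_one hT]
  refine tendsto_lintegral_of_dominated_convergence (fun _ => 1)
    (fun d => measurable_measure_prodMk_right (hS d))
    (fun d => ae_of_all _ fun w => prob_le_one) (by simp) ?_
  filter_upwards [h1, h0] with w hw1 hw0
  by_cases hw : w ∈ T
  · simpa [hw] using hw1 hw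
  · simpa [hw] using hw0 hw

theorem tendsto_weightMeasure_overlapGood {m n : ℕ} (hm : 0 < m) (hmn : m ≤ n) (ε : ℝ)
    (hdet : ∀ᵐ w ∂(gaussianPi (Fin (m + 1) × Fin n) (n : ℝ≥0)⁻¹), gramDet (rowDiff (W2of w)) ≠ 0)
    (hgen : ∀ᵐ w ∂(gaussianPi (Fin (m + 1) × Fin n) (n : ℝ≥0)⁻¹),
      SpectrallyGeneric m (limData ε w).1 (limData ε w).2.1 (limData ε w).2.2) :
    Tendsto (fun d : ℕ => weightMeasure (m + 1) d n
      {w | OverlapGood (m := m) ε (outputHessian (m + 1) d n w)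
        (LinearMap.range (Matrix.mulVecLin (rowDiff (W2of w.2))ᵀ))}) atTop
      (nhds (gaussianPi (Fin (m + 1) × Fin n) (n : ℝ≥0)⁻¹ {w | limData ε w ∉ topLE m n})) := by
  have hTm := (measurableSet_limData_mem (m := m) ε (isClosed_topLE m n)).compl
  have hlower : ∀ d w, outData ε d w ∉ topLE m n → OverlapGood (m := m) ε
      (outputHessian (m + 1) d n w) (LinearMap.range (Matrix.mulVecLin (rowDiff (W2of w.2))ᵀ)) :=
    fun d w h => overlapGood_of_notMem hm hmn (outputHessian_transpose w) h
  have hupper : ∀ d w, gramDet (rowDiff (W2of w.2)) ≠ 0 → OverlapGood (m := m) ε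
      (outputHessian (m + 1) d n w) (LinearMap.range (Matrix.mulVecLin (rowDiff (W2of w.2))ᵀ)) →
      outData ε d w ∈ topGE m n :=
    fun d w hd h => OverlapGood.mem_topGE hm hmn (outputHessian_transpose w) hd h
  have hdet' : ∀ d : ℕ, ∀ᵐ w ∂(weightMeasure (m + 1) d n), gramDet (rowDiff (W2of w.2)) ≠ 0 :=
    fun d => Measure.quasiMeasurePreserving_snd.ae hdet
  have hexcl : ∀ᵐ w ∂(gaussianPi (Fin (m + 1) × Fin n) (n : ℝ≥0)⁻¹),
      limData ε w ∈ topLE m n → limData ε w ∉ topGE m n := by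
    filter_upwards [hgen] with w hw h
    exact hw.notMem_inter (gaussHess_transpose _ _) h
  have hlow : Tendsto (fun d : ℕ => weightMeasure (m + 1) d n {w | outData ε d w ∉ topLE m n}) atTop
      (nhds (gaussianPi (Fin (m + 1) × Fin n) (n : ℝ≥0)⁻¹ {w | limData ε w ∉ topLE m n})) := by
    refine tendsto_prod_measure (fun d : ℕ => gaussianPi (Fin n × Fin d) (d : ℝ≥0)⁻¹) _
      (fun d => (measurableSet_outData_mem ε d (isClosed_topLE m n)).compl) hTm
      (ae_of_all _ fun w hw => tendsto_outData_notMem ε (isClosed_topLE m n) w hw) ?_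
    filter_upwards [hexcl, hdet] with w hw hd hwT
    refine tendsto_of_tendsto_of_tendsto_of_le_of_le tendsto_const_nhds
      (tendsto_outData_mem ε (isClosed_topGE m n) w (hw (not_not.mp hwT))) (fun _ => zero_le)
      fun d => measure_mono fun w1 hw1 => hupper d (w1, w) hd (hlower d (w1, w) hw1)
  have hup : Tendsto (fun d : ℕ => weightMeasure (m + 1) d n {w | outData ε d w ∈ topGE m n}) atTop
      (nhds (gaussianPi (Fin (m + 1) × Fin n) (n : ℝ≥0)⁻¹ {w | limData ε w ∉ topLE m n})) := by
    refine tendsto_prod_measure (fun d : ℕ => gaussianPi (Fin n × Fin d) (d : ℝ≥0)⁻¹) _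
      (fun d => measurableSet_outData_mem ε d (isClosed_topGE m n)) hTm ?_ ?_
    · filter_upwards [hdet] with w hd hwT
      exact tendsto_of_tendsto_of_tendsto_of_le_of_le
        (tendsto_outData_notMem ε (isClosed_topLE m n) w hwT) tendsto_const_nhds
        (fun d => measure_mono fun w1 hw1 => hupper d (w1, w) hd (hlower d (w1, w) hw1))
        (fun _ => prob_le_one)
    · filter_upwards [hexcl] with w hw hwT
      exact tendsto_outData_mem ε (isClosed_topGE m n) w (hw (not_not.mp hwT))
  refine tendsto_of_tendsto_of_tendsto_of_le_of_le hlow hup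
    (fun d => measure_mono fun w hw => hlower d w hw) fun d => measure_mono_ae ?_
  filter_upwards [hdet' d] with w hd hw
  exact hupper d w hd hw

theorem dot_self_nonneg {n : ℕ} (y : Fin n → ℝ) : 0 ≤ y ⬝ᵥ y :=
  Finset.sum_nonneg fun _ _ => mul_self_nonneg _

theorem DotOrthonormal.sum_smul_dot_self {k n : ℕ} {u : Fin k → Fin n → ℝ}
    (hu : DotOrthonormal u) (c : Fin k → ℝ) :
    (∑ b, c b • u b) ⬝ᵥ (∑ b, c b • u b) = c ⬝ᵥ c := by
  rw [sum_dotProduct]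
  refine Finset.sum_congr rfl fun a _ => ?_
  rw [smul_dotProduct, smul_eq_mul, hu.dot_sum]

/-- The top eigenvalues dominate the Rayleigh quotients on any subspace of the same dimension. -/
theorem IsTopFamily.le_eigenvalue {k n : ℕ} {M : Matrix (Fin n) (Fin n) ℝ} (hM : Mᵀ = M)
    {v u : Fin k → Fin n → ℝ} (hv : IsTopFamily M v) (hu : DotOrthonormal u) {l : ℝ}
    (h : ∀ c : Fin k → ℝ, l * ((∑ b, c b • u b) ⬝ᵥ (∑ b, c b • u b)) ≤
      (∑ b, c b • u b) ⬝ᵥ M *ᵥ (∑ b, c b • u b)) (a : Fin k) : l ≤ v a ⬝ᵥ M *ᵥ v a := by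
  let T : (Fin k → ℝ) →ₗ[ℝ] (Fin k → ℝ) :=
    { toFun := fun c b => if b = a then 0 else v b ⬝ᵥ ∑ b', c b' • u b'
      map_add' := fun c c' => by
        ext b
        by_cases hb : b = a <;>
          simp [hb, add_smul, Finset.sum_add_distrib, dotProduct_add]
      map_smul' := fun r c => by
        ext b
        by_cases hb : b = a <;> simp [hb, mul_smul, ← Finset.smul_sum, dotProduct_smul] }
  have hT : ¬ Function.Injective T := by
    intro hinj
    obtain ⟨c, hc⟩ := (LinearMap.injective_iff_surjective.mp hinj) (Pi.single a 1)
    have := congrFun hc a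
    simp [T] at this
  obtain ⟨c, hc0, hc⟩ : ∃ c, c ≠ 0 ∧ T c = 0 := by
    by_contra hcon
    push Not at hcon
    refine hT ((injective_iff_map_eq_zero T).mpr fun c hc => ?_)
    by_contra h0
    exact hcon c h0 hc
  set y := ∑ b, c b • u b with hy
  have hyy : 0 < y ⬝ᵥ y := by
    rw [hy, hu.sum_smul_dot_self]
    exact lt_of_le_of_ne (dot_self_nonneg c) fun h0 => hc0 (dotProduct_self_eq_zero.mp h0.symm)
  have horth : ∀ b, b ≠ a → v b ⬝ᵥ y = 0 := fun b hb => by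
    have := congrFun hc b
    simpa [T, hb] using this
  have hres : orthResidual v y = y - (v a ⬝ᵥ y) • v a := by
    rw [orthResidual, Finset.sum_eq_single a (fun b _ hb => by rw [horth b hb, zero_smul])
      (fun hb => absurd (Finset.mem_univ a) hb)]
  have htop := hv.2 y a
  set lam := v a ⬝ᵥ M *ᵥ v a with hlam
  have hva : v a ⬝ᵥ v a = 1 := by rw [hv.1.1, if_pos rfl]
  have h1 : v a ⬝ᵥ M *ᵥ y = lam * (v a ⬝ᵥ y) := by
    rw [dotProduct_mulVec_symm hM, hv.1.2 a, dotProduct_smul, smul_eq_mul, dotProduct_comm y]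
  have h2 : y ⬝ᵥ M *ᵥ v a = lam * (v a ⬝ᵥ y) := by
    rw [dotProduct_mulVec_symm hM, h1]
  rw [hres] at htop
  simp only [mulVec_sub, mulVec_smul, sub_dotProduct, dotProduct_sub, smul_dotProduct,
    dotProduct_smul, smul_eq_mul, h1, h2, hva, dotProduct_comm y (v a)] at htop
  rw [← hlam] at htop
  have h3 := h c
  rw [← hy] at h3
  have h4 : l * (y ⬝ᵥ y) ≤ lam * (y ⬝ᵥ y) := by nlinarith
  exact le_of_mul_le_mul_right h4 hyy

/-- A family of top eigenvectors is close to a subspace on which the quadratic form is large and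
on whose orthogonal complement it is small. -/
theorem IsTopFamily.overlap_ge {k n : ℕ} {M : Matrix (Fin n) (Fin n) ℝ} (hM : Mᵀ = M)
    (hpos : ∀ y, 0 ≤ y ⬝ᵥ M *ᵥ y) {v u : Fin k → Fin n → ℝ} (hv : IsTopFamily M v)
    (hu : DotOrthonormal u) {l t : ℝ} (hl : 0 < l) (ht : 0 ≤ t)
    (h : ∀ c : Fin k → ℝ, l * ((∑ b, c b • u b) ⬝ᵥ (∑ b, c b • u b)) ≤
      (∑ b, c b • u b) ⬝ᵥ M *ᵥ (∑ b, c b • u b))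
    (h' : ∀ y, (∀ b, u b ⬝ᵥ y = 0) → y ⬝ᵥ M *ᵥ y ≤ t * (y ⬝ᵥ y)) (a : Fin k) :
    1 - t / l ≤ ∑ b, (v a ⬝ᵥ u b) ^ 2 := by
  set w := orthResidual u (v a) with hw
  have hlam := hv.le_eigenvalue hM hu h a
  have huw : ∀ b, u b ⬝ᵥ w = 0 := fun b => dot_orthResidual hu (v a) b
  have hva : v a ⬝ᵥ v a = 1 := by rw [hv.1.1, if_pos rfl]
  have hvw : v a ⬝ᵥ w = 1 - ∑ b, (v a ⬝ᵥ u b) ^ 2 := by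
    rw [hw, orthResidual, dotProduct_sub, hva, dotProduct_sum]
    congr 1
    refine Finset.sum_congr rfl fun b _ => ?_
    rw [dotProduct_smul, smul_eq_mul, dotProduct_comm (u b), sq]
  have hww : w ⬝ᵥ w = v a ⬝ᵥ w := by
    have h0 : w ⬝ᵥ w = (v a - ∑ b, (u b ⬝ᵥ v a) • u b) ⬝ᵥ w := rfl
    rw [h0, sub_dotProduct, sum_dotProduct]
    simp [smul_dotProduct, huw]
  set lam := v a ⬝ᵥ M *ᵥ v a with hlam'
  have h1 : v a ⬝ᵥ M *ᵥ w = lam * (v a ⬝ᵥ w) := by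
    rw [dotProduct_mulVec_symm hM, hv.1.2 a, dotProduct_smul, smul_eq_mul, dotProduct_comm w]
  have h2 : w ⬝ᵥ M *ᵥ v a = lam * (v a ⬝ᵥ w) := by
    rw [dotProduct_mulVec_symm hM, h1]
  have h3 := hpos (w - (v a ⬝ᵥ w) • v a)
  simp only [mulVec_sub, mulVec_smul, sub_dotProduct, dotProduct_sub, smul_dotProduct,
    dotProduct_smul, smul_eq_mul, h1, h2] at h3
  rw [← hlam'] at h3
  have h4 := h' w huw
  rw [hww] at h4
  set s := v a ⬝ᵥ w with hs
  have hs0 : 0 ≤ s := by rw [← hww]; exact dot_self_nonneg w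
  have h5 : s * (lam * s) ≤ s * t := by nlinarith
  have h6 : s ≤ t / l := by
    rw [le_div_iff₀ hl]
    rcases hs0.eq_or_lt with h0 | h0
    · rw [← h0, zero_mul]
      exact ht
    · have := le_of_mul_le_mul_left h5 h0
      nlinarith
  linarith

/-- The variance of a vector under the softmax distribution. -/
noncomputable def softVar {c : ℕ} (z x : Fin c → ℝ) : ℝ := x ⬝ᵥ Amat z *ᵥ x

theorem softVar_eq {c : ℕ} (z x : Fin c → ℝ) :
    softVar z x = ∑ i, softmaxFn z i * x i ^ 2 - (∑ i, softmaxFn z i * x i) ^ 2 := by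
  have h1 : x ⬝ᵥ diagonal (softmaxFn z) *ᵥ x = ∑ i, softmaxFn z i * x i ^ 2 := by
    simp only [dotProduct, mulVec_diagonal]
    exact Finset.sum_congr rfl fun i _ => by ring
  have h2 : x ⬝ᵥ vecMulVec (softmaxFn z) (softmaxFn z) *ᵥ x = (∑ i, softmaxFn z i * x i) ^ 2 := by
    rw [vecMulVec_mulVec, op_smul_eq_smul, dotProduct_smul, smul_eq_mul, dotProduct_comm x, sq]
    rfl
  rw [softVar, Amat, sub_mulVec, dotProduct_sub, h1, h2]

theorem sum_softmaxFn_mul_sub_sq {c : ℕ} (hc : 0 < c) (z x : Fin c → ℝ) (s : ℝ) :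
    ∑ i, softmaxFn z i * (x i - s) ^ 2 =
      softVar z x + (∑ i, softmaxFn z i * x i - s) ^ 2 := by
  have h : ∑ i, softmaxFn z i * (x i - s) ^ 2 = ∑ i, softmaxFn z i * x i ^ 2 -
      2 * s * ∑ i, softmaxFn z i * x i + s ^ 2 * ∑ i, softmaxFn z i := by
    rw [Finset.mul_sum, Finset.mul_sum, ← Finset.sum_sub_distrib, ← Finset.sum_add_distrib]
    exact Finset.sum_congr rfl fun i _ => by ring
  rw [h, softVar_eq, sum_softmaxFn hc]
  ring

theorem softVar_eq_sum {c : ℕ} (hc : 0 < c) (z x : Fin c → ℝ) :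
    softVar z x = ∑ i, softmaxFn z i * (x i - ∑ j, softmaxFn z j * x j) ^ 2 := by
  rw [sum_softmaxFn_mul_sub_sq hc]
  ring

theorem softVar_nonneg {c : ℕ} (hc : 0 < c) (z x : Fin c → ℝ) : 0 ≤ softVar z x := by
  rw [softVar_eq_sum hc]
  exact Finset.sum_nonneg fun i _ => mul_nonneg (softmaxFn_pos z i).le (sq_nonneg _)

theorem softVar_le {c : ℕ} (z x : Fin c → ℝ) : softVar z x ≤ x ⬝ᵥ x := by
  rw [softVar_eq]
  have : ∑ i, softmaxFn z i * x i ^ 2 ≤ x ⬝ᵥ x := Finset.sum_le_sum fun i _ => by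
    rw [← sq]
    exact mul_le_of_le_one_left (sq_nonneg _) (softmaxFn_le_one z i)
  nlinarith [sq_nonneg (∑ i, softmaxFn z i * x i)]

theorem softVar_add_const {c : ℕ} (hc : 0 < c) (z x : Fin c → ℝ) (s : ℝ) :
    softVar z (fun i => x i + s) = softVar z x := by
  rw [softVar_eq_sum hc, softVar_eq_sum hc z x]
  refine Finset.sum_congr rfl fun i _ => ?_
  have : ∑ j, softmaxFn z j * (x j + s) = ∑ j, softmaxFn z j * x j + s := by
    simp only [mul_add, Finset.sum_add_distrib]
    rw [← Finset.sum_mul, sum_softmaxFn hc, one_mul]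
  rw [this]
  ring

theorem softVar_sub_le {c : ℕ} (hc : 0 < c) (z x y : Fin c → ℝ) :
    softVar z (x - y) ≤ 2 * softVar z x + 2 * softVar z y := by
  rw [softVar_eq_sum hc, softVar_eq_sum hc z x, softVar_eq_sum hc z y, Finset.mul_sum,
    Finset.mul_sum, ← Finset.sum_add_distrib]
  refine Finset.sum_le_sum fun i _ => ?_
  have h1 : ∑ j, softmaxFn z j * (x - y) j =
      ∑ j, softmaxFn z j * x j - ∑ j, softmaxFn z j * y j := by
    simp [mul_sub]
  rw [h1, Pi.sub_apply]
  have := softmaxFn_pos z i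
  nlinarith [mul_nonneg this.le (sq_nonneg
    ((x i - ∑ j, softmaxFn z j * x j) + (y i - ∑ j, softmaxFn z j * y j)))]

theorem softVar_smul {c : ℕ} (z x : Fin c → ℝ) (r : ℝ) :
    softVar z (r • x) = r ^ 2 * softVar z x := by
  rw [softVar, mulVec_smul, smul_dotProduct, dotProduct_smul, softVar, smul_eq_mul, smul_eq_mul]
  ring

theorem softmaxFn_ge {c : ℕ} (z : Fin c → ℝ) (i : Fin c) :
    Real.exp (-1 - z ⬝ᵥ z) / c ≤ softmaxFn z i := by
  have hc : 0 < c := Fin.pos i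
  have hz : ∀ k, z k ^ 2 ≤ z ⬝ᵥ z := fun k => by
    rw [sq]
    exact Finset.single_le_sum (f := fun k => z k * z k) (fun _ _ => mul_self_nonneg _)
      (Finset.mem_univ k)
  have h1 : ∑ k, Real.exp (z k) ≤ c * Real.exp (z i + 1 + z ⬝ᵥ z) := by
    calc ∑ k, Real.exp (z k) ≤ ∑ _k : Fin c, Real.exp (z i + 1 + z ⬝ᵥ z) := by
          refine Finset.sum_le_sum fun k _ => Real.exp_le_exp.mpr ?_
          nlinarith [hz k, hz i, sq_nonneg (z k - 1), sq_nonneg (z i + 1)]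
      _ = _ := by simp
  have hpos : 0 < ∑ k, Real.exp (z k) :=
    Finset.sum_pos (fun _ _ => Real.exp_pos _) ⟨i, Finset.mem_univ _⟩
  rw [softmaxFn, div_le_div_iff₀ (by positivity) hpos]
  calc Real.exp (-1 - z ⬝ᵥ z) * ∑ k, Real.exp (z k)
      ≤ Real.exp (-1 - z ⬝ᵥ z) * (c * Real.exp (z i + 1 + z ⬝ᵥ z)) := by gcongr
    _ = Real.exp (z i) * c := by
        rw [mul_left_comm, ← Real.exp_add, mul_comm]
        congr 2
        ring

theorem tangent_le_exp (R t : ℝ) :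
    Real.exp (-1 - R) * (1 + R - t) ≤ Real.exp (-1 - t) := by
  have h := Real.add_one_le_exp (R - t)
  have : Real.exp (-1 - t) = Real.exp (-1 - R) * Real.exp (R - t) := by
    rw [← Real.exp_add]
    congr 1
    ring
  rw [this]
  gcongr
  linarith

/-- Softmax variance lower bound in terms of the pairing with a sum-zero vector. -/
theorem softVar_ge {c : ℕ} (hc : 0 < c) (z x y : Fin c → ℝ) (hy : ∑ i, y i = 0) :
    Real.exp (-1 - z ⬝ᵥ z) / c * (x ⬝ᵥ y) ^ 2 ≤ softVar z x * (y ⬝ᵥ y) := by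
  set s := ∑ j, softmaxFn z j * x j with hs
  have h1 : x ⬝ᵥ y = ∑ i, (x i - s) * y i := by
    simp only [sub_mul, Finset.sum_sub_distrib]
    rw [← Finset.mul_sum, hy, mul_zero, sub_zero]
    rfl
  have h2 : (x ⬝ᵥ y) ^ 2 ≤ (∑ i, (x i - s) ^ 2) * (y ⬝ᵥ y) := by
    rw [h1]
    refine (Finset.sum_mul_sq_le_sq_mul_sq _ _ _).trans (le_of_eq ?_)
    simp [dotProduct, sq]
  have h3 : Real.exp (-1 - z ⬝ᵥ z) / c * ∑ i, (x i - s) ^ 2 ≤ softVar z x := by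
    rw [softVar_eq_sum hc, Finset.mul_sum]
    refine Finset.sum_le_sum fun i _ => ?_
    exact mul_le_mul_of_nonneg_right (softmaxFn_ge z i) (sq_nonneg _)
  calc _ ≤ Real.exp (-1 - z ⬝ᵥ z) / c * ((∑ i, (x i - s) ^ 2) * (y ⬝ᵥ y)) := by gcongr
    _ = Real.exp (-1 - z ⬝ᵥ z) / c * (∑ i, (x i - s) ^ 2) * (y ⬝ᵥ y) := by ring
    _ ≤ _ := mul_le_mul_of_nonneg_right h3 (dot_self_nonneg y)

theorem integral_act_gaussianReal : ∫ t, act t ∂(gaussianReal 0 1) = 1 / 2 := by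
  have hInt : Integrable act (gaussianReal 0 1) :=
    Integrable.of_bound measurable_act.aestronglyMeasurable 1 (ae_of_all _ fun t => by
      rw [Real.norm_of_nonneg (act_nonneg t)]
      exact act_le_one t)
  have hneg : MeasurePreserving (fun t : ℝ => -t) (gaussianReal 0 1) (gaussianReal 0 1) :=
    ⟨measurable_neg, by rw [gaussianReal_map_neg, neg_zero]⟩
  have h1 : ∫ t, act (-t) ∂(gaussianReal 0 1) = ∫ t, act t ∂(gaussianReal 0 1) := by
    conv_rhs => rw [← hneg.map_eq]
    rw [integral_map measurable_neg.aemeasurable measurable_act.aestronglyMeasurable]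
  have hInt' : Integrable (fun t => act (-t)) (gaussianReal 0 1) :=
    hneg.integrable_comp_of_integrable hInt
  have h2 : ∫ t, (act t + act (-t)) ∂(gaussianReal 0 1) = ∫ _t, (1 : ℝ) ∂(gaussianReal 0 1) := by
    have := nullSingletonClass_gaussianReal (μ := 0) (v := 1) one_ne_zero
    refine integral_congr_ae ?_
    have h0 : ∀ᵐ t ∂(gaussianReal 0 1), t ≠ 0 := by
      rw [ae_iff]
      simp only [not_not]
      exact measure_singleton 0
    filter_upwards [h0] with t ht
    unfold act
    rcases lt_or_gt_of_ne ht with h | h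
    · rw [if_neg (not_le.mpr h), if_pos (by linarith), zero_add]
    · rw [if_pos h.le, if_neg (by linarith), add_zero]
  rw [integral_add hInt hInt', h1] at h2
  simp at h2
  linarith

/-- The centred activation pattern. -/
noncomputable def cact (t : ℝ) : ℝ := act t - 1 / 2

theorem measurable_cact : Measurable cact := measurable_act.sub measurable_const

theorem cact_mul_self (t : ℝ) : cact t * cact t = 1 / 4 := by
  unfold cact act
  split_ifs <;> norm_num

theorem abs_cact (t : ℝ) : |cact t| = 1 / 2 := by
  unfold cact act
  split_ifs <;> norm_num

theorem integrable_act_gaussianReal : Integrable act (gaussianReal 0 1) :=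
  Integrable.of_bound measurable_act.aestronglyMeasurable 1 (ae_of_all _ fun t => by
    rw [Real.norm_of_nonneg (act_nonneg t)]
    exact act_le_one t)

theorem integral_cact {n : ℕ} (i : Fin n) : ∫ g, cact (g i) ∂(inputMeasure n) = 0 := by
  have h3 : ∫ g, cact (g i) ∂(inputMeasure n) = ∫ t, cact t ∂(gaussianReal 0 1) := by
    rw [← (measurePreserving_gaussianPi (ι := Fin n) 1 i).map_eq,
      integral_map (measurable_pi_apply i).aemeasurable measurable_cact.aestronglyMeasurable]
    rfl
  rw [h3]
  unfold cact
  rw [integral_sub integrable_act_gaussianReal (integrable_const _), integral_act_gaussianReal]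
  simp

theorem integral_cact_mul_cact {n : ℕ} (i j : Fin n) :
    ∫ g, cact (g i) * cact (g j) ∂(inputMeasure n) = if i = j then 1 / 4 else 0 := by
  split_ifs with h
  · subst h
    simp only [cact_mul_self]
    simp
  · have hind : iIndepFun (fun (i : Fin n) (g : Fin n → ℝ) => cact (g i)) (inputMeasure n) :=
      iIndepFun_pi (X := fun _ t => cact t) fun _ => measurable_cact.aemeasurable
    have h1 := (hind.indepFun h).integral_fun_mul_eq_mul_integral
      (measurable_cact.comp (measurable_pi_apply i)).aestronglyMeasurable
      (measurable_cact.comp (measurable_pi_apply j)).aestronglyMeasurable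
    rw [h1, integral_cact, zero_mul]

/-- The logits as a function of the pre-activations. -/
def reluLogits {c n : ℕ} (W : Matrix (Fin c) (Fin n) ℝ) (g : Fin n → ℝ) : Fin c → ℝ :=
  W *ᵥ fun i => max (g i) 0

theorem dotProduct_reluHess {c n : ℕ} (W : Matrix (Fin c) (Fin n) ℝ) (g y : Fin n → ℝ) :
    y ⬝ᵥ reluHess W g *ᵥ y = softVar (reluLogits W g) (W *ᵥ fun i => act (g i) * y i) := by
  have h1 : Dmat g *ᵥ y = fun i => act (g i) * y i := by
    ext i
    simp [Dmat, mulVec_diagonal, act]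
  have h2 : (Dmat g)ᵀ = Dmat g := diagonal_transpose _
  rw [reluHess, softVar, reluLogits, ← h1]
  simp only [← mulVec_mulVec]
  rw [dotProduct_mulVec y (Dmat g), ← mulVec_transpose, h2, dotProduct_mulVec _ Wᵀ,
    ← mulVec_transpose, transpose_transpose]

theorem integrable_dotProduct_reluHess {c n : ℕ} (W : Matrix (Fin c) (Fin n) ℝ) (y : Fin n → ℝ) :
    Integrable (fun g => y ⬝ᵥ reluHess W g *ᵥ y) (inputMeasure n) := by
  simp only [dotProduct, mulVec]
  exact integrable_finsetSum _ fun i _ => (integrable_finsetSum _ fun j _ =>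
    (integrable_reluHess W i j _).mul_const _).const_mul _

theorem dotProduct_limHess {c n : ℕ} (W : Matrix (Fin c) (Fin n) ℝ) (y : Fin n → ℝ) :
    y ⬝ᵥ limHess W *ᵥ y = ∫ g, y ⬝ᵥ reluHess W g *ᵥ y ∂(inputMeasure n) := by
  simp only [dotProduct, mulVec, limHess, gaussHess, of_apply, one_mulVec]
  rw [integral_finsetSum _ fun i _ => (integrable_finsetSum _ fun j _ =>
    (integrable_reluHess W i j _).mul_const _).const_mul _]
  refine Finset.sum_congr rfl fun i _ => ?_
  rw [integral_const_mul, integral_finsetSum _ fun j _ =>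
    (integrable_reluHess W i j _).mul_const _]
  simp only [integral_mul_const]

theorem dotProduct_limHess_nonneg {c n : ℕ} (hc : 0 < c) (W : Matrix (Fin c) (Fin n) ℝ)
    (y : Fin n → ℝ) : 0 ≤ y ⬝ᵥ limHess W *ᵥ y := by
  rw [dotProduct_limHess]
  refine integral_nonneg fun g => ?_
  simp only [Pi.zero_apply]
  rw [dotProduct_reluHess]
  exact softVar_nonneg hc _ _

/-- The fluctuation of the masked image of `y`. -/
noncomputable def maskNoise {c n : ℕ} (W : Matrix (Fin c) (Fin n) ℝ) (y g : Fin n → ℝ) :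
    Fin c → ℝ := W *ᵥ fun i => cact (g i) * y i

theorem mask_eq {c n : ℕ} (W : Matrix (Fin c) (Fin n) ℝ) (y g : Fin n → ℝ) :
    (W *ᵥ fun i => act (g i) * y i) = maskNoise W y g + (1 / 2 : ℝ) • (W *ᵥ y) := by
  rw [maskNoise, ← mulVec_smul, ← mulVec_add]
  congr 1
  ext i
  simp only [cact, Pi.add_apply, Pi.smul_apply, smul_eq_mul]
  ring

theorem maskNoise_dot_self {c n : ℕ} (W : Matrix (Fin c) (Fin n) ℝ) (y g : Fin n → ℝ) :
    maskNoise W y g ⬝ᵥ maskNoise W y g = ∑ a, ∑ i, ∑ j,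
      (W a i * y i * (W a j * y j)) * (cact (g i) * cact (g j)) := by
  simp only [maskNoise, dotProduct, mulVec, Finset.sum_mul_sum]
  refine Finset.sum_congr rfl fun a _ => Finset.sum_congr rfl fun i _ =>
    Finset.sum_congr rfl fun j _ => by ring

theorem integrable_cact_mul_cact {n : ℕ} (i j : Fin n) :
    Integrable (fun g => cact (g i) * cact (g j)) (inputMeasure n) :=
  Integrable.of_bound ((measurable_cact.comp (measurable_pi_apply i)).mul
    (measurable_cact.comp (measurable_pi_apply j))).aestronglyMeasurable (1 / 2 * (1 / 2))
    (ae_of_all _ fun g => by rw [Real.norm_eq_abs, abs_mul, abs_cact, abs_cact])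

theorem integrable_maskNoise {c n : ℕ} (W : Matrix (Fin c) (Fin n) ℝ) (y : Fin n → ℝ) :
    Integrable (fun g => maskNoise W y g ⬝ᵥ maskNoise W y g) (inputMeasure n) := by
  simp only [maskNoise_dot_self]
  exact integrable_finsetSum _ fun a _ => integrable_finsetSum _ fun i _ =>
    integrable_finsetSum _ fun j _ => (integrable_cact_mul_cact i j).const_mul _

theorem integral_maskNoise_le {c n : ℕ} (W : Matrix (Fin c) (Fin n) ℝ) {ρ : ℝ}
    (hρ : ∀ i, ∑ a, W a i ^ 2 ≤ ρ) (y : Fin n → ℝ) :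
    ∫ g, maskNoise W y g ⬝ᵥ maskNoise W y g ∂(inputMeasure n) ≤ ρ / 4 * (y ⬝ᵥ y) := by
  simp only [maskNoise_dot_self]
  rw [integral_finsetSum _ fun a _ => integrable_finsetSum _ fun i _ =>
    integrable_finsetSum _ fun j _ => (integrable_cact_mul_cact i j).const_mul _]
  have h1 : ∀ a, ∫ g, ∑ i, ∑ j, (W a i * y i * (W a j * y j)) * (cact (g i) * cact (g j))
      ∂(inputMeasure n) = ∑ i, W a i ^ 2 * (y i * y i / 4) := by
    intro a
    rw [integral_finsetSum _ fun i _ =>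
      integrable_finsetSum _ fun j _ => (integrable_cact_mul_cact i j).const_mul _]
    refine Finset.sum_congr rfl fun i _ => ?_
    rw [integral_finsetSum _ fun j _ => (integrable_cact_mul_cact i j).const_mul _]
    simp only [integral_const_mul, integral_cact_mul_cact]
    simp
    ring
  simp only [h1]
  rw [Finset.sum_comm, dotProduct, Finset.mul_sum]
  refine Finset.sum_le_sum fun i _ => ?_
  rw [← Finset.sum_mul]
  calc _ ≤ ρ * (y i * y i / 4) :=
        mul_le_mul_of_nonneg_right (hρ i) (div_nonneg (mul_self_nonneg _) (by norm_num))
    _ = _ := by ring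

theorem mulVec_eq_const_of_rowDiff {m n : ℕ} {W : Matrix (Fin (m + 1)) (Fin n) ℝ} {y : Fin n → ℝ}
    (hy : rowDiff W *ᵥ y = 0) (i : Fin (m + 1)) : (W *ᵥ y) i = (W *ᵥ y) (Fin.last m) := by
  refine Fin.lastCases rfl (fun a => ?_) i
  have := congrFun hy a
  have h2 : (rowDiff W *ᵥ y) a = (W *ᵥ y) a.castSucc - (W *ᵥ y) (Fin.last m) := by
    simp [rowDiff, mulVec, dotProduct, sub_mul]
  rw [h2] at this
  simpa [sub_eq_zero] using this

/-- Upper bound for the quadratic form of the limiting Hessian orthogonally to the row space. -/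
theorem limHess_le_of_rowDiff {m n : ℕ} {W : Matrix (Fin (m + 1)) (Fin n) ℝ} {ρ : ℝ}
    (hρ : ∀ i, ∑ a, W a i ^ 2 ≤ ρ) {y : Fin n → ℝ} (hy : rowDiff W *ᵥ y = 0) :
    y ⬝ᵥ limHess W *ᵥ y ≤ ρ / 4 * (y ⬝ᵥ y) := by
  rw [dotProduct_limHess]
  refine (integral_mono (integrable_dotProduct_reluHess W y) (integrable_maskNoise W y)
    fun g => ?_).trans (integral_maskNoise_le W hρ y)
  simp only
  rw [dotProduct_reluHess, mask_eq]
  have : maskNoise W y g + (1 / 2 : ℝ) • (W *ᵥ y) =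
      fun i => maskNoise W y g i + 1 / 2 * (W *ᵥ y) (Fin.last m) := by
    ext i
    rw [Pi.add_apply, Pi.smul_apply, mulVec_eq_const_of_rowDiff hy i, smul_eq_mul]
  rw [this, softVar_add_const m.succ_pos]
  exact softVar_le _ _

/-- The mean square of the logits. -/
noncomputable def logitEnergy {c n : ℕ} (W : Matrix (Fin c) (Fin n) ℝ) : ℝ :=
  ∫ g, reluLogits W g ⬝ᵥ reluLogits W g ∂(inputMeasure n)

theorem reluLogits_dot_self {c n : ℕ} (W : Matrix (Fin c) (Fin n) ℝ) (g : Fin n → ℝ) :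
    reluLogits W g ⬝ᵥ reluLogits W g =
      ∑ a, ∑ i, ∑ j, (W a i * W a j) * (max (g i) 0 * max (g j) 0) := by
  simp only [reluLogits, dotProduct, mulVec, Finset.sum_mul_sum]
  refine Finset.sum_congr rfl fun a _ => Finset.sum_congr rfl fun i _ =>
    Finset.sum_congr rfl fun j _ => by ring

theorem integrable_relu_mul_relu {n : ℕ} (i j : Fin n) :
    Integrable (fun g => max (g i) 0 * max (g j) 0) (inputMeasure n) := by
  have h1 : Integrable (fun g : Fin n → ℝ => g i ^ 2 + g j ^ 2) (inputMeasure n) :=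
    (integrable_pow_gaussianPi 1 i 2).add (integrable_pow_gaussianPi 1 j 2)
  refine h1.mono' (by fun_prop) (ae_of_all _ fun g => ?_)
  have h2 : ∀ t : ℝ, max t 0 ^ 2 ≤ t ^ 2 := fun t => by
    rcases le_total t 0 with h | h
    · rw [max_eq_right h]; nlinarith
    · rw [max_eq_left h]
  rw [Real.norm_of_nonneg (mul_nonneg (le_max_right _ _) (le_max_right _ _))]
  nlinarith [h2 (g i), h2 (g j), sq_nonneg (max (g i) 0 - max (g j) 0)]

theorem integrable_reluLogits {c n : ℕ} (W : Matrix (Fin c) (Fin n) ℝ) :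
    Integrable (fun g => reluLogits W g ⬝ᵥ reluLogits W g) (inputMeasure n) := by
  simp only [reluLogits_dot_self]
  exact integrable_finsetSum _ fun a _ => integrable_finsetSum _ fun i _ =>
    integrable_finsetSum _ fun j _ => (integrable_relu_mul_relu i j).const_mul _

/-- Lower bound for the quadratic form of the limiting Hessian on the row space. -/
theorem le_limHess_of_sum_eq_zero {m n : ℕ} {W : Matrix (Fin (m + 1)) (Fin n) ℝ} {ρ R : ℝ}
    (hρ : ∀ i, ∑ a, W a i ^ 2 ≤ ρ) (hR : logitEnergy W ≤ R) {x : Fin (m + 1) → ℝ}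
    (hx : ∑ i, x i = 0) (hW : 1 / 2 * (x ⬝ᵥ x) ≤ (Wᵀ *ᵥ x) ⬝ᵥ (Wᵀ *ᵥ x)) :
    (Real.exp (-1 - R) / (m + 1 : ℕ) / 16 - ρ / 4) * ((Wᵀ *ᵥ x) ⬝ᵥ (Wᵀ *ᵥ x)) ≤
      (Wᵀ *ᵥ x) ⬝ᵥ limHess W *ᵥ (Wᵀ *ᵥ x) := by
  set y := Wᵀ *ᵥ x with hy
  have hyx : (W *ᵥ y) ⬝ᵥ x = y ⬝ᵥ y := by
    rw [dotProduct_comm, dotProduct_mulVec, ← mulVec_transpose]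
  have hyy := dot_self_nonneg y
  set κ := Real.exp (-1 - R) / (m + 1 : ℕ) with hκ
  have hκ0 : 0 ≤ κ := by positivity
  have hq : ∀ z, Real.exp (-1 - z ⬝ᵥ z) / (m + 1 : ℕ) * (1 / 2 * (y ⬝ᵥ y)) ≤
      softVar z (W *ᵥ y) := by
    intro z
    have h1 := softVar_ge m.succ_pos z (W *ᵥ y) x hx
    rw [hyx] at h1
    have h2 := softVar_nonneg m.succ_pos z (W *ᵥ y)
    set e := Real.exp (-1 - z ⬝ᵥ z) / (m + 1 : ℕ) with he
    have he0 : 0 ≤ e := by positivity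
    rcases hyy.eq_or_lt with h0 | h0
    · rw [← h0]
      simpa using h2
    · have h3 : softVar z (W *ᵥ y) * (x ⬝ᵥ x) ≤ softVar z (W *ᵥ y) * (2 * (y ⬝ᵥ y)) :=
        mul_le_mul_of_nonneg_left (by linarith) h2
      have h4 : (e * (1 / 2 * (y ⬝ᵥ y))) * (y ⬝ᵥ y) ≤ softVar z (W *ᵥ y) * (y ⬝ᵥ y) := by
        nlinarith
      exact le_of_mul_le_mul_right h4 h0
  have hpt : ∀ g, κ / 16 * (y ⬝ᵥ y) * (1 + R - reluLogits W g ⬝ᵥ reluLogits W g) -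
      maskNoise W y g ⬝ᵥ maskNoise W y g ≤ y ⬝ᵥ reluHess W g *ᵥ y := by
    intro g
    rw [dotProduct_reluHess]
    set z := reluLogits W g with hz
    have h1 : (1 / 2 : ℝ) • (W *ᵥ y) = (W *ᵥ fun i => act (g i) * y i) - maskNoise W y g := by
      rw [mask_eq, add_sub_cancel_left]
    have h2 := softVar_sub_le m.succ_pos z (W *ᵥ fun i => act (g i) * y i) (maskNoise W y g)
    rw [← h1, softVar_smul] at h2
    have h3 := softVar_le z (maskNoise W y g)
    have h4 := hq z
    have h5 : κ * (1 + R - z ⬝ᵥ z) ≤ Real.exp (-1 - z ⬝ᵥ z) / (m + 1 : ℕ) := by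
      rw [hκ, div_mul_eq_mul_div]
      gcongr
      exact tangent_le_exp R _
    have h6 := mul_le_mul_of_nonneg_right h5 hyy
    nlinarith
  rw [dotProduct_limHess]
  have hint1 : Integrable (fun g => κ / 16 * (y ⬝ᵥ y) *
      (1 + R - reluLogits W g ⬝ᵥ reluLogits W g)) (inputMeasure n) :=
    ((integrable_const _).sub (integrable_reluLogits W)).const_mul _
  have h := integral_mono (hint1.sub (integrable_maskNoise W y))
    (integrable_dotProduct_reluHess W y) hpt
  refine le_trans ?_ h
  simp only [Pi.sub_apply]
  rw [integral_sub hint1 (integrable_maskNoise W y), integral_const_mul,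
    integral_sub (integrable_const _) (integrable_reluLogits W)]
  have h1 := integral_maskNoise_le W hρ y
  have h2 : (∫ _g : Fin n → ℝ, (1 + R) ∂(inputMeasure n)) = 1 + R := by simp
  rw [h2]
  have h3 : κ / 16 * (y ⬝ᵥ y) ≤ κ / 16 * (y ⬝ᵥ y) *
      (1 + R - ∫ g, reluLogits W g ⬝ᵥ reluLogits W g ∂(inputMeasure n)) := by
    refine le_mul_of_one_le_right (by positivity) ?_
    have : (∫ g, reluLogits W g ⬝ᵥ reluLogits W g ∂(inputMeasure n)) ≤ R := hR
    linarith
  linarith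

theorem gramDet_ne_zero_of_le {m n : ℕ} {W : Matrix (Fin (m + 1)) (Fin n) ℝ}
    (hW : ∀ x : Fin (m + 1) → ℝ, ∑ i, x i = 0 →
      1 / 2 * (x ⬝ᵥ x) ≤ (Wᵀ *ᵥ x) ⬝ᵥ (Wᵀ *ᵥ x)) : gramDet (rowDiff W) ≠ 0 := by
  intro h0
  obtain ⟨x', hx0, hx'⟩ := Matrix.exists_mulVec_eq_zero_iff.mpr h0
  set x : Fin (m + 1) → ℝ := Fin.snoc (α := fun _ => ℝ) x' (-∑ a, x' a) with hx
  have hxc : (fun a : Fin m => x a.castSucc) = x' := by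
    ext a
    simp [hx]
  have hsum : ∑ i, x i = 0 := by
    rw [Fin.sum_univ_castSucc]
    simp [hx]
  have h1 := hW x hsum
  rw [transpose_mulVec_eq_rowDiff W hsum, hxc] at h1
  have h2 : ((rowDiff W)ᵀ *ᵥ x') ⬝ᵥ ((rowDiff W)ᵀ *ᵥ x') = 0 := by
    rw [dotProduct_mulVec, ← mulVec_transpose, transpose_transpose, mulVec_mulVec, hx',
      zero_dotProduct]
  rw [h2] at h1
  have h3 : x ⬝ᵥ x = 0 := le_antisymm (by linarith) (dot_self_nonneg x)
  have h4 : x = 0 := dotProduct_self_eq_zero.mp h3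
  refine hx0 ?_
  rw [← hxc, h4]
  rfl

theorem limData_notMem_topLE {m n : ℕ} (hm : 0 < m) {ε ρ R : ℝ} (w : Fin (m + 1) × Fin n → ℝ)
    (hρ0 : 0 ≤ ρ) (hρ : ∀ i, ∑ a, W2of w a i ^ 2 ≤ ρ) (hR : logitEnergy (W2of w) ≤ R)
    (hW : ∀ x : Fin (m + 1) → ℝ, ∑ i, x i = 0 →
      1 / 2 * (x ⬝ᵥ x) ≤ ((W2of w)ᵀ *ᵥ x) ⬝ᵥ ((W2of w)ᵀ *ᵥ x))
    (hl : 0 < Real.exp (-1 - R) / (m + 1 : ℕ) / 16 - ρ / 4)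
    (hε : ρ / 4 < ε * (Real.exp (-1 - R) / (m + 1 : ℕ) / 16 - ρ / 4)) :
    limData ε w ∉ topLE m n := by
  rintro ⟨v, hv, hle⟩
  have hdet := gramDet_ne_zero_of_le hW
  have hdet' : 0 < gramDet (rowDiff (W2of w)) := lt_of_le_of_ne (gramDet_nonneg _) hdet.symm
  obtain ⟨u, hu, hspan⟩ := exists_orthonormal_span _ hdet
  simp only [limData, specData] at hle hv
  rw [quadSum_gramProj _ hu hspan] at hle
  set l := Real.exp (-1 - R) / (m + 1 : ℕ) / 16 - ρ / 4 with hldef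
  have hge : ∀ a, 1 - ρ / 4 / l ≤ ∑ b, (v a ⬝ᵥ u b) ^ 2 := by
    refine hv.overlap_ge (gaussHess_transpose _ _)
      (dotProduct_limHess_nonneg m.succ_pos _) hu hl (by positivity) ?_ ?_
    · intro c
      have hmem : (∑ b, c b • u b) ∈ Submodule.span ℝ (Set.range u) :=
        Submodule.sum_mem _ fun b _ => Submodule.smul_mem _ _ (Submodule.subset_span ⟨b, rfl⟩)
      rw [hspan, ← map_ker_sumLin] at hmem
      obtain ⟨x, hx, hxe⟩ := hmem
      rw [mulVecLin_apply] at hxe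
      rw [← hxe]
      exact le_limHess_of_sum_eq_zero hρ hR hx (hW x hx)
    · intro y hy
      refine limHess_le_of_rowDiff hρ ?_
      have hall : ∀ s ∈ Submodule.span ℝ (Set.range u), s ⬝ᵥ y = 0 := by
        intro s hs
        induction hs using Submodule.span_induction with
        | mem s hs => obtain ⟨b, rfl⟩ := hs; exact hy b
        | zero => exact zero_dotProduct _
        | add s t _ _ h1 h2 => rw [add_dotProduct, h1, h2, add_zero]
        | smul r s _ h => rw [smul_dotProduct, h, smul_zero]
      have h1 := hall ((rowDiff (W2of w))ᵀ *ᵥ (rowDiff (W2of w) *ᵥ y))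
        (by rw [hspan]; exact ⟨_, rfl⟩)
      rw [dotProduct_comm, dotProduct_mulVec, ← mulVec_transpose, transpose_transpose] at h1
      exact dotProduct_self_eq_zero.mp h1
  have hsum : (m : ℝ) * (1 - ρ / 4 / l) ≤ ∑ a, ∑ b, (v a ⬝ᵥ u b) ^ 2 := by
    calc
      (m : ℝ) * (1 - ρ / 4 / l) = ∑ _a : Fin m, (1 - ρ / 4 / l) := by
        rw [Finset.sum_const, Finset.card_univ, Fintype.card_fin, nsmul_eq_mul]
      _ ≤ _ := Finset.sum_le_sum fun a _ => hge a
  have h1 : ρ / 4 / l < ε := by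
    rw [div_lt_iff₀ hl]
    exact hε
  have hm' : (0 : ℝ) < m := by exact_mod_cast hm
  have h2 : (m : ℝ) * (1 - ε) < m * (1 - ρ / 4 / l) := by
    apply mul_lt_mul_of_pos_left _ hm'
    linarith
  rw [mul_comm (m * (1 - ε) : ℝ)] at hle
  have := le_of_mul_le_mul_left hle hdet'
  linarith

theorem logitEnergy_eq {c n : ℕ} (W : Matrix (Fin c) (Fin n) ℝ) :
    logitEnergy W = ∑ a, ∑ i, ∑ j, (W a i * W a j) *
      ∫ g : Fin n → ℝ, max (g i) 0 * max (g j) 0 ∂(inputMeasure n) := by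
  unfold logitEnergy
  simp only [reluLogits_dot_self]
  have h := fun (a : Fin c) (i j : Fin n) =>
    (integrable_relu_mul_relu i j).const_mul (W a i * W a j)
  rw [integral_finsetSum _ fun a _ => integrable_finsetSum _ fun i _ =>
    integrable_finsetSum _ fun j _ => h a i j]
  refine Finset.sum_congr rfl fun a _ => ?_
  rw [integral_finsetSum _ fun i _ => integrable_finsetSum _ fun j _ => h a i j]
  refine Finset.sum_congr rfl fun i _ => ?_
  rw [integral_finsetSum _ fun j _ => h a i j]
  exact Finset.sum_congr rfl fun j _ => integral_const_mul _ _

theorem integral_relu_sq_le {n : ℕ} (i : Fin n) :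
    ∫ g : Fin n → ℝ, max (g i) 0 * max (g i) 0 ∂(inputMeasure n) ≤ 1 := by
  calc ∫ g : Fin n → ℝ, max (g i) 0 * max (g i) 0 ∂(inputMeasure n)
      ≤ ∫ g : Fin n → ℝ, g i * g i ∂(inputMeasure n) := by
        refine integral_mono (integrable_relu_mul_relu i i) (integrable_mul_gaussianPi 1 i i)
          fun g => ?_
        rcases le_total (g i) 0 with h | h
        · simp only [max_eq_right h, mul_zero]
          exact mul_self_nonneg _
        · simp only [max_eq_left h, le_refl]
    _ = 1 := by
        rw [inputMeasure, integral_mul_gaussianPi, if_pos rfl, NNReal.coe_one]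

theorem integrable_logitEnergy {c n : ℕ} (v : ℝ≥0) :
    Integrable (fun w : Fin c × Fin n → ℝ => logitEnergy (W2of w))
      (gaussianPi (Fin c × Fin n) v) := by
  simp only [logitEnergy_eq, W2of, of_apply]
  exact integrable_finsetSum _ fun a _ => integrable_finsetSum _ fun i _ =>
    integrable_finsetSum _ fun j _ => (integrable_mul_gaussianPi v (a, i) (a, j)).mul_const _

theorem integral_logitEnergy_le {c n : ℕ} (v : ℝ≥0) :
    ∫ w : Fin c × Fin n → ℝ, logitEnergy (W2of w) ∂(gaussianPi (Fin c × Fin n) v) ≤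
      c * (n * v) := by
  simp only [logitEnergy_eq, W2of, of_apply]
  have h := fun (a : Fin c) (i j : Fin n) =>
    (integrable_mul_gaussianPi v (a, i) (a, j)).mul_const
      (∫ g : Fin n → ℝ, max (g i) 0 * max (g j) 0 ∂(inputMeasure n))
  rw [integral_finsetSum _ fun a _ => integrable_finsetSum _ fun i _ =>
    integrable_finsetSum _ fun j _ => h a i j]
  calc _ ≤ ∑ _a : Fin c, (n * v : ℝ) := by
        refine Finset.sum_le_sum fun a _ => ?_
        rw [integral_finsetSum _ fun i _ => integrable_finsetSum _ fun j _ => h a i j]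
        calc _ ≤ ∑ _i : Fin n, (v : ℝ) := by
              refine Finset.sum_le_sum fun i _ => ?_
              rw [integral_finsetSum _ fun j _ => h a i j]
              simp only [integral_mul_const, integral_mul_gaussianPi, Prod.mk.injEq, true_and,
                ite_mul, zero_mul, Finset.sum_ite_eq, Finset.mem_univ, if_true]
              exact mul_le_of_le_one_right v.2 (integral_relu_sq_le i)
          _ = n * v := by
              rw [Finset.sum_const, Finset.card_univ, Fintype.card_fin, nsmul_eq_mul]
    _ = c * (n * v) := by
        rw [Finset.sum_const, Finset.card_univ, Fintype.card_fin, nsmul_eq_mul]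

theorem half_dotProduct_le_of_gram {c n : ℕ} (hc : 0 < c) {W : Matrix (Fin c) (Fin n) ℝ}
    (hW : ∀ a b, |∑ j, W a j * W b j - (1 : Matrix (Fin c) (Fin c) ℝ) a b| ≤ 1 / (2 * c))
    (x : Fin c → ℝ) : 1 / 2 * (x ⬝ᵥ x) ≤ (Wᵀ *ᵥ x) ⬝ᵥ (Wᵀ *ᵥ x) := by
  have hc' : (0 : ℝ) < c := by exact_mod_cast hc
  have h1 : (Wᵀ *ᵥ x) ⬝ᵥ (Wᵀ *ᵥ x) = ∑ a, ∑ b, x a * x b * ∑ j, W a j * W b j := by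
    rw [mulVec_transpose, ← dotProduct_mulVec]
    simp only [dotProduct, mulVec, vecMul, Finset.mul_sum]
    refine Finset.sum_congr rfl fun a _ => ?_
    rw [Finset.sum_comm]
    refine Finset.sum_congr rfl fun b _ => Finset.sum_congr rfl fun j _ => by ring
  have h2 : x ⬝ᵥ x = ∑ a, ∑ b, x a * x b * (1 : Matrix (Fin c) (Fin c) ℝ) a b := by
    simp [dotProduct, Matrix.one_apply]
  have h3 : ∑ a, ∑ b, ((x a ^ 2 + x b ^ 2) / 2 * (1 / (2 * c))) = 1 / 2 * (x ⬝ᵥ x) := by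
    simp only [dotProduct, add_div, add_mul, Finset.sum_add_distrib, Finset.sum_const,
      Finset.card_univ, Fintype.card_fin, nsmul_eq_mul, ← Finset.sum_div, ← Finset.sum_mul,
      ← Finset.mul_sum]
    simp only [← pow_two]
    field_simp
    ring
  have h4 : x ⬝ᵥ x - (Wᵀ *ᵥ x) ⬝ᵥ (Wᵀ *ᵥ x) ≤ 1 / 2 * (x ⬝ᵥ x) := by
    rw [← h3, h1, h2, ← Finset.sum_sub_distrib]
    refine Finset.sum_le_sum fun a _ => ?_
    rw [← Finset.sum_sub_distrib]
    refine Finset.sum_le_sum fun b _ => ?_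
    rw [← mul_sub, ← neg_sub, mul_neg]
    refine (neg_le_abs _).trans ?_
    rw [abs_mul]
    refine mul_le_mul ?_ (hW a b) (abs_nonneg _) (by positivity)
    rw [abs_le]
    constructor <;> nlinarith [sq_nonneg (x a - x b), sq_nonneg (x a + x b)]
  linarith

theorem gaussianPi_real_ge_sq_le {ι : Type*} [Fintype ι] (v : ℝ≥0) (i : ι) {s : ℝ} (hs : 0 < s) :
    (gaussianPi ι v).real {w | s ≤ w i ^ 2} ≤ v ^ 2 * fourthMoment / s ^ 2 := by
  have h := mul_meas_ge_le_integral_of_nonneg (μ := gaussianPi ι v) (f := fun w => w i ^ 4)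
    (ae_of_all _ fun w => by positivity) (integrable_pow_gaussianPi v i 4) (s ^ 2)
  rw [integral_comp_gaussianPi v i (fun t => t ^ 4) (by fun_prop),
    integral_pow_four_gaussianReal] at h
  rw [le_div_iff₀' (by positivity)]
  refine le_trans (mul_le_mul_of_nonneg_left (measureReal_mono fun w hw => ?_) (by positivity)) h
  have hw' : s ≤ w i ^ 2 := hw
  change s ^ 2 ≤ w i ^ 4
  nlinarith

theorem gaussianPi_real_limData_le {m n : ℕ} (hm : 0 < m) (hn : 0 < n) {ε ρ R : ℝ} (hρ0 : 0 < ρ)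
    (hR0 : 0 < R)
    (hl : 0 < Real.exp (-1 - R) / (m + 1 : ℕ) / 16 - ρ / 4)
    (hε : ρ / 4 < ε * (Real.exp (-1 - R) / (m + 1 : ℕ) / 16 - ρ / 4)) :
    (gaussianPi (Fin (m + 1) × Fin n) (n : ℝ≥0)⁻¹).real {w | limData ε w ∈ topLE m n} ≤
      (m + 1 : ℕ) / R + (m + 1 : ℕ) ^ 3 * fourthMoment / ρ ^ 2 / n +
      (gaussianPi (Fin (m + 1) × Fin n) (n : ℝ≥0)⁻¹).real
        {w | ∃ a b, 1 / (2 * (m + 1 : ℕ)) ≤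
          |∑ j, w (a, j) * w (b, j) - (1 : Matrix (Fin (m + 1)) (Fin (m + 1)) ℝ) a b|} := by
  set μ := gaussianPi (Fin (m + 1) × Fin n) (n : ℝ≥0)⁻¹ with hμ
  have hn' : (0 : ℝ) < n := by exact_mod_cast hn
  have hm' : (0 : ℝ) < (m + 1 : ℕ) := by positivity
  set B1 : Set (Fin (m + 1) × Fin n → ℝ) := {w | R ≤ logitEnergy (W2of w)} with hB1
  set B2 : Set (Fin (m + 1) × Fin n → ℝ) := ⋃ p, {w | ρ / (m + 1 : ℕ) ≤ w p ^ 2} with hB2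
  set B3 : Set (Fin (m + 1) × Fin n → ℝ) := {w | ∃ a b, 1 / (2 * (m + 1 : ℕ)) ≤
          |∑ j, w (a, j) * w (b, j) - (1 : Matrix (Fin (m + 1)) (Fin (m + 1)) ℝ) a b|} with hB3
  have hsub : {w | limData ε w ∈ topLE m n} ⊆ B1 ∪ B2 ∪ B3 := by
    intro w hw
    by_contra hcon
    simp only [Set.mem_union, not_or, hB1, hB2, hB3, Set.mem_iUnion, Set.mem_ofPred_eq,
      not_exists, not_le] at hcon
    obtain ⟨⟨h1, h2⟩, h3⟩ := hcon
    refine limData_notMem_topLE hm w hρ0.le (fun i => ?_) h1.le (fun x _ => ?_) hl hε hw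
    · calc ∑ a, W2of w a i ^ 2 ≤ ∑ _a : Fin (m + 1), ρ / (m + 1 : ℕ) :=
            Finset.sum_le_sum fun a _ => (h2 (a, i)).le
        _ = ρ := by
            rw [Finset.sum_const, Finset.card_univ, Fintype.card_fin, nsmul_eq_mul]
            field_simp
    · exact half_dotProduct_le_of_gram (Nat.succ_pos m) (fun a b => (h3 a b).le) x
  have e1 : μ.real B1 ≤ (m + 1 : ℕ) / R := by
    have h := mul_meas_ge_le_integral_of_nonneg (μ := μ)
      (f := fun w : Fin (m + 1) × Fin n → ℝ => logitEnergy (W2of w))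
      (ae_of_all _ fun w => integral_nonneg fun g => dot_self_nonneg _)
      (integrable_logitEnergy _) R
    rw [le_div_iff₀' hR0]
    refine h.trans ((integral_logitEnergy_le _).trans_eq ?_)
    rw [NNReal.coe_inv, NNReal.coe_natCast, mul_inv_cancel₀ hn'.ne', mul_one]
  have e2 : μ.real B2 ≤ (m + 1 : ℕ) ^ 3 * fourthMoment / ρ ^ 2 / n := by
    refine (measureReal_iUnion_fintype_le _).trans ?_
    refine (Finset.sum_le_sum fun p _ => gaussianPi_real_ge_sq_le _ p (by positivity)).trans_eq ?_
    rw [Finset.sum_const, Finset.card_univ, Fintype.card_prod, Fintype.card_fin, Fintype.card_fin,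
      nsmul_eq_mul, NNReal.coe_inv, NNReal.coe_natCast]
    push_cast
    field_simp
  calc μ.real {w | limData ε w ∈ topLE m n} ≤ μ.real (B1 ∪ B2 ∪ B3) := measureReal_mono hsub
    _ ≤ μ.real B1 + μ.real B2 + μ.real B3 :=
        (measureReal_union_le _ _).trans (by gcongr; exact measureReal_union_le _ _)
    _ ≤ _ := by gcongr

theorem exists_threshold (m : ℕ) {ε : ℝ} (hε : 0 < ε) (R : ℝ) : ∃ ρ : ℝ, 0 < ρ ∧
    0 < Real.exp (-1 - R) / (m + 1 : ℕ) / 16 - ρ / 4 ∧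
    ρ / 4 < ε * (Real.exp (-1 - R) / (m + 1 : ℕ) / 16 - ρ / 4) := by
  set q : ℝ := Real.exp (-1 - R) / (m + 1 : ℕ) / 16 with hq
  have hq0 : 0 < q := by positivity
  refine ⟨2 * q * (ε / (1 + ε)), by positivity, ?_, ?_⟩
  · have : ε / (1 + ε) < 1 := by rw [div_lt_one (by positivity)]; linarith
    nlinarith
  · have h : ε / (1 + ε) * (1 + ε) = ε := by field_simp
    have : 0 < ε / (1 + ε) := by positivity
    nlinarith [mul_pos hq0 this]

theorem tendsto_gaussianPi_limData {m : ℕ} (hm : 0 < m) {ε : ℝ} (hε : 0 < ε) :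
    Tendsto (fun n : ℕ => gaussianPi (Fin (m + 1) × Fin n) (n : ℝ≥0)⁻¹
      {w | limData ε w ∉ topLE m n}) atTop (nhds 1) := by
  have hreal : Tendsto (fun n : ℕ => (gaussianPi (Fin (m + 1) × Fin n) (n : ℝ≥0)⁻¹).real
      {w | limData ε w ∈ topLE m n}) atTop (nhds 0) := by
    rw [Metric.tendsto_nhds]
    intro η hη
    obtain ⟨ρ, hρ0, hl, hρ⟩ := exists_threshold m hε (3 * (m + 1 : ℕ) / η)
    have hR0 : 0 < 3 * ((m + 1 : ℕ) : ℝ) / η := by positivity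
    have h1 : Tendsto (fun n : ℕ => ((m + 1 : ℕ) : ℝ) ^ 3 * fourthMoment / ρ ^ 2 / n)
        atTop (nhds 0) := tendsto_const_div_atTop_nhds_zero_nat _
    have h2 : Tendsto (fun n : ℕ => (gaussianPi (Fin (m + 1) × Fin n) (n : ℝ≥0)⁻¹).real
        {w | ∃ a b, 1 / (2 * (m + 1 : ℕ)) ≤
          |∑ j, w (a, j) * w (b, j) - (1 : Matrix (Fin (m + 1)) (Fin (m + 1)) ℝ) a b|})
        atTop (nhds 0) :=
      (ENNReal.tendsto_toReal ENNReal.zero_ne_top).comp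
        (tendsto_gram_deviation (m + 1) (by positivity))
    have h3 := (h1.eventually_lt_const (u := η / 3) (by positivity)).and
      (h2.eventually_lt_const (u := η / 3) (by positivity))
    filter_upwards [h3, eventually_gt_atTop 0] with n hn hn0
    rw [dist_zero_right, Real.norm_of_nonneg measureReal_nonneg]
    have h4 := gaussianPi_real_limData_le hm hn0 hρ0 hR0 hl hρ
    have h5 : ((m + 1 : ℕ) : ℝ) / (3 * (m + 1 : ℕ) / η) = η / 3 := by field_simp
    linarith [hn.1, hn.2]
  have hcompl : Tendsto (fun n : ℕ => gaussianPi (Fin (m + 1) × Fin n) (n : ℝ≥0)⁻¹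
      {w | limData ε w ∈ topLE m n}) atTop (nhds 0) := by
    have h := ENNReal.tendsto_ofReal hreal
    rw [ENNReal.ofReal_zero] at h
    exact h.congr fun n => ofReal_measureReal
  have h := ENNReal.Tendsto.sub (tendsto_const_nhds (x := (1 : ℝ≥0∞))) hcompl
    (Or.inl ENNReal.one_ne_top)
  rw [tsub_zero] at h
  refine h.congr fun n => ?_
  exact (prob_compl_eq_one_sub (measurableSet_limData_mem ε (isClosed_topLE m n))).symm

section Density
variable {ι : Type*} [Fintype ι]

theorem integrable_prod_gaussianPDFReal (v : ℝ≥0) :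
    Integrable fun x : ι → ℝ => ∏ i, gaussianPDFReal 0 v (x i) :=
  Integrable.fintype_prod fun _ => integrable_gaussianPDFReal 0 v

theorem gaussianPi_eq_withDensity {v : ℝ≥0} (hv : v ≠ 0) :
    gaussianPi ι v =
      volume.withDensity fun x => ENNReal.ofReal (∏ i, gaussianPDFReal 0 v (x i)) := by
  refine Measure.pi_eq fun s hs => ?_
  have hpi : MeasurableSet (Set.univ.pi s) := MeasurableSet.univ_pi hs
  rw [withDensity_apply _ hpi, ← ofReal_integral_eq_lintegral_ofReal
    (integrable_prod_gaussianPDFReal v).integrableOn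
    (ae_of_all _ fun x => Finset.prod_nonneg fun i _ => gaussianPDFReal_nonneg _ _ _),
    ← integral_indicator hpi]
  have h : (Set.univ.pi s).indicator (fun x : ι → ℝ => ∏ i, gaussianPDFReal 0 v (x i)) =
      fun x => ∏ i, (s i).indicator (gaussianPDFReal 0 v) (x i) := by
    classical
    funext x
    by_cases hx : x ∈ Set.univ.pi s
    · rw [Set.indicator_of_mem hx]
      exact Finset.prod_congr rfl fun i _ => (Set.indicator_of_mem (hx i (Set.mem_univ i)) _).symm
    · rw [Set.indicator_of_notMem hx]
      obtain ⟨i, hi⟩ : ∃ i, x i ∉ s i := by simpa using hx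
      exact (Finset.prod_eq_zero (Finset.mem_univ i) (Set.indicator_of_notMem hi _)).symm
  rw [h, integral_fintype_prod_volume_eq_prod,
    ENNReal.ofReal_prod_of_nonneg fun i _ => integral_nonneg fun x =>
      Set.indicator_nonneg (fun _ _ => gaussianPDFReal_nonneg _ _ _) x]
  refine Finset.prod_congr rfl fun i _ => ?_
  rw [integral_indicator (hs i), gaussianReal_apply_eq_integral _ hv]

theorem gaussianPi_absolutelyContinuous {v : ℝ≥0} (hv : v ≠ 0) :
    gaussianPi ι v ≪ volume := by
  rw [gaussianPi_eq_withDensity hv]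
  exact withDensity_absolutelyContinuous _ _

/-- A measurable set meeting almost every ray in a null set is null. -/
theorem ae_notMem_of_rays {Z : Set (ι → ℝ)} (hZ : MeasurableSet Z)
    (h : ∀ᵐ θ : ι → ℝ, ∀ᵐ r ∂(volume.restrict (Set.Ioi (0 : ℝ))), r • θ ∉ Z) :
    ∀ᵐ w : ι → ℝ, w ∉ Z := by
  have hmeas : MeasurableSet {p : (ι → ℝ) × ℝ | p.2 • p.1 ∉ Z} :=
    (measurable_snd.smul measurable_fst) hZ.compl
  have h1 := (Measure.ae_ae_comm hmeas).mp h
  have : (ae (volume.restrict (Set.Ioi (0 : ℝ)))).NeBot := by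
    rw [ae_neBot]
    simp
  obtain ⟨r, hr, hr0⟩ := (h1.and (ae_restrict_mem measurableSet_Ioi)).exists
  have hr0' : r ≠ 0 := ne_of_gt hr0
  rw [ae_iff] at hr ⊢
  simp only [not_not, Set.ofPred_mem_eq] at hr ⊢
  have h2 := Measure.addHaar_preimage_smul (volume : Measure (ι → ℝ)) hr0' Z
  change volume ((fun θ : ι → ℝ => r • θ) ⁻¹' Z) = 0 at hr
  rw [hr] at h2
  rcases mul_eq_zero.mp h2.symm with h3 | h3
  · exfalso
    rw [ENNReal.ofReal_eq_zero] at h3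
    have : 0 < |(r ^ Module.finrank ℝ (ι → ℝ))⁻¹| := abs_pos.mpr (by positivity)
    linarith
  · exact h3

/-- An analytic function that does not vanish near some point of an interval vanishes on a
null subset only. -/
theorem ae_ne_zero_of_analyticOnNhd {f : ℝ → ℝ} {U : Set ℝ} (hU : MeasurableSet U)
    (hUc : IsPreconnected U) (hf : AnalyticOnNhd ℝ f U) {r : ℝ} (hr : r ∈ U) (hfr : f r ≠ 0) :
    ∀ᵐ t ∂(volume.restrict U), f t ≠ 0 := by
  have h := hf.preimage_zero_mem_codiscreteWithin hfr hr ⟨⟨r, hr⟩, hUc⟩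
  have h1 := ae_restrict_le_codiscreteWithin (μ := volume) hU h
  filter_upwards [h1] with t ht
  simpa using ht

/-- A function that is analytic along all lines through a point where it does not vanish is
almost everywhere nonzero. -/
theorem ae_ne_zero_of_lines {f : (ι → ℝ) → ℝ} (hf : Measurable f) {w₀ : ι → ℝ} (h0 : f w₀ ≠ 0)
    (han : ∀ θ : ι → ℝ, AnalyticOnNhd ℝ (fun r : ℝ => f (r • θ + w₀)) Set.univ) :
    ∀ᵐ w, f w ≠ 0 := by
  have h1 : ∀ᵐ θ : ι → ℝ, θ ∉ {w | f (w + w₀) = 0} := by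
    refine ae_notMem_of_rays (measurableSet_eq_fun (by fun_prop) measurable_const)
      (ae_of_all _ fun θ => ?_)
    have h2 := ae_ne_zero_of_analyticOnNhd MeasurableSet.univ isPreconnected_univ (han θ)
      (Set.mem_univ 0) (by simpa using h0)
    rw [Measure.restrict_univ] at h2
    exact ae_restrict_of_ae h2
  have h3 :=
    (measurePreserving_add_right (volume : Measure (ι → ℝ)) (-w₀)).quasiMeasurePreserving.ae h1
  filter_upwards [h3] with w hw
  simpa using hw

end Density

theorem integrable_exp_neg_mul_sum_sq (n : ℕ) {t : ℝ} (ht : 0 < t) :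
    Integrable fun x : Fin n → ℝ => Real.exp (t * -(∑ i, x i ^ 2)) := by
  have h : Integrable fun x : Fin n → ℝ => ∏ i, Real.exp (-t * x i ^ 2) :=
    Integrable.fintype_prod fun _ => integrable_exp_neg_mul_sq ht
  refine h.congr (ae_of_all _ fun x => ?_)
  change ∏ i, Real.exp (-t * x i ^ 2) = _
  rw [← Real.exp_sum, ← Finset.mul_sum]
  congr 1
  ring

theorem analyticOnNhd_laplace {n : ℕ} {F : (Fin n → ℝ) → ℝ} {C : ℝ} (hF : Measurable F)
    (hC : ∀ x, |F x| ≤ C) :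
    AnalyticOnNhd ℝ (fun t : ℝ => ∫ x : Fin n → ℝ, F x * Real.exp (t * -(∑ i, x i ^ 2)))
      (Set.Ioi 0) := by
  set X : (Fin n → ℝ) → ℝ := fun x => -(∑ i, x i ^ 2) with hX
  set μ : Measure (Fin n → ℝ) := volume.withDensity fun x => ENNReal.ofReal (F x + C) with hμ
  have hFC : ∀ x, 0 ≤ F x + C := fun x => by linarith [(abs_le.mp (hC x)).1]
  have hInt : ∀ t, 0 < t → Integrable (fun x => F x * Real.exp (t * X x)) := fun t ht =>
    (integrable_exp_neg_mul_sum_sq n ht).bdd_mul (c := C) hF.aestronglyMeasurable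
      (ae_of_all _ hC)
  have hInt' : ∀ t, 0 < t → Integrable (fun x => (F x + C) * Real.exp (t * X x)) := fun t ht => by
    simp only [add_mul]
    exact (hInt t ht).add ((integrable_exp_neg_mul_sum_sq n ht).const_mul C)
  have hdens : Measurable fun x => ENNReal.ofReal (F x + C) := by fun_prop
  have hμint : ∀ t, 0 < t → Integrable (fun x => Real.exp (t * X x)) μ := fun t ht => by
    rw [hμ, integrable_withDensity_iff hdens (ae_of_all _ fun x => ENNReal.ofReal_lt_top)]
    refine (hInt' t ht).congr (ae_of_all _ fun x => ?_)
    simp only [ENNReal.toReal_ofReal (hFC x), mul_comm]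
  have hsub : ∀ ν : Measure (Fin n → ℝ), (∀ t, 0 < t → Integrable (fun x => Real.exp (t * X x)) ν) →
      Set.Ioi 0 ⊆ interior (integrableExpSet X ν) := fun ν hν =>
    interior_maximal (fun t ht => hν t ht) isOpen_Ioi
  have h1 : AnalyticOnNhd ℝ (mgf X μ) (Set.Ioi 0) := analyticOnNhd_mgf.mono (hsub μ hμint)
  have h2 : AnalyticOnNhd ℝ (mgf X volume) (Set.Ioi 0) :=
    analyticOnNhd_mgf.mono (hsub _ fun t ht => integrable_exp_neg_mul_sum_sq n ht)
  refine (h1.sub (analyticOnNhd_const (v := C) |>.mul h2)).congr isOpen_Ioi fun t ht => ?_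
  change mgf X μ t - C * mgf X volume t = ∫ x, F x * Real.exp (t * X x)
  have h3 : mgf X μ t = ∫ x, (F x + C) * Real.exp (t * X x) := by
    rw [mgf, hμ, integral_withDensity_eq_integral_toReal_smul hdens
      (ae_of_all _ fun x => ENNReal.ofReal_lt_top)]
    simp only [ENNReal.toReal_ofReal (hFC _), smul_eq_mul]
  rw [h3, mgf, ← integral_const_mul, ← integral_sub (hInt' t ht)
    ((integrable_exp_neg_mul_sum_sq n ht).const_mul C)]
  congr 1
  ext x
  ring

theorem prod_gaussianPDFReal_eq {n : ℕ} (x : Fin n → ℝ) :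
    ∏ i, gaussianPDFReal 0 1 (x i) =
      (√(2 * Real.pi))⁻¹ ^ n * Real.exp (1 / 2 * -(∑ i, x i ^ 2)) := by
  simp only [gaussianPDFReal, Finset.prod_mul_distrib, ← Real.exp_sum, NNReal.coe_one, mul_one,
    sub_zero, Finset.prod_const, Finset.card_univ, Fintype.card_fin]
  congr 2
  rw [← Finset.sum_div, Finset.sum_neg_distrib]
  ring

/-- A bounded function of a centred Gaussian vector has an expectation that depends
analytically on the standard deviation. -/
theorem analyticOnNhd_integral_smul {n : ℕ} {F : (Fin n → ℝ) → ℝ} {C : ℝ} (hF : Measurable F)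
    (hC : ∀ x, |F x| ≤ C) :
    AnalyticOnNhd ℝ (fun r : ℝ => ∫ g, F (r • g) ∂(inputMeasure n)) (Set.Ioi 0) := by
  have h1 : AnalyticOnNhd ℝ (fun r : ℝ => ((√(2 * Real.pi))⁻¹ * r⁻¹) ^ n *
      ∫ x : Fin n → ℝ, F x * Real.exp ((1 / 2 * (r⁻¹) ^ 2) * -(∑ i, x i ^ 2))) (Set.Ioi 0) := by
    intro r hr
    have hr' : r ≠ 0 := ne_of_gt hr
    have hinv : AnalyticAt ℝ (fun r : ℝ => r⁻¹) r := analyticAt_inv hr'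
    have hg : AnalyticAt ℝ (fun r : ℝ => 1 / 2 * (r⁻¹) ^ 2) r :=
      analyticAt_const.mul (hinv.pow 2)
    have hr0 : (0 : ℝ) < r := hr
    have hpos : (0 : ℝ) < 1 / 2 * (r⁻¹) ^ 2 := by positivity
    exact ((analyticAt_const.mul hinv).pow n).mul
      (AnalyticAt.comp (f := fun r : ℝ => 1 / 2 * (r⁻¹) ^ 2)
        (analyticOnNhd_laplace hF hC _ hpos) hg)
  refine h1.congr isOpen_Ioi fun r hr => ?_
  have hr0 : (0 : ℝ) < r := hr
  have h2 : ∫ g, F (r • g) ∂(inputMeasure n) =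
      ∫ x, (∏ i, gaussianPDFReal 0 1 (x i)) * F (r • x) := by
    rw [show inputMeasure n = gaussianPi (Fin n) 1 from rfl, gaussianPi_eq_withDensity one_ne_zero,
      integral_withDensity_eq_integral_toReal_smul _ (ae_of_all _ fun x => ENNReal.ofReal_lt_top)]
    · simp only [smul_eq_mul]
      congr 1
      ext x
      rw [ENNReal.toReal_ofReal (Finset.prod_nonneg fun i _ => gaussianPDFReal_nonneg _ _ _)]
    · refine ENNReal.measurable_ofReal.comp (Finset.measurable_prod _ fun i _ => ?_)
      exact (measurable_gaussianPDFReal 0 1).comp (measurable_pi_apply i)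
  have h3 := Measure.integral_comp_smul (volume : Measure (Fin n → ℝ))
    (fun x => (∏ i, gaussianPDFReal 0 1 (r⁻¹ * x i)) * F x) r
  simp only [Pi.smul_apply, smul_eq_mul, inv_mul_cancel_left₀ hr0.ne'] at h3
  change _ = ∫ g, F (r • g) ∂(inputMeasure n)
  rw [h2, h3, Module.finrank_fin_fun, abs_of_nonneg (by positivity), mul_pow, inv_pow r n,
    mul_comm ((√(2 * Real.pi))⁻¹ ^ n), mul_assoc, ← integral_const_mul]
  congr 2
  ext x
  rw [prod_gaussianPDFReal_eq (fun i => r⁻¹ * x i)]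
  simp only [mul_pow, ← Finset.mul_sum]
  rw [show 1 / 2 * -((r⁻¹) ^ 2 * ∑ i, x i ^ 2) = 1 / 2 * (r⁻¹) ^ 2 * -∑ i, x i ^ 2 by ring]
  ring

/-- The limiting output Hessian of the weights `r • W`, divided by `r ^ 2`. -/
noncomputable def scaledHess {c n : ℕ} (W : Matrix (Fin c) (Fin n) ℝ) (r : ℝ) :
    Matrix (Fin n) (Fin n) ℝ :=
  Matrix.of fun i j => ∫ g, reluHess W (r • g) i j ∂(inputMeasure n)

/-- The limit of `scaledHess W r` as `r` tends to zero. -/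
noncomputable def zeroHess {c n : ℕ} (W : Matrix (Fin c) (Fin n) ℝ) :
    Matrix (Fin n) (Fin n) ℝ :=
  Matrix.of fun i j => (1 / 4 + if i = j then 1 / 4 else 0) * (Wᵀ * Amat (0 : Fin c → ℝ) * W) i j

theorem act_mul {r : ℝ} (hr : 0 < r) (t : ℝ) : act (r * t) = act t := by
  unfold act
  simp only [mul_nonneg_iff_of_pos_left hr]

theorem limHess_smul {c n : ℕ} (W : Matrix (Fin c) (Fin n) ℝ) {r : ℝ} (hr : 0 < r) :
    limHess (r • W) = r ^ 2 • scaledHess W r := by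
  ext i j
  simp only [limHess, gaussHess, scaledHess, of_apply, one_mulVec, Matrix.smul_apply, smul_eq_mul]
  rw [← integral_const_mul]
  congr 1
  ext g
  have h : (fun i => max ((r • g) i) 0) = r • fun i => max (g i) 0 := by
    ext i
    simp only [Pi.smul_apply, smul_eq_mul]
    rw [mul_max_of_nonneg _ _ hr.le, mul_zero]
  rw [reluHess_apply, reluHess_apply, h]
  simp only [Pi.smul_apply, smul_eq_mul, act_mul hr, transpose_smul, Matrix.smul_mul,
    Matrix.mul_smul,
    Matrix.smul_apply, smul_mulVec, mulVec_smul]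
  ring

theorem scaledHess_transpose {c n : ℕ} (W : Matrix (Fin c) (Fin n) ℝ) (r : ℝ) :
    (scaledHess W r)ᵀ = scaledHess W r := by
  ext i j
  simp only [transpose_apply, scaledHess, of_apply]
  congr 1
  ext g
  rw [← transpose_apply (reluHess W _), reluHess_transpose]

theorem zeroHess_transpose {c n : ℕ} (W : Matrix (Fin c) (Fin n) ℝ) :
    (zeroHess W)ᵀ = zeroHess W := by
  have h : (Wᵀ * Amat (0 : Fin c → ℝ) * W)ᵀ = Wᵀ * Amat (0 : Fin c → ℝ) * W := by
    rw [transpose_mul, transpose_mul, transpose_transpose, Amat_transpose, Matrix.mul_assoc]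
  ext i j
  simp only [transpose_apply, zeroHess, of_apply]
  rw [← transpose_apply (Wᵀ * Amat (0 : Fin c → ℝ) * W), h]
  simp only [eq_comm]

theorem analyticOnNhd_scaledHess {c n : ℕ} (W : Matrix (Fin c) (Fin n) ℝ) (i j : Fin n) :
    AnalyticOnNhd ℝ (fun r => scaledHess W r i j) (Set.Ioi 0) :=
  analyticOnNhd_integral_smul (measurable_reluHess_right W i j) fun h => abs_reluHess_le W h i j

theorem integral_act_mul_act {n : ℕ} (i j : Fin n) :
    ∫ g, act (g i) * act (g j) ∂(inputMeasure n) = 1 / 4 + if i = j then 1 / 4 else 0 := by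
  have hc : ∀ k : Fin n, Integrable (fun g : Fin n → ℝ => cact (g k)) (inputMeasure n) := fun k =>
    Integrable.of_bound (measurable_cact.comp (measurable_pi_apply k)).aestronglyMeasurable (1 / 2)
      (ae_of_all _ fun g => (abs_cact _).le)
  have hcc := integrable_cact_mul_cact (n := n) i j
  have h : ∀ g : Fin n → ℝ, act (g i) * act (g j) =
      cact (g i) * cact (g j) + (1 / 2 * cact (g i) + (1 / 2 * cact (g j) + 1 / 4)) := fun g => by
    unfold cact
    ring
  simp only [h]
  have hj : Integrable (fun g : Fin n → ℝ => 1 / 2 * cact (g j) + 1 / 4) (inputMeasure n) :=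
    ((hc j).const_mul _).add (integrable_const _)
  have hi : Integrable (fun g : Fin n → ℝ => 1 / 2 * cact (g i) + (1 / 2 * cact (g j) + 1 / 4))
      (inputMeasure n) := ((hc i).const_mul _).add hj
  rw [integral_add hcc hi, integral_add ((hc i).const_mul _) hj,
    integral_add ((hc j).const_mul _) (integrable_const _), integral_const_mul, integral_const_mul,
    integral_cact, integral_cact, integral_cact_mul_cact]
  simp
  ring

theorem tendsto_scaledHess {c n : ℕ} (W : Matrix (Fin c) (Fin n) ℝ) (i j : Fin n) :
    Tendsto (fun r => scaledHess W r i j) (nhdsWithin 0 (Set.Ioi 0)) (nhds (zeroHess W i j)) := by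
  have hz : zeroHess W i j = ∫ g, act (g i) * act (g j) * (Wᵀ * Amat (0 : Fin c → ℝ) * W) i j
      ∂(inputMeasure n) := by
    rw [integral_mul_const, integral_act_mul_act]
    rfl
  rw [hz]
  simp only [scaledHess, of_apply]
  refine tendsto_integral_filter_of_dominated_convergence (fun _ => hessBound W i j)
    (Eventually.of_forall fun r => ((measurable_reluHess_right W i j).comp
      (measurable_const_smul r)).aestronglyMeasurable)
    (Eventually.of_forall fun r => ae_of_all _ fun g => abs_reluHess_le W _ i j)
    (integrable_const _) (ae_of_all _ fun g => ?_)
  have h1 : Continuous fun r : ℝ =>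
      (Wᵀ * Amat (W *ᵥ fun i => max ((r • g) i) 0) * W) i j :=
    ((continuous_preHess c n).comp (f := fun r : ℝ => (W, r • g)) (by fun_prop)).matrix_elem i j
  have h2 := (h1.tendsto 0).const_mul (act (g i) * act (g j))
  have h3 : (W *ᵥ fun i => max (((0 : ℝ) • g) i) 0) = 0 := by
    simp only [zero_smul, Pi.zero_apply, max_self]
    exact mulVec_zero W
  rw [h3] at h2
  refine (h2.mono_left nhdsWithin_le_nhds).congr' ?_
  filter_upwards [self_mem_nhdsWithin] with r hr
  rw [reluHess_apply]
  simp only [Pi.smul_apply, smul_eq_mul, act_mul hr]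

theorem SpectrallyGeneric.smul {m n : ℕ} {M N : Matrix (Fin n) (Fin n) ℝ} {D : ℝ}
    (h : SpectrallyGeneric m M N D) {a s : ℝ} (ha : a ≠ 0) (hs : s ≠ 0) :
    SpectrallyGeneric m (a • M) (s • N) (s * D) := by
  intro b lam hb
  have hb' : IsEigenbasis M b (fun i => a⁻¹ * lam i) := by
    refine ⟨hb.1, fun i => ?_⟩
    rw [← smul_smul, ← hb.2, smul_mulVec, smul_smul, inv_mul_cancel₀ ha, one_smul]
  obtain ⟨h1, h2⟩ := h b _ hb'
  refine ⟨fun i j hij => h1 (by simp only [hij]), fun f hf => h2 f ?_⟩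
  have h3 : quadSum (s • N) (fun a => b (f a)) = s * quadSum N (fun a => b (f a)) := by
    simp only [quadSum, smul_mulVec, dotProduct_smul, smul_eq_mul, Finset.mul_sum]
  rw [h3] at hf
  exact mul_left_cancel₀ hs hf

theorem specData_smul {m n : ℕ} (hm : 0 < m) (ε : ℝ) (M : Matrix (Fin n) (Fin n) ℝ)
    (V : Matrix (Fin m) (Fin n) ℝ) (r : ℝ) :
    (specData ε M (r • V)).2.1 = r ^ (2 * m) • (specData ε M V).2.1 ∧
    (specData ε M (r • V)).2.2 = r ^ (2 * m) * (specData ε M V).2.2 := by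
  have hG : (r • V) * (r • V)ᵀ = r ^ 2 • (V * Vᵀ) := by
    rw [transpose_smul, Matrix.smul_mul,
    Matrix.mul_smul, smul_smul, pow_two]
  constructor
  · simp only [specData, gramProj]
    rw [hG, adjugate_smul, transpose_smul]
    simp only [Matrix.smul_mul, Matrix.mul_smul, smul_smul, Fintype.card_fin]
    congr 1
    obtain ⟨k, rfl⟩ := Nat.exists_eq_succ_of_ne_zero hm.ne'
    simp only [Nat.succ_eq_add_one, Nat.add_sub_cancel]
    ring
  · simp only [specData, gramDet]
    rw [hG, det_smul, Fintype.card_fin, ← pow_mul]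
    ring

theorem rowDiff_W2of_smul {m n : ℕ} (r : ℝ) (w : Fin (m + 1) × Fin n → ℝ) :
    rowDiff (W2of (r • w)) = r • rowDiff (W2of w) := by
  ext i j
  simp only [rowDiff, W2of, of_apply, Pi.smul_apply, Matrix.smul_apply, smul_eq_mul]
  ring

/-- Spectral data of the small-weight limit of the output Hessian. -/
noncomputable def zeroData {m n : ℕ} (ε : ℝ) (w : (Fin (m + 1) × Fin n) → ℝ) : SpecData n :=
  specData ε (zeroHess (W2of w)) (rowDiff (W2of w))

/-- Evaluation of a polynomial on spectral data. -/
noncomputable def specEval {n : ℕ} (Q : MvPolynomial (PairIndex n) ℝ) (p : SpecData n) : ℝ :=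
  MvPolynomial.eval (pairPoint p.1 p.2.1 p.2.2) Q

theorem continuous_specEval {n : ℕ} (Q : MvPolynomial (PairIndex n) ℝ) :
    Continuous (specEval Q) := by
  refine (MvPolynomial.continuous_eval Q).comp (continuous_pi fun k => ?_)
  rcases k with p | p | _ <;> simp only [pairPoint, Sum.elim_inl, Sum.elim_inr] <;> fun_prop

theorem AnalyticOnNhd.specEval {E : Type*} [NormedAddCommGroup E] [NormedSpace ℝ E] {n : ℕ}
    (Q : MvPolynomial (PairIndex n) ℝ) {p : E → SpecData n} {s : Set E}
    (h1 : ∀ i j, AnalyticOnNhd ℝ (fun r => (p r).1 i j) s)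
    (h2 : ∀ i j, AnalyticOnNhd ℝ (fun r => (p r).2.1 i j) s)
    (h3 : AnalyticOnNhd ℝ (fun r => (p r).2.2) s) :
    AnalyticOnNhd ℝ (fun r => specEval Q (p r)) s := by
  refine AnalyticOnNhd.aeval_mvPolynomial (f := fun r => pairPoint (p r).1 (p r).2.1 (p r).2.2)
    (fun k => ?_) Q
  rcases k with q | q | _
  · exact h1 q.1 q.2
  · exact h2 q.1 q.2
  · exact h3

/-- Genericity of the small-weight limit propagates to all scales by analyticity. -/
theorem ae_limData_of_ae_zeroData {m n : ℕ} (hm : 0 < m) (ε : ℝ)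
    (h : ∀ᵐ w : Fin (m + 1) × Fin n → ℝ,
      SpectrallyGeneric m (zeroData ε w).1 (zeroData ε w).2.1 (zeroData ε w).2.2) :
    ∀ᵐ w : Fin (m + 1) × Fin n → ℝ,
      SpectrallyGeneric m (limData ε w).1 (limData ε w).2.1 (limData ε w).2.2 := by
  obtain ⟨Q, hQ⟩ := exists_spectral_polynomial m n
  have hQlim : ∀ w : Fin (m + 1) × Fin n → ℝ, specEval Q (limData ε w) ≠ 0 ↔
      SpectrallyGeneric m (limData ε w).1 (limData ε w).2.1 (limData ε w).2.2 := fun w =>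
    hQ _ _ _ (gaussHess_transpose _ _)
  have hZ : MeasurableSet {w : Fin (m + 1) × Fin n → ℝ | specEval Q (limData ε w) = 0} :=
    measurableSet_limData_mem ε (F := {p | specEval Q p = 0})
      (isClosed_eq (continuous_specEval Q) continuous_const)
  have key : ∀ᵐ w : Fin (m + 1) × Fin n → ℝ, w ∉ {w | specEval Q (limData ε w) = 0} := by
    refine ae_notMem_of_rays hZ ?_
    filter_upwards [h] with θ hθ
    set p : ℝ → SpecData n := fun r => specData ε (scaledHess (W2of θ) r) (rowDiff (W2of θ)) with hp
    have han : AnalyticOnNhd ℝ (fun r => specEval Q (p r)) (Set.Ioi 0) :=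
      AnalyticOnNhd.specEval Q (fun i j => analyticOnNhd_scaledHess _ i j)
        (fun i j => analyticOnNhd_const) analyticOnNhd_const
    have hlim : Tendsto p (nhdsWithin 0 (Set.Ioi 0)) (nhds (zeroData ε θ)) := by
      refine Tendsto.prodMk_nhds ?_ tendsto_const_nhds
      exact tendsto_pi_nhds.mpr fun i => tendsto_pi_nhds.mpr fun j => tendsto_scaledHess _ i j
    have h0 : specEval Q (zeroData ε θ) ≠ 0 := (hQ _ _ _ (zeroHess_transpose _)).mpr hθ
    have hev := (((continuous_specEval Q).tendsto _).comp hlim).eventually_ne h0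
    obtain ⟨r, hr, hr0⟩ := (hev.and self_mem_nhdsWithin).exists
    have hae := ae_ne_zero_of_analyticOnNhd measurableSet_Ioi isPreconnected_Ioi han hr0 hr
    filter_upwards [hae, ae_restrict_mem measurableSet_Ioi] with t ht ht0
    have hgen : SpectrallyGeneric m (p t).1 (p t).2.1 (p t).2.2 :=
      (hQ _ _ _ (scaledHess_transpose _ _)).mp ht
    have ht0' : t ≠ 0 := ne_of_gt ht0
    refine (hQlim _).mpr ?_
    have h1 : limData ε (t • θ) = (t ^ 2 • (p t).1, t ^ (2 * m) • (p t).2.1,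
        t ^ (2 * m) * (p t).2.2) := by
      have hs := specData_smul hm ε (limHess (W2of (t • θ))) (rowDiff (W2of θ)) t
      refine Prod.ext ?_ (Prod.ext ?_ ?_)
      · exact limHess_smul (W2of θ) ht0
      · rw [limData, rowDiff_W2of_smul, hs.1]
        rfl
      · rw [limData, rowDiff_W2of_smul, hs.2]
        rfl
    rw [h1]
    exact hgen.smul (pow_ne_zero _ ht0') (pow_ne_zero _ ht0')
  filter_upwards [key] with w hw
  exact (hQlim w).mp hw

/-- The Gram operator of a family of vectors plus its own diagonal part. -/
def famHess {m n : ℕ} (u : Fin m → Fin n → ℝ) : Matrix (Fin n) (Fin n) ℝ :=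
  Matrix.of fun i j => (1 + if i = j then 1 else 0) * ∑ b, u b i * u b j

theorem famHess_mulVec {m n : ℕ} (u : Fin m → Fin n → ℝ) (v : Fin n → ℝ) (i : Fin n) :
    (famHess u *ᵥ v) i = ∑ b, (u b ⬝ᵥ v) * u b i + (∑ b, u b i ^ 2) * v i := by
  have h : ∀ j, (1 + if i = j then (1 : ℝ) else 0) * (∑ b, u b i * u b j) * v j =
      (∑ b, u b i * u b j) * v j + if i = j then (∑ b, u b i * u b j) * v j else 0 := fun j => by
    split_ifs <;> ring
  simp only [mulVec, famHess, of_apply, dotProduct, h, Finset.sum_add_distrib, Finset.sum_ite_eq,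
    Finset.mem_univ, if_true, pow_two]
  congr 1
  simp only [Finset.sum_mul]
  rw [Finset.sum_comm]
  exact Finset.sum_congr rfl fun b _ => Finset.sum_congr rfl fun j _ => by ring

theorem dot_famHess_mulVec {m n : ℕ} (u : Fin m → Fin n → ℝ) (v : Fin n → ℝ) :
    v ⬝ᵥ famHess u *ᵥ v = ∑ b, (u b ⬝ᵥ v) ^ 2 + ∑ i, (∑ b, u b i ^ 2) * v i ^ 2 := by
  have h : ∀ i, v i * (famHess u *ᵥ v) i =
      ∑ b, (u b ⬝ᵥ v) * (u b i * v i) + (∑ b, u b i ^ 2) * v i ^ 2 := fun i => by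
    rw [famHess_mulVec, mul_add, Finset.mul_sum]
    congr 1
    · exact Finset.sum_congr rfl fun b _ => by ring
    · ring
  rw [dotProduct]
  simp only [h, Finset.sum_add_distrib]
  congr 1
  rw [Finset.sum_comm]
  refine Finset.sum_congr rfl fun b _ => ?_
  rw [← Finset.mul_sum, pow_two]
  rfl

/-- A unit vector supported on `S` whose squared entries on `S` are distinct and nonzero. -/
theorem exists_distinct_unit {n : ℕ} {S : Set (Fin n)} (hS : S.Nonempty) :
    ∃ s : Fin n → ℝ, s ⬝ᵥ s = 1 ∧ (∀ i ∈ S, s i ≠ 0) ∧ (∀ i ∉ S, s i = 0) ∧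
      ∀ i ∈ S, ∀ j ∈ S, s i ^ 2 = s j ^ 2 → i = j := by
  classical
  set t : Fin n → ℝ := fun i => if i ∈ S then (i : ℝ) + 1 else 0 with ht
  have htpos : 0 < t ⬝ᵥ t := by
    obtain ⟨i, hi⟩ := hS
    refine lt_of_le_of_ne (dot_self_nonneg t) fun h => ?_
    have h1 := congrFun (dotProduct_self_eq_zero.mp h.symm) i
    simp only [ht, if_pos hi, Pi.zero_apply] at h1
    exact absurd h1 (by positivity)
  set c := (√(t ⬝ᵥ t))⁻¹ with hc
  have hcpos : 0 < c := inv_pos.mpr (Real.sqrt_pos.mpr htpos)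
  refine ⟨c • t, ?_, fun i hi => ?_, fun i hi => ?_, fun i hi j hj hij => ?_⟩
  · rw [smul_dotProduct, dotProduct_smul, smul_smul, smul_eq_mul, hc, ← mul_inv,
      Real.mul_self_sqrt htpos.le, inv_mul_cancel₀ htpos.ne']
  · simp only [Pi.smul_apply, ht, if_pos hi, smul_eq_mul]
    positivity
  · simp [ht, if_neg hi]
  · simp only [Pi.smul_apply, ht, if_pos hi, if_pos hj, smul_eq_mul, mul_pow] at hij
    have h1 := mul_left_cancel₀ (pow_ne_zero 2 hcpos.ne') hij
    have h2 := (pow_left_inj₀ (by positivity) (by positivity) two_ne_zero).mp h1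
    exact Fin.ext (by exact_mod_cast add_right_cancel h2)

theorem exists_dotOrthonormal_extension {n : ℕ} (s : Set (Fin n)) (v : Fin n → Fin n → ℝ)
    (hv : ∀ i ∈ s, ∀ j ∈ s, v i ⬝ᵥ v j = if i = j then 1 else 0) :
    ∃ b : Fin n → Fin n → ℝ, DotOrthonormal b ∧ ∀ i ∈ s, b i = v i := by
  set V : Fin n → EuclideanSpace ℝ (Fin n) := fun i => WithLp.toLp 2 (v i) with hV
  have ho : Orthonormal ℝ (s.domRestrict V) := by
    rw [orthonormal_iff_ite]
    rintro ⟨i, hi⟩ ⟨j, hj⟩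
    rw [EuclideanSpace.inner_eq_star_dotProduct]
    have := hv j hj i hi
    simp only [Set.domRestrict_apply, hV, star_trivial, Subtype.mk.injEq, eq_comm (a := i)]
    exact this
  obtain ⟨b, hb⟩ := ho.exists_orthonormalBasis_extension_of_card_eq (by simp)
  refine ⟨fun i => ⇑(b i), fun i j => ?_, fun i hi => ?_⟩
  · have := orthonormal_iff_ite.mp b.orthonormal j i
    rw [EuclideanSpace.inner_eq_star_dotProduct] at this
    simpa [eq_comm] using this
  · simp only [hb i hi, hV]

/-- Entrywise, an eigenvector orthogonal to the family has a single nonzero entry on any set of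
coordinates where the diagonal part has distinct entries. -/
theorem eq_zero_of_diag_eigen {n : ℕ} {S : Set (Fin n)} {v s h : Fin n → ℝ} {lam : ℝ}
    (hv : ∀ i ∉ S, v i = 0) (hs : ∀ i ∈ S, s i ≠ 0)
    (hinj : ∀ i ∈ S, ∀ j ∈ S, h i = h j → i = j)
    (heig : ∀ i ∈ S, h i * v i = lam * v i) (hsv : s ⬝ᵥ v = 0) : v = 0 := by
  by_contra hne
  obtain ⟨i, hi⟩ := Function.ne_iff.mp hne
  have hiS : i ∈ S := by
    by_contra hcon
    exact hi (hv i hcon)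
  have hli := mul_right_cancel₀ hi (heig i hiS)
  have hother : ∀ j, j ≠ i → v j = 0 := fun j hj => by
    by_contra hvj
    have hjS : j ∈ S := by
      by_contra hcon
      exact hvj (hv j hcon)
    exact hj (hinj j hjS i hiS ((mul_right_cancel₀ hvj (heig j hjS)).trans hli.symm))
  have h1 : s ⬝ᵥ v = s i * v i :=
    Finset.sum_eq_single i (fun j _ hj => by rw [hother j hj, mul_zero]) (by simp)
  rw [h1] at hsv
  exact (mul_ne_zero (hs i hiS) hi) hsv

theorem IsEigenbasis.ne_zero {n : ℕ} {M : Matrix (Fin n) (Fin n) ℝ} {b : Fin n → Fin n → ℝ}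
    {lam : Fin n → ℝ} (h : IsEigenbasis M b lam) (i : Fin n) : b i ≠ 0 := by
  intro h0
  have := h.1 i i
  simp [h0] at this

/-- A family avoiding the value `x` for the overlap with any eigenvectors of its `famHess`. -/
def OverlapAvoids {m n : ℕ} (u : Fin m → Fin n → ℝ) (x : ℝ) : Prop :=
  ∀ b lam, IsEigenbasis (famHess u) b lam → ∀ f : Fin m ↪ Fin n,
    ∑ a, ∑ b', (b (f a) ⬝ᵥ u b') ^ 2 ≠ x

theorem exists_overlapAvoids_of_notMem {m n : ℕ} (hmn : m ≤ n) {x : ℝ} (hx : ∀ k : ℕ, (k : ℝ) ≠ x) :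
    ∃ u : Fin m → Fin n → ℝ, DotOrthonormal u ∧ OverlapAvoids u x := by
  set u : Fin m → Fin n → ℝ := fun b => Pi.single (Fin.castLE hmn b) 1 with hu
  refine ⟨u, fun a b => ?_, fun b lam hb f => ?_⟩
  · simp [hu, Pi.single_apply, (Fin.castLE_injective hmn).eq_iff, eq_comm]
  · have hq : ∀ k, ∑ b', (b k ⬝ᵥ u b') ^ 2 = if lam k = 0 then 0 else 1 := by
      intro k
      have h1 := dot_famHess_mulVec u (b k)
      have h2 : ∀ i, (∑ b', u b' i ^ 2) * b k i ^ 2 =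
          ∑ b', if Fin.castLE hmn b' = i then b k i ^ 2 else 0 := fun i => by
        rw [Finset.sum_mul]
        refine Finset.sum_congr rfl fun b' _ => ?_
        simp only [hu, Pi.single_apply, eq_comm (a := i)]
        split_ifs <;> simp
      have h3 : ∀ b', (b k ⬝ᵥ u b') ^ 2 = b k (Fin.castLE hmn b') ^ 2 := fun b' => by simp [hu]
      have h4 : ∀ b', (u b' ⬝ᵥ b k) ^ 2 = b k (Fin.castLE hmn b') ^ 2 := fun b' => by simp [hu]
      simp only [h2, h4] at h1
      rw [Finset.sum_comm] at h1
      simp only [Finset.sum_ite_eq, Finset.mem_univ, if_true] at h1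
      rw [hb.2, dotProduct_smul, hb.1] at h1
      simp only [h3]
      split_ifs with h
      · rw [h] at h1
        simp at h1
        linarith
      · have h5 : ∀ b', lam k * b k (Fin.castLE hmn b') ^ 2 =
            2 * b k (Fin.castLE hmn b') ^ 2 := fun b' => by
          have h6 := congrFun (hb.2 k) (Fin.castLE hmn b')
          rw [famHess_mulVec] at h6
          simp [hu, Pi.single_apply, (Fin.castLE_injective hmn).eq_iff] at h6
          linear_combination -(b k (Fin.castLE hmn b')) * h6
        have h7 : lam k * ∑ b', b k (Fin.castLE hmn b') ^ 2 =
            2 * ∑ b', b k (Fin.castLE hmn b') ^ 2 := by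
          rw [Finset.mul_sum, Finset.mul_sum]
          exact Finset.sum_congr rfl fun b' _ => h5 b'
        simp at h1
        have h8 : lam k = 2 := by
          refine mul_left_cancel₀ h ?_
          linear_combination 2 * h7 + (lam k - 2) * h1
        linarith
    simp only [hq]
    intro h
    refine hx (∑ a, if lam (f a) = 0 then 0 else 1) ?_
    rw [← h]
    push_cast
    rfl

theorem exists_overlapAvoids_zero {m n : ℕ} (hm : 0 < m) (hmn : m ≤ n) :
    ∃ u : Fin m → Fin n → ℝ, DotOrthonormal u ∧ OverlapAvoids u 0 := by
  obtain ⟨m, rfl⟩ := Nat.exists_eq_succ_of_ne_zero hm.ne'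
  set S : Set (Fin n) := {i | m ≤ (i : ℕ)} with hS
  obtain ⟨s, hs1, hs0, hsS, hsinj⟩ := exists_distinct_unit (S := S) ⟨⟨m, hmn⟩, le_refl m⟩
  have hlt : m ≤ n := (Nat.le_succ m).trans hmn
  set e : Fin m → Fin n → ℝ := fun b => Pi.single (Fin.castLE hlt b) 1 with he
  set u : Fin (m + 1) → Fin n → ℝ := Fin.snoc (α := fun _ => Fin n → ℝ) e s with hu
  have huc : ∀ b : Fin m, u b.castSucc = e b := fun b => by simp [hu]
  have hul : u (Fin.last m) = s := by simp [hu]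
  have hsc : ∀ b : Fin m, s (Fin.castLE hlt b) = 0 := fun b => hsS _ (by simp [hS])
  refine ⟨u, fun a b => ?_, fun b lam hb f hsum => ?_⟩
  · induction a using Fin.lastCases with
    | last =>
      induction b using Fin.lastCases with
      | last => simp [hul, hs1]
      | cast b => simp [hul, huc, he, hsc, (Fin.castSucc_lt_last b).ne']
    | cast a =>
      induction b using Fin.lastCases with
      | last => simp [hul, huc, he, hsc, (Fin.castSucc_lt_last a).ne]
      | cast b =>
        simp [huc, he, Pi.single_apply, (Fin.castLE_injective hlt).eq_iff, eq_comm]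
  · set k := f 0
    have hk : ∀ b', b k ⬝ᵥ u b' = 0 := by
      have h1 := (Finset.sum_eq_zero_iff_of_nonneg fun a _ =>
        Finset.sum_nonneg fun b' _ => sq_nonneg (b (f a) ⬝ᵥ u b')).mp hsum 0 (Finset.mem_univ _)
      intro b'
      exact pow_eq_zero_iff two_ne_zero |>.mp ((Finset.sum_eq_zero_iff_of_nonneg fun b' _ =>
        sq_nonneg (b k ⬝ᵥ u b')).mp h1 b' (Finset.mem_univ _))
    refine hb.ne_zero k (eq_zero_of_diag_eigen (S := S) (h := fun i => s i ^ 2) (lam := lam k)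
      (fun i hi => ?_) hs0 hsinj (fun i hi => ?_) ?_)
    · have hi' : (i : ℕ) < m := not_le.mp hi
      have h2 := hk (Fin.castSucc ⟨i, hi'⟩)
      rw [huc, he] at h2
      simpa using h2
    · have h2 := congrFun (hb.2 k) i
      rw [famHess_mulVec] at h2
      have h3 : ∑ b', u b' i ^ 2 = s i ^ 2 := by
        rw [Fin.sum_univ_castSucc, hul]
        refine add_eq_right.mpr (Finset.sum_eq_zero fun b' _ => ?_)
        have hne : i ≠ Fin.castLE hlt b' := fun h => by
          have : m ≤ (i : ℕ) := hi
          rw [h] at this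
          exact absurd b'.2 (not_lt.mpr this)
        simp [huc, he, hne]
      rw [h3] at h2
      simpa [dotProduct_comm (u _), hk] using h2
    · rw [dotProduct_comm, ← hul, hk]

theorem exists_overlapAvoids_natCast {m n : ℕ} (hm : 0 < m) (hmn : m < n) (K : ℕ) (hK : 0 < K) :
    ∃ u : Fin m → Fin n → ℝ, DotOrthonormal u ∧ OverlapAvoids u K := by
  obtain ⟨k, rfl⟩ := Nat.exists_eq_add_of_lt hmn
  rw [show m + k + 1 = m + 1 + k by ring] at *
  set S : Set (Fin (m + 1 + k)) := {i | (i : ℕ) ≤ m} with hS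
  obtain ⟨s, hs1, hs0, hsS, hsinj⟩ := exists_distinct_unit (S := S) ⟨⟨m, hmn⟩, le_refl m⟩
  have hnat : ∀ j : Fin k, Fin.natAdd (m + 1) j ∉ S := fun j h => by
    simp [hS] at h
    omega
  have hcast : ∀ j : Fin (m + 1), Fin.castAdd k j ∈ S := fun j => by
    simp [hS]
    omega
  set l : Fin (m + 1 + k) := Fin.castAdd k (Fin.last m) with hl
  obtain ⟨w, hw, hwv⟩ := exists_dotOrthonormal_extension (n := m + 1 + k) ({i | m ≤ (i : ℕ)})
    (fun i => if i = l then s else Pi.single i 1) (fun i hi j hj => by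
      have hout : ∀ i : Fin (m + 1 + k), m ≤ (i : ℕ) → i ≠ l → s i = 0 := fun i hi hil => by
        refine hsS i fun h => hil (Fin.ext ?_)
        simp [hS] at h
        simp [hl]
        omega
      by_cases h1 : i = l <;> by_cases h2 : j = l
      · simp [h1, h2, hs1]
      · simp [h1, h2, hout j hj h2, Ne.symm h2]
      · simp [h1, h2, hout i hi h1]
      · simp [h1, h2, Pi.single_apply, eq_comm])
  set u : Fin m → Fin (m + 1 + k) → ℝ := fun b => w (Fin.castAdd k b.castSucc) with hu
  have hwl : w l = s := by rw [hwv l (by simp [hl]), if_pos rfl]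
  have hwn : ∀ j : Fin k, w (Fin.natAdd (m + 1) j) = Pi.single (Fin.natAdd (m + 1) j) 1 :=
    fun j => by
      rw [hwv _ (by simp; omega), if_neg]
      intro h
      have h1 := congrArg Fin.val h
      simp [hl] at h1
      omega
  have hsplit : ∀ y z : Fin (m + 1 + k) → ℝ, ∑ b, (u b ⬝ᵥ y) * (u b ⬝ᵥ z) =
      ∑ i : Fin (m + 1), y (Fin.castAdd k i) * z (Fin.castAdd k i) - (s ⬝ᵥ y) * (s ⬝ᵥ z) := by
    intro y z
    have h := hw.parseval y z
    rw [Fin.sum_univ_add, Fin.sum_univ_castSucc, ← hl, hwl, dotProduct, Fin.sum_univ_add] at h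
    simp only [hwn, single_one_dotProduct] at h
    linarith
  have hP : ∀ i v, ∑ b, (u b ⬝ᵥ v) * u b i = (if (i : ℕ) ≤ m then v i else 0) - (s ⬝ᵥ v) * s i := by
    intro i v
    have h := hsplit v (Pi.single i 1)
    simp only [dotProduct_single_one] at h
    rw [h]
    congr 1
    induction i using Fin.addCases with
    | left i =>
      rw [if_pos (show _ ≤ m from hcast i)]
      simp [Pi.single_apply, (Fin.castAdd_injective (m + 1) k).eq_iff]
    | right j =>
      rw [if_neg (show ¬ _ ≤ m from hnat j)]
      refine Finset.sum_eq_zero fun i _ => ?_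
      rw [Pi.single_eq_of_ne, mul_zero]
      intro h
      exact hnat j (h ▸ hcast i)
  have hdiag : ∀ i, ∑ b, u b i ^ 2 = if (i : ℕ) ≤ m then 1 - s i ^ 2 else 0 := by
    intro i
    have h := hP i (Pi.single i 1)
    simp only [dotProduct_single_one, Pi.single_eq_same, ← pow_two] at h
    rw [h]
    split_ifs with hi
    · rfl
    · rw [hsS i hi]
      simp
  have hsmall : ∀ i ∈ S, s i ^ 2 < 1 := by
    intro i hi
    obtain ⟨j, hj, hji⟩ : ∃ j ∈ S, j ≠ i := by
      by_cases h : (i : ℕ) = 0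
      · exact ⟨l, by simp [hS, hl], fun h' => by simp [← h', hl] at h; omega⟩
      · exact ⟨⟨0, by omega⟩, by simp [hS], fun h' => h (by simp [← h'])⟩
    have h1 : s i ^ 2 + s j ^ 2 ≤ 1 := by
      rw [← hs1, dotProduct, ← Finset.sum_pair (f := fun i => s i ^ 2) hji.symm]
      simp only [pow_two]
      exact Finset.sum_le_sum_of_subset_of_nonneg (Finset.subset_univ _)
        fun i _ _ => mul_self_nonneg _
    have h2 : 0 < s j ^ 2 := by
      have := hs0 j hj
      positivity
    linarith
  refine ⟨u, fun a b => ?_, fun b lam hb f hsum => ?_⟩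
  · have h := hw (Fin.castAdd k a.castSucc) (Fin.castAdd k b.castSucc)
    simpa [(Fin.castAdd_injective (m + 1) k).eq_iff] using h
  set R : Fin (m + 1 + k) → ℝ := fun κ => ∑ i : Fin (m + 1), b κ (Fin.castAdd k i) ^ 2 with hR
  set T : Fin (m + 1 + k) → ℝ := fun κ => (s ⬝ᵥ b κ) ^ 2 with hT
  have hq : ∀ κ, ∑ b', (u b' ⬝ᵥ b κ) ^ 2 = R κ - T κ := fun κ => by
    simpa only [← pow_two] using hsplit (b κ) (b κ)
  have hzero : ∀ κ, lam κ = 0 → R κ = 0 ∧ T κ = 0 := by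
    intro κ h0
    have h1 := dot_famHess_mulVec u (b κ)
    rw [hb.2, h0, zero_smul, dotProduct_zero] at h1
    have hnn : ∀ i, 0 ≤ (∑ b', u b' i ^ 2) * b κ i ^ 2 := fun i =>
      mul_nonneg (Finset.sum_nonneg fun _ _ => sq_nonneg _) (sq_nonneg _)
    have hqn : 0 ≤ ∑ b', (u b' ⬝ᵥ b κ) ^ 2 := Finset.sum_nonneg fun _ _ => sq_nonneg _
    have h2 : ∑ i, (∑ b', u b' i ^ 2) * b κ i ^ 2 = 0 :=
      le_antisymm (by linarith) (Finset.sum_nonneg fun i _ => hnn i)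
    have h3 : ∀ i ∈ S, b κ i = 0 := fun i hi => by
      have h4 := (Finset.sum_eq_zero_iff_of_nonneg fun i _ => hnn i).mp h2 i (Finset.mem_univ _)
      rw [hdiag, if_pos (show _ ≤ m from hi)] at h4
      rcases mul_eq_zero.mp h4 with h5 | h5
      · linarith [hsmall i hi]
      · exact pow_eq_zero_iff two_ne_zero |>.mp h5
    refine ⟨Finset.sum_eq_zero fun i _ => by rw [h3 _ (hcast i)]; norm_num, ?_⟩
    have h5 : s ⬝ᵥ b κ = 0 := Finset.sum_eq_zero fun i _ => by
      by_cases hi : i ∈ S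
      · rw [h3 i hi, mul_zero]
      · rw [hsS i hi, zero_mul]
    simp only [hT, h5]
    norm_num
  have hone : ∀ κ, lam κ ≠ 0 → R κ = 1 ∧ 0 < T κ := by
    intro κ h0
    have heig : ∀ i : Fin (m + 1 + k), (if (i : ℕ) ≤ m then b κ i else 0) - (s ⬝ᵥ b κ) * s i +
        (if (i : ℕ) ≤ m then 1 - s i ^ 2 else 0) * b κ i = lam κ * b κ i := fun i => by
      have h2 := congrFun (hb.2 κ) i
      rwa [famHess_mulVec, hP, hdiag] at h2
    have hout : ∀ i ∉ S, b κ i = 0 := fun i hi => by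
      have h2 := heig i
      rw [if_neg (show ¬ _ ≤ m from hi), if_neg (show ¬ _ ≤ m from hi), hsS i hi] at h2
      refine mul_left_cancel₀ h0 ?_
      linarith
    refine ⟨?_, ?_⟩
    · have h1 := hb.1 κ κ
      rw [if_pos rfl, dotProduct, Fin.sum_univ_add] at h1
      simp only [hout _ (hnat _), ← pow_two] at h1
      simpa using h1
    · refine lt_of_le_of_ne (sq_nonneg _) fun h => hb.ne_zero κ ?_
      have hs : s ⬝ᵥ b κ = 0 := pow_eq_zero_iff two_ne_zero |>.mp h.symm
      refine eq_zero_of_diag_eigen (S := S) (h := fun i => 2 - s i ^ 2) (lam := lam κ) hout hs0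
        (fun i hi j hj hij => hsinj i hi j hj (by simpa using hij)) (fun i hi => ?_) hs
      have h2 := heig i
      rw [if_pos (show _ ≤ m from hi), if_pos (show _ ≤ m from hi), hs] at h2
      linarith
  have hTsum : ∑ κ, T κ = 1 := by
    rw [← hs1, hb.1.parseval s s]
    exact Finset.sum_congr rfl fun κ _ => by rw [← pow_two, dotProduct_comm]
  have hRsum : ∑ κ, R κ = m + 1 := by
    rw [Finset.sum_comm]
    have h1 : ∀ i : Fin (m + 1), ∑ κ, b κ (Fin.castAdd k i) ^ 2 = 1 := fun i => by
      have h := hb.1.parseval (Pi.single (Fin.castAdd k i) 1) (Pi.single (Fin.castAdd k i) 1)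
      simp only [dotProduct_single_one, Pi.single_eq_same, ← pow_two] at h
      exact h.symm
    simp [h1]
  have hR01 : ∀ κ, R κ = if lam κ = 0 then 0 else 1 := fun κ => by
    split_ifs with h
    · exact (hzero κ h).1
    · exact (hone κ h).1
  have hT0 : ∀ κ, 0 ≤ T κ := fun κ => sq_nonneg _
  obtain ⟨κ, hκf, hκ⟩ : ∃ κ, κ ∉ Finset.univ.map f ∧ lam κ ≠ 0 := by
    by_contra! hcon
    have h1 : ∑ κ, R κ = ∑ κ ∈ Finset.univ.map f, R κ :=
      (Finset.sum_subset (Finset.subset_univ _) fun κ _ h => (hzero κ (hcon κ h)).1).symm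
    have h2 : ∑ κ ∈ Finset.univ.map f, R κ ≤ ∑ κ ∈ Finset.univ.map f, (1 : ℝ) :=
      Finset.sum_le_sum fun κ _ => by
        rw [hR01]
        split_ifs <;> norm_num
    rw [← h1, hRsum] at h2
    simp at h2
    linarith
  have hTf : ∑ a, T (f a) < 1 := by
    have h1 : ∑ κ' ∈ insert κ (Finset.univ.map f), T κ' ≤ 1 := by
      rw [← hTsum]
      exact Finset.sum_le_sum_of_subset_of_nonneg (Finset.subset_univ _) fun κ _ _ => hT0 κ
    rw [Finset.sum_insert hκf, Finset.sum_map] at h1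
    linarith [(hone κ hκ).2]
  have hval : (∑ a, if lam (f a) = 0 then (0 : ℝ) else 1) - ∑ a, T (f a) = K := by
    rw [← hsum, ← Finset.sum_sub_distrib]
    refine Finset.sum_congr rfl fun a _ => ?_
    rw [← hR01, ← hq]
    exact Finset.sum_congr rfl fun b' _ => by rw [dotProduct_comm]
  set N : ℕ := ∑ a, if lam (f a) = 0 then 0 else 1 with hN
  have hNc : (∑ a, if lam (f a) = 0 then (0 : ℝ) else 1) = N := by
    rw [hN]
    push_cast
    rfl
  rw [hNc] at hval
  have hTn : 0 ≤ ∑ a, T (f a) := Finset.sum_nonneg fun a _ => hT0 _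
  have hNK : N = K := by
    have h1 : K ≤ N := by exact_mod_cast (by linarith : (K : ℝ) ≤ N)
    have h2 : N < K + 1 := by exact_mod_cast (by linarith : (N : ℝ) < K + 1)
    omega
  have hT0' : ∑ a, T (f a) = 0 := by
    rw [hNK] at hval
    linarith
  have hall : ∀ a, lam (f a) = 0 := fun a => by
    by_contra h
    have := (Finset.sum_eq_zero_iff_of_nonneg fun a _ => hT0 (f a)).mp hT0' a (Finset.mem_univ _)
    exact (hone _ h).2.ne' this
  have : N = 0 := by simp [hN, hall]
  omega

theorem exists_overlapAvoids {m n : ℕ} (hm : 0 < m) (hmn : m < n) (x : ℝ) :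
    ∃ u : Fin m → Fin n → ℝ, DotOrthonormal u ∧ OverlapAvoids u x := by
  by_cases h : ∃ K : ℕ, (K : ℝ) = x
  · obtain ⟨K, rfl⟩ := h
    rcases Nat.eq_zero_or_pos K with rfl | hK
    · exact_mod_cast exists_overlapAvoids_zero hm hmn.le
    · exact exists_overlapAvoids_natCast hm hmn K hK
  · push Not at h
    exact exists_overlapAvoids_of_notMem hmn.le h

theorem exists_sumZero_basis (m : ℕ) : ∃ e : Fin (m + 1) → Fin (m + 1) → ℝ, DotOrthonormal e ∧
    (∀ b : Fin m, ∑ a, e b.castSucc a = 0) ∧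
    ∀ x : Fin (m + 1) → ℝ, ∑ i, x i = 0 → e (Fin.last m) ⬝ᵥ x = 0 := by
  set c : ℝ := (√(m + 1))⁻¹ with hc
  have hcm : c * c * (m + 1) = 1 := by
    rw [hc, ← mul_inv, Real.mul_self_sqrt (by positivity), inv_mul_cancel₀ (by positivity)]
  have hc0 : c ≠ 0 := by
    rw [hc]
    positivity
  obtain ⟨e, he, hel⟩ := exists_dotOrthonormal_extension {Fin.last m} (fun _ _ => c) (by
    rintro i rfl j rfl
    simp only [dotProduct, Finset.sum_const, Finset.card_univ, Fintype.card_fin, if_true,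
      nsmul_eq_mul]
    push_cast
    linarith)
  have hdot : ∀ x : Fin (m + 1) → ℝ, e (Fin.last m) ⬝ᵥ x = c * ∑ i, x i := fun x => by
    rw [hel _ rfl, Finset.mul_sum]
    rfl
  refine ⟨e, he, fun b => ?_, fun x hx => by rw [hdot, hx, mul_zero]⟩
  have h := he (Fin.last m) b.castSucc
  rw [hdot, if_neg (Fin.castSucc_lt_last b).ne'] at h
  exact (mul_eq_zero.mp h).resolve_left hc0

theorem transpose_mul_Amat_zero_mul {c n : ℕ} (W : Matrix (Fin c) (Fin n) ℝ)
    (hW : ∀ j, ∑ a, W a j = 0) :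
    Wᵀ * Amat (0 : Fin c → ℝ) * W = (c : ℝ)⁻¹ • (Wᵀ * W) := by
  have h : Amat (0 : Fin c → ℝ) * W = (c : ℝ)⁻¹ • W := by
    ext a j
    simp [Amat, softmaxFn, vecMulVec, Matrix.mul_apply, Matrix.diagonal_apply, sub_mul,
      ← Finset.mul_sum, hW]
  rw [Matrix.mul_assoc, h, Matrix.mul_smul]

/-- Second-layer weights realising a prescribed family of vectors. -/
theorem exists_weights {m n : ℕ} (u : Fin m → Fin n → ℝ) :
    ∃ W : Matrix (Fin (m + 1)) (Fin n) ℝ,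
      zeroHess W = (1 / (4 * ((m : ℝ) + 1))) • famHess u ∧
      LinearMap.range (mulVecLin (rowDiff W)ᵀ) = Submodule.span ℝ (Set.range u) ∧
      (DotOrthonormal u → gramDet (rowDiff W) ≠ 0) := by
  obtain ⟨e, he, hes, hel⟩ := exists_sumZero_basis m
  set E : Matrix (Fin m) (Fin (m + 1)) ℝ := Matrix.of fun b => e b.castSucc with hE
  have hEE : E * Eᵀ = 1 := by
    ext a b
    have := he a.castSucc b.castSucc
    simp only [(Fin.castSucc_injective m).eq_iff] at this
    rw [Matrix.one_apply, ← this]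
    rfl
  set U : Matrix (Fin m) (Fin n) ℝ := Matrix.of u with hU
  have hWt : ∀ x : Fin (m + 1) → ℝ, (Eᵀ * U)ᵀ *ᵥ x = Uᵀ *ᵥ (E *ᵥ x) := fun x => by
    rw [transpose_mul, transpose_transpose, mulVec_mulVec]
  refine ⟨Eᵀ * U, ?_, ?_, fun hu => gramDet_ne_zero_of_le fun x hx => ?_⟩
  · have h0 : ∀ j, ∑ a, (Eᵀ * U) a j = 0 := fun j => by
      simp only [Matrix.mul_apply, transpose_apply, hE, of_apply]
      rw [Finset.sum_comm]
      simp only [← Finset.sum_mul, hes, zero_mul, Finset.sum_const_zero]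
    have h1 : (Eᵀ * U)ᵀ * (Eᵀ * U) = Uᵀ * U := by
      rw [transpose_mul, transpose_transpose, Matrix.mul_assoc, ← Matrix.mul_assoc E, hEE,
        Matrix.one_mul]
    ext i j
    simp only [zeroHess, of_apply]
    rw [transpose_mul_Amat_zero_mul _ h0, h1]
    simp only [famHess, Matrix.smul_apply, of_apply, smul_eq_mul, Matrix.mul_apply,
      transpose_apply, hU]
    push_cast
    field_simp
    split_ifs <;> ring
  · rw [← map_ker_sumLin]
    ext z
    have hspan : Submodule.span ℝ (Set.range u) = LinearMap.range (mulVecLin Uᵀ) := by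
      rw [Matrix.range_mulVecLin]
      rfl
    rw [hspan]
    simp only [Submodule.mem_map, LinearMap.mem_range, mulVecLin_apply, hWt]
    constructor
    · rintro ⟨x, -, rfl⟩
      exact ⟨_, rfl⟩
    · rintro ⟨y, rfl⟩
      refine ⟨Eᵀ *ᵥ y, ?_, by rw [mulVec_mulVec y E, hEE, one_mulVec]⟩
      change ∑ a, (Eᵀ *ᵥ y) a = 0
      simp only [mulVec, dotProduct, transpose_apply, hE, of_apply]
      rw [Finset.sum_comm]
      simp only [← Finset.sum_mul, hes, zero_mul, Finset.sum_const_zero]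
  · have hUU : U * Uᵀ = 1 := by
      ext a b
      rw [Matrix.one_apply, ← hu a b]
      rfl
    have h1 : (Uᵀ *ᵥ (E *ᵥ x)) ⬝ᵥ (Uᵀ *ᵥ (E *ᵥ x)) = (E *ᵥ x) ⬝ᵥ (E *ᵥ x) := by
      rw [dotProduct_mulVec, ← mulVec_transpose, transpose_transpose, mulVec_mulVec, hUU,
        one_mulVec]
    have h2 : (E *ᵥ x) ⬝ᵥ (E *ᵥ x) = x ⬝ᵥ x := by
      rw [he.parseval x x, Fin.sum_univ_castSucc, hel x hx, mul_zero, add_zero]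
      rfl
    rw [hWt, h1, h2]
    linarith [dot_self_nonneg x]

theorem exists_simple_famHess {m n : ℕ} (hm : 0 < m) (hn : 0 < n) :
    ∃ u : Fin m → Fin n → ℝ, ∀ b lam, IsEigenbasis (famHess u) b lam → Function.Injective lam := by
  obtain ⟨s, -, hs0, -, hsinj⟩ := exists_distinct_unit (S := (Set.univ : Set (Fin n)))
    ⟨⟨0, hn⟩, trivial⟩
  set u : Fin m → Fin n → ℝ := fun b => if b = ⟨0, hm⟩ then s else 0 with hu
  have hmul : ∀ v i, (famHess u *ᵥ v) i = (s ⬝ᵥ v) * s i + s i ^ 2 * v i := by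
    intro v i
    rw [famHess_mulVec]
    congr 1
    · rw [Finset.sum_eq_single ⟨0, hm⟩ (fun b _ hb => by simp [hu, hb]) (by simp)]
      simp [hu]
    · rw [Finset.sum_eq_single ⟨0, hm⟩ (fun b _ hb => by simp [hu, hb]) (by simp)]
      simp [hu]
  have key : ∀ (v : Fin n → ℝ) (μ : ℝ), famHess u *ᵥ v = μ • v → s ⬝ᵥ v = 0 → v = 0 := by
    intro v μ hv hsv
    refine eq_zero_of_diag_eigen (S := Set.univ) (h := fun i => s i ^ 2) (lam := μ)
      (fun i hi => absurd trivial hi) hs0 hsinj (fun i _ => ?_) hsv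
    have := congrFun hv i
    rw [hmul, hsv, zero_mul, zero_add] at this
    exact this
  refine ⟨u, fun b lam hb k l hkl => ?_⟩
  by_contra hne
  have hk : s ⬝ᵥ b k ≠ 0 := fun h => hb.ne_zero k (key _ _ (hb.2 k) h)
  have h0 := key ((s ⬝ᵥ b l) • b k - (s ⬝ᵥ b k) • b l) (lam k) (by
    rw [mulVec_sub, mulVec_smul, mulVec_smul, hb.2, hb.2, ← hkl, smul_sub]
    simp only [smul_smul, mul_comm]) (by
    simp only [dotProduct_sub, dotProduct_smul, smul_eq_mul]
    ring)
  have h1 := congrArg (fun v => b l ⬝ᵥ v) h0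
  simp [dotProduct_sub, dotProduct_smul, hb.1 _ _, Ne.symm hne, hk] at h1

theorem exists_notMem_eigenEq {m n : ℕ} (hm : 0 < m) (hmn : m < n) (ε : ℝ) :
    ∃ w : Fin (m + 1) × Fin n → ℝ, gramDet (rowDiff (W2of w)) ≠ 0 ∧ zeroData ε w ∉ eigenEq m n := by
  obtain ⟨u, hu, hav⟩ := exists_overlapAvoids hm hmn (m * (1 - ε))
  obtain ⟨W, hW, hspan, hdet⟩ := exists_weights u
  have hd := hdet hu
  refine ⟨fun p => W p.1 p.2, hd, fun h => ?_⟩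
  obtain ⟨f, b, hb, heq⟩ := Set.mem_iUnion.mp h
  change quadSum (gramProj (rowDiff W)) _ = m * (1 - ε) * gramDet (rowDiff W) at heq
  change IsEigenfamily (zeroHess W) b at hb
  rw [quadSum_gramProj _ hu hspan.symm, mul_comm] at heq
  set a : ℝ := 1 / (4 * ((m : ℝ) + 1)) with ha
  have ha0 : a ≠ 0 := by
    rw [ha]
    positivity
  refine hav b (fun i => a⁻¹ * (b i ⬝ᵥ zeroHess W *ᵥ b i)) ⟨hb.1, fun i => ?_⟩ f
    (mul_right_cancel₀ hd heq)
  rw [← smul_smul, ← hb.2 i, hW, smul_mulVec, smul_smul, inv_mul_cancel₀ ha0, one_smul]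

/-- A matrix-valued function all of whose entries are analytic. -/
def EntrywiseAnalytic {E : Type*} [NormedAddCommGroup E] [NormedSpace ℝ E] {p q : ℕ}
    (M : E → Matrix (Fin p) (Fin q) ℝ) : Prop :=
  ∀ i j, AnalyticOnNhd ℝ (fun w => M w i j) Set.univ

section EntrywiseAnalytic

variable {E : Type*} [NormedAddCommGroup E] [NormedSpace ℝ E] {p q r : ℕ}

theorem EntrywiseAnalytic.mul {M : E → Matrix (Fin p) (Fin q) ℝ} {N : E → Matrix (Fin q) (Fin r) ℝ}
    (hM : EntrywiseAnalytic M) (hN : EntrywiseAnalytic N) :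
    EntrywiseAnalytic fun w => M w * N w := fun i j => by
  simp only [Matrix.mul_apply]
  exact Finset.analyticOnNhd_fun_sum _ fun k _ => (hM i k).mul (hN k j)

theorem EntrywiseAnalytic.transpose {M : E → Matrix (Fin p) (Fin q) ℝ}
    (hM : EntrywiseAnalytic M) : EntrywiseAnalytic fun w => (M w)ᵀ := fun i j => hM j i

theorem entrywiseAnalytic_const (M : Matrix (Fin p) (Fin q) ℝ) :
    EntrywiseAnalytic fun _ : E => M := fun _ _ => analyticOnNhd_const

theorem EntrywiseAnalytic.det {M : E → Matrix (Fin p) (Fin p) ℝ} (hM : EntrywiseAnalytic M) :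
    AnalyticOnNhd ℝ (fun w => (M w).det) Set.univ := by
  simp only [det_apply']
  exact Finset.analyticOnNhd_fun_sum _ fun σ _ => analyticOnNhd_const.mul
    (Finset.analyticOnNhd_fun_prod _ fun i _ => hM _ _)

theorem EntrywiseAnalytic.adjugate {M : E → Matrix (Fin p) (Fin p) ℝ}
    (hM : EntrywiseAnalytic M) : EntrywiseAnalytic fun w => (M w).adjugate := fun i j => by
  simp only [adjugate_apply]
  refine EntrywiseAnalytic.det fun a b => ?_
  by_cases h : a = j
  · subst h
    simp only [updateRow_self]
    exact analyticOnNhd_const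
  · simp only [updateRow_ne h]
    exact hM a b

end EntrywiseAnalytic

theorem entrywiseAnalytic_W2of (c n : ℕ) :
    EntrywiseAnalytic fun w : Fin c × Fin n → ℝ => W2of w := fun i j =>
  (ContinuousLinearMap.proj (R := ℝ) (φ := fun _ : Fin c × Fin n => ℝ) (i, j)).analyticOnNhd _

theorem entrywiseAnalytic_rowDiff (m n : ℕ) :
    EntrywiseAnalytic fun w : Fin (m + 1) × Fin n → ℝ => rowDiff (W2of w) := fun i j =>
  (entrywiseAnalytic_W2of (m + 1) n i.castSucc j).sub
    (entrywiseAnalytic_W2of (m + 1) n (Fin.last m) j)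

theorem entrywiseAnalytic_zeroHess (c n : ℕ) :
    EntrywiseAnalytic fun w : Fin c × Fin n → ℝ => zeroHess (W2of w) := fun i j =>
  analyticOnNhd_const.mul ((((entrywiseAnalytic_W2of c n).transpose.mul
    (entrywiseAnalytic_const _)).mul (entrywiseAnalytic_W2of c n)) i j)

theorem entrywiseAnalytic_gramProj (m n : ℕ) :
    EntrywiseAnalytic fun w : Fin (m + 1) × Fin n → ℝ => gramProj (rowDiff (W2of w)) :=
  have h := entrywiseAnalytic_rowDiff m n
  (h.transpose.mul (h.mul h.transpose).adjugate).mul h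

theorem analyticOnNhd_gramDet (m n : ℕ) :
    AnalyticOnNhd ℝ (fun w : Fin (m + 1) × Fin n → ℝ => gramDet (rowDiff (W2of w))) Set.univ :=
  have h := entrywiseAnalytic_rowDiff m n
  (h.mul h.transpose).det

theorem continuous_zeroData {m n : ℕ} (ε : ℝ) : Continuous (zeroData (m := m) (n := n) ε) := by
  have hc : ∀ f : (Fin (m + 1) × Fin n → ℝ) → ℝ, AnalyticOnNhd ℝ f Set.univ → Continuous f :=
    fun f hf => continuousOn_univ.mp hf.continuousOn
  refine Continuous.prodMk (continuous_matrix fun i j => hc _ (entrywiseAnalytic_zeroHess _ n i j))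
    (Continuous.prodMk (continuous_matrix fun i j => hc _ (entrywiseAnalytic_gramProj m n i j))
      (continuous_const.mul (hc _ (analyticOnNhd_gramDet m n))))

theorem ae_ne_zero_of_analyticOnNhd_univ {ι : Type*} [Fintype ι] [Nonempty ι] {f : (ι → ℝ) → ℝ}
    (hf : AnalyticOnNhd ℝ f Set.univ) {w₀ : ι → ℝ} (h0 : f w₀ ≠ 0) : ∀ᵐ w, f w ≠ 0 := by
  refine ae_ne_zero_of_lines (continuousOn_univ.mp hf.continuousOn).measurable h0 fun θ => ?_
  refine hf.comp (g := f) (f := fun r : ℝ => r • θ + w₀) ?_ (Set.mapsTo_univ _ _)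
  exact (analyticOnNhd_id.smul analyticOnNhd_const).add analyticOnNhd_const

theorem ae_gramDet_ne_zero {m n : ℕ} (hm : 0 < m) (hmn : m < n) :
    ∀ᵐ w : Fin (m + 1) × Fin n → ℝ, gramDet (rowDiff (W2of w)) ≠ 0 := by
  have : Nonempty (Fin (m + 1) × Fin n) := ⟨(0, ⟨m, hmn⟩)⟩
  obtain ⟨w, hw, -⟩ := exists_notMem_eigenEq hm hmn 0
  exact ae_ne_zero_of_analyticOnNhd_univ (analyticOnNhd_gramDet m n) hw

theorem ae_simple_zeroHess {m n : ℕ} (hm : 0 < m) (hn : 0 < n) :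
    ∀ᵐ w : Fin (m + 1) × Fin n → ℝ, ∀ b lam, IsEigenbasis (zeroHess (W2of w)) b lam →
      Function.Injective lam := by
  have : Nonempty (Fin (m + 1) × Fin n) := ⟨(0, ⟨0, hn⟩)⟩
  obtain ⟨Q, hQ⟩ := exists_spectral_polynomial 0 n
  have hiff : ∀ M : Matrix (Fin n) (Fin n) ℝ,
      SpectrallyGeneric 0 M 0 1 ↔ ∀ b lam, IsEigenbasis M b lam → Function.Injective lam := by
    intro M
    refine forall₃_congr fun b lam _ => ⟨And.left, fun h => ⟨h, fun f => ?_⟩⟩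
    simp [quadSum]
  have han : AnalyticOnNhd ℝ (fun w : Fin (m + 1) × Fin n → ℝ =>
      specEval Q (zeroHess (W2of w), 0, 1)) Set.univ :=
    AnalyticOnNhd.specEval Q (fun i j => entrywiseAnalytic_zeroHess (m + 1) n i j)
      (fun _ _ => analyticOnNhd_const) analyticOnNhd_const
  obtain ⟨u, hu⟩ := exists_simple_famHess hm hn
  obtain ⟨W, hW, -, -⟩ := exists_weights u
  set a : ℝ := 1 / (4 * ((m : ℝ) + 1)) with ha
  have ha0 : a ≠ 0 := by
    rw [ha]
    positivity
  have h1 : SpectrallyGeneric 0 (zeroHess W) 0 1 := by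
    have := ((hiff _).mpr hu).smul ha0 one_ne_zero
    rwa [← hW, smul_zero, one_mul] at this
  have h0 : specEval Q (zeroHess (W2of fun p => W p.1 p.2), 0, 1) ≠ 0 :=
    (hQ _ _ _ (zeroHess_transpose _)).mpr h1
  filter_upwards [ae_ne_zero_of_analyticOnNhd_univ han h0] with w hw
  exact (hiff _).mp ((hQ _ _ _ (zeroHess_transpose _)).mp hw)

theorem ae_spectrallyGeneric_zeroData {m n : ℕ} (hm : 0 < m) (hmn : m < n) (ε : ℝ) :
    ∀ᵐ w : Fin (m + 1) × Fin n → ℝ,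
      SpectrallyGeneric m (zeroData ε w).1 (zeroData ε w).2.1 (zeroData ε w).2.2 := by
  have : Nonempty (Fin (m + 1) × Fin n) := ⟨(0, ⟨m, hmn⟩)⟩
  obtain ⟨Q, hQ⟩ := exists_spectral_polynomial m n
  have han : AnalyticOnNhd ℝ (fun w : Fin (m + 1) × Fin n → ℝ => specEval Q (zeroData ε w))
      Set.univ :=
    AnalyticOnNhd.specEval Q (fun i j => entrywiseAnalytic_zeroHess (m + 1) n i j)
      (fun i j => entrywiseAnalytic_gramProj m n i j)
      (analyticOnNhd_const.mul (analyticOnNhd_gramDet m n))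
  obtain ⟨w₀, -, hw₀⟩ := exists_notMem_eigenEq hm hmn ε
  have hopen : IsOpen {w : Fin (m + 1) × Fin n → ℝ | zeroData ε w ∉ eigenEq m n} :=
    (isClosed_eigenEq m n).isOpen_compl.preimage (continuous_zeroData ε)
  obtain ⟨w₁, hw₁, hs⟩ :=
    (Measure.dense_of_ae (ae_simple_zeroHess hm (hm.trans hmn))).inter_open_nonempty _ hopen
      ⟨w₀, hw₀⟩
  have h0 : specEval Q (zeroData ε w₁) ≠ 0 :=
    (hQ _ _ _ (zeroHess_transpose _)).mpr (spectrallyGeneric_of_notMem_eigenEq hw₁ hs)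
  filter_upwards [ae_ne_zero_of_analyticOnNhd_univ han h0] with w hw
  exact (hQ _ _ _ (zeroHess_transpose _)).mp hw

/-- **Top eigenspace of the output Hessian at random initialization.**  Let `S₁` be a
top-`(c−1)` eigenspace of `M` (spanned by an orthonormal family `v` of eigenvectors of
the `c−1` largest eigenvalues, encoded via an antitone enumeration `lam` of the roots
of the characteristic polynomial), and let `S₂ = (W²)ᵀ (1_c)^⊥` be the image under
`(W²)ᵀ` of the orthogonal complement of the all-ones vector, with orthonormal basis
`u`.  Then for every `ε > 0`,
`lim_{n→∞} lim_{d→∞} P[ Overlap(S₁, S₂) > 1 − ε ] = 1` (iterated limit, stated via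
the inner limits `L n`), where
`Overlap(S₁, S₂) = (∑_{a,b} ⟨v_a, u_b⟩²)/(c−1)`. -/
theorem outputHessian_top_eigenspace_overlap
    (c : ℕ) (hc : 2 ≤ c) (ε : ℝ) (hε : 0 < ε) :
    ∃ L : ℕ → ℝ≥0∞,
      (∀ n : ℕ, c ≤ n →
        Tendsto (fun d : ℕ =>
            weightMeasure c d n
              {w | ∀ lam : Fin n → ℝ, Antitone lam →
                (outputHessian c d n w).charpoly
                    = ∏ k : Fin n, (Polynomial.X - Polynomial.C (lam k)) →
                ∀ v : Fin (c - 1) → (Fin n → ℝ),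
                  (∀ (a : Fin (c - 1)) (h : (a : ℕ) < n),
                    (outputHessian c d n w).mulVec (v a) = lam ⟨a, h⟩ • v a) →
                  (∀ a b, v a ⬝ᵥ v b = if a = b then 1 else 0) →
                ∀ u : Fin (c - 1) → (Fin n → ℝ),
                  (∀ a b, u a ⬝ᵥ u b = if a = b then 1 else 0) →
                  Submodule.span ℝ (Set.range u)
                      = Submodule.map (Matrix.mulVecLin (W2of w.2)ᵀ)
                          (LinearMap.ker (sumLin c)) →
                  1 - ε < (∑ a : Fin (c - 1), ∑ b : Fin (c - 1),
                      (v a ⬝ᵥ u b) ^ 2) / ((c : ℝ) - 1)})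
          atTop (nhds (L n))) ∧
      Tendsto L atTop (nhds 1) := by
  obtain ⟨m, rfl⟩ : ∃ m, c = m + 1 := ⟨c - 1, by omega⟩
  have hm : 0 < m := by omega
  refine ⟨fun n => gaussianPi (Fin (m + 1) × Fin n) (n : ℝ≥0)⁻¹ {w | limData ε w ∉ topLE m n},
    fun n hn => ?_, tendsto_gaussianPi_limData hm hε⟩
  have hmn : m < n := hn
  have hv : (n : ℝ≥0)⁻¹ ≠ 0 := inv_ne_zero (Nat.cast_ne_zero.mpr (by omega))
  have hac := gaussianPi_absolutelyContinuous (ι := Fin (m + 1) × Fin n) hv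
  have hlim := tendsto_weightMeasure_overlapGood hm hmn.le ε
    (hac.ae_le (ae_gramDet_ne_zero hm hmn))
    (hac.ae_le (ae_limData_of_ae_zeroData hm ε (ae_spectrallyGeneric_zeroData hm hmn ε)))
  have hcm : ((m + 1 : ℕ) : ℝ) - 1 = m := by
    push_cast
    ring
  simp only [← map_ker_sumLin, OverlapGood] at hlim
  simp only [hcm]
  exact hlim
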